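/- Let G be a group satisfying hypothesis (H) that contains no element of order 6 and no element of order 27. Then G is locally finite, i.e., every finitely generated subgroup of G is finite. -/

import Mathlib

/-- A group `K` is a locally cyclic 2-group: every element has order a power of 2
and every finitely generated subgroup is cyclic. -/
def IsLocallyCyclic2Group (K : Type*) [Group K] : Prop :=
  (∀ k : K, ∃ n : ℕ, orderOf k = 2 ^ n) ∧
  ∀ S : Subgroup K, S.FG → IsCyclic S

/-- Hypothesis (H): `G` is periodic, `π(G) = {2, 3}`, and the order of the product of
any two elements of order at most 4 does not exceed 9. -/
def HypH (G : Type*) [Group G] : Prop :=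
  (∀ g : G, IsOfFinOrder g) ∧
  (∀ p : ℕ, p.Prime → ((∃ g : G, p ∣ orderOf g) ↔ p = 2 ∨ p = 3)) ∧
  ∀ x y : G, orderOf x ≤ 4 → orderOf y ≤ 4 → orderOf (x * y) ≤ 9

/-- Hypothesis (H*): `G` satisfies (H) and the centralizer of every involution of `G`
is a locally cyclic 2-group. -/
def HypHStar (G : Type*) [Group G] : Prop :=
  HypH G ∧ ∀ a : G, a ≠ 1 → a ^ 2 = 1 →
    IsLocallyCyclic2Group (Subgroup.centralizer {a})

set_option linter.all false

/-! ## A verified coset-enumeration checker -/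

namespace TC

/-- Read entry `k` of a table packed into a natural number (12 bits per entry). -/
def get (T k : ℕ) : ℕ := (T >>> (12 * k)) % 4096

/-- Write an entry (only used when the old entry is zero). -/
def put (T k v : ℕ) : ℕ := T ||| (v <<< (12 * k))

theorem get_testBit (T k i : ℕ) : (get T k).testBit i = (decide (i < 12) && T.testBit (12 * k + i)) := by
  have : get T k = (T >>> (12 * k)) % 2 ^ 12 := rfl
  rw [this, Nat.testBit_mod_two_pow, Nat.testBit_shiftRight]

theorem get_put (T k v k' : ℕ) (hv : v < 4096) (h0 : get T k = 0) :
    get (put T k v) k' = if k' = k then v else get T k' := by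
  have hv' : v < 2 ^ 12 := by simpa using hv
  apply Nat.eq_of_testBit_eq
  intro i
  have h0i : ∀ j, j < 12 → T.testBit (12 * k + j) = false := by
    intro j hj
    have := get_testBit T k j
    rw [h0] at this
    simpa [hj] using this.symm
  have hvi : ∀ j, 12 ≤ j → v.testBit j = false := fun j hj =>
    Nat.testBit_lt_two_pow (lt_of_lt_of_le hv' (Nat.pow_le_pow_right (by norm_num) hj))
  rw [get_testBit]
  unfold put
  rw [Nat.testBit_or, Nat.testBit_shiftLeft]
  by_cases hi : i < 12
  · split_ifs with hk
    · subst hk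
      simp [hi, h0i i hi]
    · rw [get_testBit]
      rcases lt_or_gt_of_ne hk with h | h
      · have : ¬ (12 * k ≤ 12 * k' + i) := by omega
        simp [hi, this]
      · have : v.testBit (12 * k' + i - 12 * k) = false := hvi _ (by omega)
        simp [hi, this]
  · split_ifs with hk
    · simp [hi, hvi i (by omega)]
    · rw [get_testBit]
      simp [hi]

/-- Root of the coset `c` in the coincidence forest (letter `0` is the identity). -/
def find (K T : ℕ) : ℕ → ℕ → ℕ
  | 0, c => c
  | f + 1, c => match get T (c * K) with
    | 0 => c
    | p + 1 => find K T f p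

/-- Table look-up: `0` means undefined, `e + 1` means coset `e`. -/
def look (K T c g : ℕ) : ℕ := match get T (c * K + g) with
  | 0 => 0
  | e + 1 => find K T 100 e + 1

/-- Record `a * g = f`, or queue a coincidence. -/
def half (K T : ℕ) (q : List (ℕ × ℕ)) (a g f : ℕ) : ℕ × List (ℕ × ℕ) :=
  match look K T a g with
  | 0 => match Nat.ble (f + 2) 4096 && Nat.beq (get T (a * K + g)) 0 with
    | true => (put T (a * K + g) (f + 1), q)
    | false => (T, q)
  | h + 1 => match Nat.beq h f with
    | true => (T, q)
    | false => (T, (h, f) :: q)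

/-- Record `a * g = f` together with the inverse edge. -/
def edge (K : ℕ) (inv : List ℕ) (s : ℕ × List (ℕ × ℕ)) (a g f : ℕ) : ℕ × List (ℕ × ℕ) :=
  match s with
  | (T, q) => match half K T q a g f with
    | (T', q') => half K T' q' f (inv.getD g 0) a

/-- Move the row of `b` to the row of `a`. -/
def row (K : ℕ) (inv : List ℕ) (a b : ℕ) : ℕ → ℕ × List (ℕ × ℕ) → ℕ × List (ℕ × ℕ)
  | 0, s => s
  | g + 1, s => match row K inv a b g s with
    | (T, q) => match look K T b (g + 1) with
      | 0 => (T, q)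
      | f + 1 => edge K inv (T, q) a (g + 1) f

/-- Work through the queue of coincidences. -/
def drain (K : ℕ) (inv : List ℕ) : ℕ → ℕ × List (ℕ × ℕ) → ℕ
  | 0, (T, _) => T
  | _ + 1, (T, []) => T
  | n + 1, (T, (a, b) :: q) =>
    match Nat.beq (find K T 100 a) (find K T 100 b) with
    | true => drain K inv n (T, q)
    | false => match Nat.ble (find K T 100 a) (find K T 100 b) with
      | true => drain K inv n (row K inv (find K T 100 a) (find K T 100 b) (K - 1)
          (half K T q (find K T 100 b) 0 (find K T 100 a)))
      | false => drain K inv n (row K inv (find K T 100 b) (find K T 100 a) (K - 1)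
          (half K T q (find K T 100 a) 0 (find K T 100 b)))

/-- Scan a word forwards: the coset reached and the unread part. -/
def fwd (K T : ℕ) : ℕ → List ℕ → ℕ × List ℕ
  | c, [] => (c, [])
  | c, g :: w => match look K T c g with
    | 0 => (c, g :: w)
    | d + 1 => fwd K T d w

/-- Scan a reversed word backwards. -/
def bwd (K T : ℕ) (inv : List ℕ) : ℕ → List ℕ → Option ℕ
  | c, [] => some c
  | c, g :: w => match look K T c (inv.getD g 0) with
    | 0 => none
    | d + 1 => bwd K T inv d w

/-- Scan a relator at `c` and use the outcome if at most one letter is missing. -/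
def scan (K : ℕ) (inv : List ℕ) (T c : ℕ) (w : List ℕ) : ℕ :=
  match fwd K T c w with
  | (d, []) => drain K inv 1000 (T, [(d, c)])
  | (d, g :: u) => match bwd K T inv c u.reverse with
    | none => T
    | some e => drain K inv 1000 (edge K inv (T, []) d g e)

/-- Check that a word fixes coset `0`. -/
def fixes (K T : ℕ) (w : List ℕ) : Bool :=
  match fwd K T 0 w with
  | (0, []) => true
  | _ => false

/-- The main loop. -/
def run (K B : ℕ) (inv : List ℕ) (rels : List (List ℕ)) (subs : List (List ℕ)) (tgt : List ℕ) :
    List ℕ → ℕ → ℕ → Bool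
  | [], T, _ => fixes K T tgt
  | o :: os, T, n =>
    match Nat.ble (o % B + 1) K with
    | true => match Nat.ble (o / B + 1) n with
      | true => match drain K inv 1000 (edge K inv (T, []) (find K T 100 (o / B)) (o % B) n) with
        | 0 => run K B inv rels subs tgt os 0 (n + 1)
        | T' + 1 => run K B inv rels subs tgt os (T' + 1) (n + 1)
      | false => false
    | false => match rels[o % B - K]? with
      | some w => match scan K inv T (find K T 100 (o / B)) w with
        | 0 => run K B inv rels subs tgt os 0 n
        | T' + 1 => run K B inv rels subs tgt os (T' + 1) n
      | none => match scan K inv T 0 (subs.getD (o % B - K - rels.length) []) with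
        | 0 => run K B inv rels subs tgt os 0 n
        | T' + 1 => run K B inv rels subs tgt os (T' + 1) n

end TC

namespace TC

section sound
variable {G : Type*} [Group G]

/-- `v c * gen g` and `v d` lie in the same right coset of `H`. -/
def Rel (H : Subgroup G) (gen : ℕ → G) (v : ℕ → G) (c g d : ℕ) : Prop :=
  v c * gen g * (v d)⁻¹ ∈ H

/-- All table entries are correct. -/
def Good (H : Subgroup G) (gen : ℕ → G) (v : ℕ → G) (K T : ℕ) : Prop :=
  ∀ c g, g < K → get T (c * K + g) ≠ 0 → Rel H gen v c g (get T (c * K + g) - 1)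

/-- Two coset representatives are equivalent. -/
def Same (H : Subgroup G) (v : ℕ → G) (c d : ℕ) : Prop := v c * (v d)⁻¹ ∈ H

variable {H : Subgroup G} {gen : ℕ → G} {v : ℕ → G} {K : ℕ} {T : ℕ} {inv : List ℕ}

theorem Same.refl (c : ℕ) : Same H v c c := by simp [Same, H.one_mem]

theorem Same.symm {c d : ℕ} (h : Same H v c d) : Same H v d c := by
  have := H.inv_mem h
  simpa [Same] using this

theorem Same.trans {c d e : ℕ} (h : Same H v c d) (h' : Same H v d e) : Same H v c e := by
  have := H.mul_mem h h'
  simpa [Same, mul_assoc] using this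

theorem Rel.left {c c' g d : ℕ} (h : Rel H gen v c g d) (h' : Same H v c' c) :
    Rel H gen v c' g d := by
  have := H.mul_mem h' h
  simpa [Rel, mul_assoc] using this

theorem Rel.right {c g d d' : ℕ} (h : Rel H gen v c g d) (h' : Same H v d d') :
    Rel H gen v c g d' := by
  have := H.mul_mem h h'
  simpa [Rel, mul_assoc] using this

theorem Rel.same {c g d d' : ℕ} (h : Rel H gen v c g d) (h' : Rel H gen v c g d') :
    Same H v d d' := by
  have := H.mul_mem (H.inv_mem h) h'
  simpa [Same, mul_assoc] using this

theorem find_same (h1 : gen 0 = 1) (hK : 0 < K) (hT : Good H gen v K T) :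
    ∀ f c, Same H v c (find K T f c)
  | 0, c => Same.refl c
  | f + 1, c => by
    unfold find
    split
    · exact Same.refl c
    · rename_i p hp
      have := hT c 0 hK (by simp [hp])
      simp only [add_zero, hp] at this
      have h2 : Same H v c p := by simpa [Rel, Same, h1] using this
      exact h2.trans (find_same h1 hK hT f p)

theorem look_rel (h1 : gen 0 = 1) (hT : Good H gen v K T) {c g d : ℕ} (hg : g < K)
    (h : look K T c g = d + 1) : Rel H gen v c g d := by
  unfold look at h
  split at h
  · exact absurd h (by simp)
  · rename_i e he
    have := hT c g hg (by simp [he])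
    simp only [he] at this
    have h2 := find_same h1 (Nat.zero_lt_of_lt hg) hT 100 e
    have h3 : find K T 100 e = d := by simpa using h
    rw [h3] at h2
    exact this.right h2

/-- Correctness of the queue. -/
def GoodQ (H : Subgroup G) (v : ℕ → G) (q : List (ℕ × ℕ)) : Prop :=
  ∀ p ∈ q, Same H v p.1 p.2

theorem half_good (h1 : gen 0 = 1) (hT : Good H gen v K T) {q : List (ℕ × ℕ)} (hq : GoodQ H v q)
    {a g f : ℕ} (hg : g < K) (hr : Rel H gen v a g f) :
    Good H gen v K (half K T q a g f).1 ∧ GoodQ H v (half K T q a g f).2 := by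
  unfold half
  split
  · split
    · rename_i hb
      simp only [Bool.and_eq_true, Nat.ble_eq] at hb
      have hb2 := Nat.eq_of_beq_eq_true hb.2
      refine ⟨?_, hq⟩
      intro c g' hg' hne
      have hgp := get_put T (a * K + g) (f + 1) (c * K + g') (by omega) hb2
      rw [hgp] at hne ⊢
      split_ifs at hne ⊢ with hk
      · have hg2 : g' = g := by
          have := congrArg (· % K) hk
          simpa [Nat.add_mod, Nat.mod_eq_of_lt hg, Nat.mod_eq_of_lt hg'] using this
        subst hg2
        have hc : c = a := by
          have h3 : c * K = a * K := by omega
          exact Nat.eq_of_mul_eq_mul_right (Nat.zero_lt_of_lt hg) h3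
        subst hc
        simpa using hr
      · exact hT c g' hg' hne
    · exact ⟨hT, hq⟩
  · rename_i h hh
    have := look_rel h1 hT hg hh
    split
    · exact ⟨hT, hq⟩
    · refine ⟨hT, ?_⟩
      intro p hp
      rcases List.mem_cons.1 hp with rfl | hp
      · exact this.same hr
      · exact hq p hp

theorem edge_good (h1 : gen 0 = 1) (hinv : ∀ g < K, inv.getD g 0 < K ∧ gen (inv.getD g 0) = (gen g)⁻¹)
    (hT : Good H gen v K T) {q : List (ℕ × ℕ)} (hq : GoodQ H v q)
    {a g f : ℕ} (hg : g < K) (hr : Rel H gen v a g f) :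
    Good H gen v K (edge K inv (T, q) a g f).1 ∧ GoodQ H v (edge K inv (T, q) a g f).2 := by
  have h2 := half_good h1 hT hq hg hr
  have h3 : Rel H gen v f (inv.getD g 0) a := by
    have := H.inv_mem hr
    simpa only [Rel, (hinv g hg).2, mul_inv_rev, inv_inv, mul_assoc] using this
  exact half_good h1 h2.1 h2.2 (hinv g hg).1 h3

theorem row_good (h1 : gen 0 = 1) (hinv : ∀ g < K, inv.getD g 0 < K ∧ gen (inv.getD g 0) = (gen g)⁻¹)
    {a b : ℕ} (hab : Same H v a b) :
    ∀ g, g < K → ∀ s : ℕ × List (ℕ × ℕ), Good H gen v K s.1 → GoodQ H v s.2 →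
    Good H gen v K (row K inv a b g s).1 ∧ GoodQ H v (row K inv a b g s).2
  | 0, _, s, hT, hq => ⟨hT, hq⟩
  | g + 1, hg, s, hT, hq => by
    have ih := row_good h1 hinv hab g (by omega) s hT hq
    unfold row
    split
    rename_i T q hs
    rw [hs] at ih
    split
    · exact ih
    · rename_i f hf
      exact edge_good h1 hinv ih.1 ih.2 hg ((look_rel h1 ih.1 hg hf).left hab)

theorem drain_good (h1 : gen 0 = 1) (hK : 0 < K)
    (hinv : ∀ g < K, inv.getD g 0 < K ∧ gen (inv.getD g 0) = (gen g)⁻¹) :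
    ∀ n, ∀ s : ℕ × List (ℕ × ℕ), Good H gen v K s.1 → GoodQ H v s.2 →
    Good H gen v K (drain K inv n s)
  | 0, (T, q), hT, hq => by simpa [drain] using hT
  | n + 1, (T, []), hT, hq => by simpa [drain] using hT
  | n + 1, (T, (a, b) :: q), hT, hq => by
    have hq' : GoodQ H v q := fun p hp => hq p (List.mem_cons_of_mem _ hp)
    have hab : Same H v a b := hq (a, b) (by simp)
    have hT' : Good H gen v K T := hT
    have hs : Same H v (find K T 100 a) (find K T 100 b) :=
      ((find_same h1 hK hT' 100 a).symm.trans hab).trans (find_same h1 hK hT' 100 b)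
    have r1 : ∀ c d, Same H v c d → Rel H gen v c 0 d := by
      intro c d h
      simpa [Rel, Same, h1] using h
    unfold drain
    split
    · exact drain_good h1 hK hinv n _ hT' hq'
    · split
      · have h2 := half_good h1 hT' hq' hK (r1 _ _ hs.symm)
        have h3 := row_good h1 hinv hs (K - 1) (by omega) _ h2.1 h2.2
        exact drain_good h1 hK hinv n _ h3.1 h3.2
      · have h2 := half_good h1 hT' hq' hK (r1 _ _ hs)
        have h3 := row_good h1 hinv hs.symm (K - 1) (by omega) _ h2.1 h2.2
        exact drain_good h1 hK hinv n _ h3.1 h3.2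

/-- Value of a word. -/
def val (gen : ℕ → G) (w : List ℕ) : G := (w.map gen).prod

theorem fwd_good (h1 : gen 0 = 1) (hT : Good H gen v K T) :
    ∀ (w : List ℕ) (c : ℕ), (∀ g ∈ w, g < K) →
    (∀ g ∈ (fwd K T c w).2, g < K) ∧
    v c * val gen w * (val gen (fwd K T c w).2)⁻¹ * (v (fwd K T c w).1)⁻¹ ∈ H
  | [], c, _ => by simp [fwd, val, H.one_mem]
  | g :: w, c, hw => by
    unfold fwd
    split
    · exact ⟨hw, by simp [H.one_mem]⟩
    · rename_i d hd
      have ih := fwd_good h1 hT w d (fun x hx => hw x (by simp [hx]))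
      refine ⟨ih.1, ?_⟩
      have h2 := look_rel h1 hT (hw g (by simp)) hd
      have := H.mul_mem h2 ih.2
      simpa [val, mul_assoc] using this

theorem bwd_good (h1 : gen 0 = 1) (hT : Good H gen v K T)
    (hinv : ∀ g < K, inv.getD g 0 < K ∧ gen (inv.getD g 0) = (gen g)⁻¹) :
    ∀ (w : List ℕ) (c d : ℕ), (∀ g ∈ w, g < K) → bwd K T inv c w = some d →
    v d * val gen w.reverse * (v c)⁻¹ ∈ H
  | [], c, d, _, h => by
    have : c = d := by simpa [bwd] using h
    subst this
    simp [val, H.one_mem]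
  | g :: w, c, d, hw, h => by
    unfold bwd at h
    split at h
    · exact absurd h (by simp)
    · rename_i e he
      have hg := hw g (by simp)
      have ih := bwd_good h1 hT hinv w e d (fun x hx => hw x (by simp [hx])) h
      have h2 := look_rel h1 hT (hinv g hg).1 he
      have h3 := H.inv_mem h2
      rw [(hinv g hg).2] at h3
      have := H.mul_mem ih h3
      simpa [val, mul_assoc] using this

theorem scan_good (h1 : gen 0 = 1) (hK : 0 < K)
    (hinv : ∀ g < K, inv.getD g 0 < K ∧ gen (inv.getD g 0) = (gen g)⁻¹)
    (hT : Good H gen v K T) {w : List ℕ} {c : ℕ} (hw : ∀ g ∈ w, g < K)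
    (hc : v c * val gen w * (v c)⁻¹ ∈ H) : Good H gen v K (scan K inv T c w) := by
  have hf := fwd_good h1 hT w c hw
  unfold scan
  split
  · rename_i d hd
    rw [hd] at hf
    refine drain_good h1 hK hinv _ _ hT ?_
    intro p hp
    have : p = (d, c) := by simpa using hp
    subst this
    have h2 := H.mul_mem (H.inv_mem hf.2) hc
    simpa [Same, val, mul_assoc] using h2
  · rename_i d g u hd
    rw [hd] at hf
    split
    · exact hT
    · rename_i e he
      have hb := bwd_good h1 hT hinv u.reverse c e
        (fun x hx => hf.1 x (by simp at hx; simp [hx])) he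
      rw [List.reverse_reverse] at hb
      have h2 := H.mul_mem (H.mul_mem (H.inv_mem hf.2) hc) (H.inv_mem hb)
      have h3 : Rel H gen v d g e := by
        simpa [Rel, val, mul_assoc] using h2
      have h4 := edge_good h1 hinv hT (q := []) (by intro p hp; simp at hp) (hf.1 g (by simp)) h3
      exact drain_good h1 hK hinv _ _ h4.1 h4.2

/-- The coset representatives agree with the definitions in the trace. -/
def Defd (gen : ℕ → G) (v : ℕ → G) (K B : ℕ) : List ℕ → ℕ → Prop
  | [], _ => True
  | o :: os, n => if o % B < K then (o / B < n → v n = v (o / B) * gen (o % B)) ∧ Defd gen v K B os (n + 1)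
      else Defd gen v K B os n

theorem exists_defd (gen : ℕ → G) (K B : ℕ) : ∀ (os : List ℕ) (n : ℕ) (v0 : ℕ → G),
    ∃ v : ℕ → G, (∀ j < n, v j = v0 j) ∧ Defd gen v K B os n
  | [], n, v0 => ⟨v0, fun _ _ => rfl, trivial⟩
  | o :: os, n, v0 => by
    by_cases h : o % B < K
    · obtain ⟨v, hv, hd⟩ := exists_defd gen K B os (n + 1)
        (Function.update v0 n (v0 (o / B) * gen (o % B)))
      refine ⟨v, fun j hj => ?_, ?_⟩
      · rw [hv j (by omega), Function.update_of_ne (by omega)]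
      · simp only [Defd, h, if_true]
        refine ⟨fun hn => ?_, hd⟩
        rw [hv n (by omega), Function.update_self, hv (o / B) (by omega),
          Function.update_of_ne (by omega)]
    · obtain ⟨v, hv, hd⟩ := exists_defd gen K B os n v0
      exact ⟨v, hv, by simpa only [Defd, h, if_false] using hd⟩

theorem run_good (h1 : gen 0 = 1) (hK : 0 < K)
    (hinv : ∀ g < K, inv.getD g 0 < K ∧ gen (inv.getD g 0) = (gen g)⁻¹) (B : ℕ)
    (rels subs : List (List ℕ)) (tgt : List ℕ)
    (hrk : ∀ w ∈ rels, ∀ g ∈ w, g < K) (hsk : ∀ w ∈ subs, ∀ g ∈ w, g < K)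
    (htk : ∀ g ∈ tgt, g < K)
    (hrel : ∀ w ∈ rels, val gen w = 1) (hsub : ∀ w ∈ subs, val gen w ∈ H)
    (hv0 : v 0 = 1) :
    ∀ (os : List ℕ) (T n : ℕ), Good H gen v K T → Defd gen v K B os n →
      run K B inv rels subs tgt os T n = true → val gen tgt ∈ H
  | [], T, n, hT, _, h => by
    unfold run fixes at h
    have hf := fwd_good h1 hT tgt 0 htk
    split at h
    · rename_i hs
      rw [hs] at hf
      simpa [hv0, val] using hf.2
    · exact absurd h (by simp)
  | o :: os, T, n, hT, hd, h => by
    have ih := run_good h1 hK hinv B rels subs tgt hrk hsk htk hrel hsub hv0 os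
    have fs := find_same h1 hK hT 100 (o / B)
    unfold run at h
    split at h
    · rename_i hb
      have hb : o % B < K := by simpa [Nat.succ_le_iff] using hb
      simp only [Defd, hb, if_true] at hd
      split at h
      · rename_i hn
        have hn : o / B < n := by simpa [Nat.succ_le_iff] using hn
        have hr : Rel H gen v (o / B) (o % B) n := by
          simp [Rel, hd.1 hn, H.one_mem]
        have h4 := edge_good h1 hinv hT (q := []) (by intro p hp; simp at hp) hb (hr.left fs.symm)
        have h5 := drain_good h1 hK hinv 1000 _ h4.1 h4.2
        split at h
        · rename_i h0
          rw [h0] at h5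
          exact ih _ _ h5 hd.2 h
        · rename_i h0
          rw [h0] at h5
          exact ih _ _ h5 hd.2 h
      · exact absurd h (by simp)
    · rename_i hb
      have hb : ¬ o % B < K := by
        intro h'
        have : Nat.ble (o % B + 1) K = true := by simpa [Nat.succ_le_iff] using h'
        simp_all
      simp only [Defd, hb, if_false] at hd
      split at h
      · rename_i w hw
        have hw' : w ∈ rels := List.mem_of_getElem? hw
        have h5 := scan_good (c := find K T 100 (o / B)) h1 hK hinv hT (hrk w hw')
          (by rw [hrel w hw']; simp [H.one_mem])
        split at h
        · rename_i h0
          rw [h0] at h5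
          exact ih _ _ h5 hd h
        · rename_i h0
          rw [h0] at h5
          exact ih _ _ h5 hd h
      · have hs : subs.getD (o % B - K - rels.length) [] ∈ subs ∨
            subs.getD (o % B - K - rels.length) [] = [] := by
          rw [List.getD_eq_getElem?_getD]
          cases hx : subs[o % B - K - rels.length]? with
          | none => right; rfl
          | some w => left; exact List.mem_of_getElem? hx
        have h5 := scan_good (c := 0) (w := subs.getD (o % B - K - rels.length) []) h1 hK hinv hT
          (by
            rcases hs with hs | hs
            · exact hsk _ hs
            · rw [hs]; simp)
          (by
            rcases hs with hs | hs
            · simpa [hv0] using hsub _ hs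
            · rw [hs]; simp [hv0, val, H.one_mem])
        split at h
        · rename_i h0
          rw [h0] at h5
          exact ih _ _ h5 hd h
        · rename_i h0
          rw [h0] at h5
          exact ih _ _ h5 hd h

/-- Well-formedness of the input: all letters are in range. -/
def wf (K : ℕ) (inv : List ℕ) (rels subs : List (List ℕ)) (tgt : List ℕ) : Bool :=
  decide (0 < K) && inv.all (fun g => decide (g < K)) && rels.all (fun w => w.all (fun g => decide (g < K))) &&
    subs.all (fun w => w.all (fun g => decide (g < K))) && tgt.all (fun g => decide (g < K))

/-- Soundness of the coset enumeration. `gs` lists the letters (letter `0` is `1`). -/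
theorem sound (H : Subgroup G) (gs : List G) (inv : List ℕ) (rels subs : List (List ℕ))
    (tgt : List ℕ) (B : ℕ) (os : List ℕ)
    (h0 : gs.getD 0 1 = 1)
    (hwf : wf inv.length inv rels subs tgt = true)
    (hinv : ∀ g < inv.length, gs.getD (inv.getD g 0) 1 = (gs.getD g 1)⁻¹)
    (hrel : ∀ w ∈ rels, val (fun g => gs.getD g 1) w = 1)
    (hsub : ∀ w ∈ subs, val (fun g => gs.getD g 1) w ∈ H)
    (hrun : run inv.length B inv rels subs tgt os 0 1 = true) :
    val (fun g => gs.getD g 1) tgt ∈ H := by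
  simp only [wf, Bool.and_eq_true, decide_eq_true_eq, List.all_eq_true] at hwf
  obtain ⟨⟨⟨⟨hK, hi⟩, hr⟩, hs⟩, ht⟩ := hwf
  obtain ⟨v, hv, hd⟩ := exists_defd (fun g => gs.getD g 1) inv.length B os 1 (fun _ => (1 : G))
  refine run_good (v := v) (K := inv.length) (inv := inv) (by simpa using h0) hK ?_ B rels subs tgt hr hs ht
    hrel hsub (hv 0 (by omega)) os 0 1 ?_ hd hrun
  · intro g hg
    refine ⟨?_, hinv g hg⟩
    rw [List.getD_eq_getElem _ _ hg]
    exact hi _ (List.getElem_mem hg)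
  · intro c g _ hne
    simp [get] at hne

end sound
end TC

set_option maxRecDepth 100000 in
theorem tc_F8 {G : Type*} [Group G] (H : Subgroup G) (i x : G)
    (h0 : i ^ 4 = 1)
    (h1 : x ^ 3 = 1)
    (h2 : (i ^ 2 * x) ^ 2 = 1)
    (h3 : (i * x) ^ 8 = 1)
    (h4 : (i⁻¹ * x * i * x⁻¹) ^ 9 = 1) (hs0 : i ∈ H) :
    (i * x) ^ 4 ∈ H := by
  have hrun : TC.run 5 11 [0, 2, 1, 4, 3]
    [[1, 1, 1, 1],
      [3, 3, 3],
      [1, 1, 3, 1, 1, 3],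
      [1, 3, 1, 3, 1, 3, 1, 3, 1, 3, 1, 3, 1, 3, 1, 3],
      [2, 3, 1, 4, 2, 3, 1, 4, 2, 3, 1, 4, 2, 3, 1, 4, 2, 3, 1, 4, 2, 3, 1, 4, 2, 3, 1, 4, 2, 3, 1, 4, 2, 3, 1, 4]]
    [[1]] [1, 3, 1, 3, 1, 3, 1, 3]
    [
    10, 3, 12, 25, 34, 47, 56, 69, 78, 91, 100, 113, 122, 135, 144, 8, 6, 7, 28, 124, 166, 180,
    189, 201, 210, 224, 233, 245, 254, 268, 277, 289, 298, 312, 321, 333, 342, 356, 365, 377,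
    386, 400, 409, 421, 430, 444, 453, 465, 9, 16, 40, 49, 476, 485, 499, 508, 520, 529, 543,
    552, 564, 573, 587, 596, 608, 617, 631, 640, 652, 661, 675, 684, 696, 705, 719, 728, 740,
    749, 763, 772, 784, 793, 807, 20, 29, 94, 126, 128, 139, 535, 544, 546, 555, 579, 590, 599,
    623, 797, 70, 827, 839, 848, 862, 871, 883, 892, 906, 915, 927, 936, 950, 959, 971, 980,
    994, 1003, 1015, 1024, 1038, 1047, 1059, 1068, 1082, 1091, 31, 441, 1115, 1124, 1136, 1145,
    1159, 1168, 1180, 1189, 1203, 1212, 1224, 1233, 1247, 1256, 1268, 1277, 1291, 1300, 1312,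
    1321, 1335, 1344, 1356, 1365, 1379, 1388, 1400, 1409, 42, 818, 1432, 1444, 1453, 1467,
    1476, 1488, 1497, 1511, 1520, 1532, 1541, 1555, 1564, 1576, 1585, 1599, 1608, 1620, 1629,
    1643, 1652, 1664, 1673, 1687, 1696, 1708, 1717, 1731, 1740, 1752, 53, 62, 72, 73, 84, 93,
    95, 106, 743, 830, 832, 854, 863, 865, 898, 907, 909, 918, 942, 1040, 1112, 51, 434, 840,
    1784, 842, 542, 1805, 74, 545, 774, 1828, 1840, 1849, 1863, 1872, 1884, 1893, 1907, 1916,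
    1928, 1937, 1951, 1960, 1972, 1981, 1995, 2004, 2016, 2025, 2039, 2048, 2060, 2069, 2083,
    2092, 2104, 2113, 2127, 86, 765, 777, 789, 886, 1800, 1809, 1931, 1932, 2042, 432, 861,
    2157, 2171, 2180, 2192, 2201, 2215, 2224, 2236, 2245, 2259, 2268, 2280, 2289, 2303, 2312,
    2324, 2333, 2347, 2356, 2368, 97, 974, 976, 1052, 1118, 1151, 1162, 1195, 1206, 1239, 1250,
    1283, 1294, 1327, 565, 2389, 568, 920, 921] 0 1 = true := by decide +kernel
  have key := TC.sound H [1, i, i⁻¹, x, x⁻¹] [0, 2, 1, 4, 3] _ _ _ _ _ (by simp) (by decide +kernel)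
    (by
      intro g hg
      simp only [List.length_cons, List.length_nil] at hg
      interval_cases g <;> simp)
    (by
      simp only [List.mem_cons, List.not_mem_nil, or_false]
      rintro w (rfl | rfl | rfl | rfl | rfl)
      · simpa only [TC.val, List.map, List.prod_cons, List.prod_nil, List.getD_cons_zero, List.getD_cons_succ,
        pow_succ, pow_zero, one_mul, mul_one, mul_assoc] using h0
      · simpa only [TC.val, List.map, List.prod_cons, List.prod_nil, List.getD_cons_zero, List.getD_cons_succ,
        pow_succ, pow_zero, one_mul, mul_one, mul_assoc] using h1
      · simpa only [TC.val, List.map, List.prod_cons, List.prod_nil, List.getD_cons_zero, List.getD_cons_succ,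
        pow_succ, pow_zero, one_mul, mul_one, mul_assoc] using h2
      · simpa only [TC.val, List.map, List.prod_cons, List.prod_nil, List.getD_cons_zero, List.getD_cons_succ,
        pow_succ, pow_zero, one_mul, mul_one, mul_assoc] using h3
      · simpa only [TC.val, List.map, List.prod_cons, List.prod_nil, List.getD_cons_zero, List.getD_cons_succ,
        pow_succ, pow_zero, one_mul, mul_one, mul_assoc] using h4)
    (by
      simp only [List.mem_cons, List.not_mem_nil, or_false]
      rintro w rfl
      · simpa only [TC.val, List.map, List.prod_cons, List.prod_nil, List.getD_cons_zero, List.getD_cons_succ,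
        pow_succ, pow_zero, one_mul, mul_one, mul_assoc] using hs0) hrun
  simpa only [TC.val, List.map, List.prod_cons, List.prod_nil, List.getD_cons_zero, List.getD_cons_succ,
        pow_succ, pow_zero, one_mul, mul_one, mul_assoc] using key

set_option maxRecDepth 100000 in
theorem tc_F9 {G : Type*} [Group G] (H : Subgroup G) (i x : G)
    (h0 : i ^ 4 = 1)
    (h1 : x ^ 3 = 1)
    (h2 : (i ^ 2 * x) ^ 2 = 1)
    (h3 : (i * x) ^ 9 = 1)
    (h4 : (i⁻¹ * x * i * x) ^ 9 = 1)
    (h5 : (i⁻¹ * x * i * x⁻¹) ^ 9 = 1) (hs0 : i ∈ H) :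
    x ∈ H := by
  have hrun : TC.run 5 12 [0, 2, 1, 4, 3]
    [[1, 1, 1, 1],
      [3, 3, 3],
      [1, 1, 3, 1, 1, 3],
      [1, 3, 1, 3, 1, 3, 1, 3, 1, 3, 1, 3, 1, 3, 1, 3, 1, 3],
      [2, 3, 1, 3, 2, 3, 1, 3, 2, 3, 1, 3, 2, 3, 1, 3, 2, 3, 1, 3, 2, 3, 1, 3, 2, 3, 1, 3, 2, 3, 1, 3, 2, 3, 1, 3],
      [2, 3, 1, 4, 2, 3, 1, 4, 2, 3, 1, 4, 2, 3, 1, 4, 2, 3, 1, 4, 2, 3, 1, 4, 2, 3, 1, 4, 2, 3, 1, 4, 2, 3, 1, 4]]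
    [[1]] [3]
    [
    11, 3, 13, 27, 37, 51, 61, 75, 85, 99, 109, 123, 133, 147, 157, 171, 181, 8, 7, 159, 205,
    220, 230, 243, 253, 268, 278, 291, 301, 316, 326, 339, 349, 364, 374, 387, 397, 412, 422,
    435, 445, 460, 470, 483, 493, 508, 518, 531, 10, 38, 555, 565, 579, 590, 603, 613, 627,
    638, 651, 661, 675, 686, 699, 709, 723, 734, 747, 757, 771, 782, 795, 805, 819, 830, 843,
    853, 867, 9, 6, 17, 30, 43, 150, 543, 889, 903, 914, 927, 937, 951, 962, 975, 985, 999,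
    1010, 1023, 1033, 1047, 1058, 1071, 1081, 1095, 1106, 1119, 1129, 1143, 1154, 1167, 1177,
    1191, 1202, 21, 31, 54, 161, 211, 221, 223, 233, 259, 269, 271, 281, 307, 317, 319, 329,
    355, 365, 367, 377, 403, 413, 415, 425, 451, 461, 463, 135, 1225, 1240, 1250, 1263, 1273,
    1288, 1298, 1311, 1321, 1336, 1346, 1359, 1369, 1384, 1394, 1407, 1417, 1432, 1442, 1455,
    1465, 1480, 1490, 1503, 1513, 22, 126, 163, 870, 871, 1231, 1241, 1243, 1253, 1279, 1291,
    1327, 1337, 1339, 1349, 76, 1538, 1551, 1561, 1576, 1586, 1599, 1609, 1624, 1634, 1647,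
    1657, 1672, 1682, 1695, 1705, 1720, 1730, 1743, 1753, 1768, 1778, 1791, 1801, 1816, 1826,
    34, 67, 77, 78, 79, 1541, 1567, 1577, 1579, 1615, 1627, 580, 1850, 1863, 1873, 1888, 1898,
    1911, 1921, 1936, 1946, 1959, 1969, 1984, 1994, 2007, 2017, 2032, 2042, 2055, 2065, 2080,
    2090, 2103, 2113, 2128, 2138, 2151, 2161, 46, 139, 1506, 1507, 219, 2185, 2200, 2210, 2223,
    2233, 2248, 2258, 2271, 2281, 2296, 2306, 2319, 2329, 2344, 2354, 2367, 2377, 2392, 2402,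
    2415, 2425, 2440, 2450, 2463, 2473, 2488, 2498, 58, 91, 101, 115, 1543, 2154, 111, 102,
    103, 2141, 1552, 2534, 2547, 2557, 1554, 495, 2582, 2595, 2605, 2619, 2630, 2643, 2653,
    2667, 2678, 2691, 2701, 2715, 2726, 2739, 2749, 2763, 2774, 2787, 2797, 2811, 2822, 2835,
    2845, 2859, 2870, 2883, 2893, 2907, 81, 1239, 2929, 2943, 2953, 80, 1179, 2977, 2992, 3002,
    3015, 3025, 3040, 3050, 3063, 3073, 3088, 3098, 3111, 3121, 3136, 3146, 3159, 3169, 3184,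
    3194, 3207, 3217, 82, 1242, 1458, 2550, 2140, 3242, 3255, 3265, 3280, 3290, 3303, 3313,
    3328, 3338, 3351, 3361, 3376, 3386, 3399, 3409, 3424, 3434, 3447, 3457, 3472, 3482, 3495,
    3505, 3520, 3530, 3543, 3553, 94, 2551, 2910, 2957, 1803, 3578, 3591, 3601, 3615, 3626,
    1575, 3649, 3664, 3674, 3687, 3697, 3712, 3722, 3735, 3745, 3760, 3770, 3783, 3793, 3808,
    3818, 3831, 3841, 3856, 3866, 3879, 3889, 106, 1492, 3914, 3927, 3937, 3952, 3962, 1482,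
    1495, 1555, 1794, 1795, 2563, 2573, 2946, 2475, 3986, 3999, 4009, 4023, 4034, 4047, 4057,
    4071, 4082, 4095, 4105, 4119, 4130, 4143, 4153, 4167, 4178, 4191, 4201, 4215, 4226, 4239,
    4249, 4263, 4274, 4287, 4297, 4311, 129, 2571, 4333, 128, 1255, 2959, 3546, 3547, 2913,
    2924, 3901, 4359, 4370, 4383, 4393, 4407, 4418, 4431, 4441, 4455, 4466, 4479, 4489, 4503,
    4514, 4527, 4537, 4551, 4562, 4575, 4585, 141, 1256, 1314, 1362, 1398, 1770, 3223, 3224] 0 1 = true := by decide +kernel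
  have key := TC.sound H [1, i, i⁻¹, x, x⁻¹] [0, 2, 1, 4, 3] _ _ _ _ _ (by simp) (by decide +kernel)
    (by
      intro g hg
      simp only [List.length_cons, List.length_nil] at hg
      interval_cases g <;> simp)
    (by
      simp only [List.mem_cons, List.not_mem_nil, or_false]
      rintro w (rfl | rfl | rfl | rfl | rfl | rfl)
      · simpa only [TC.val, List.map, List.prod_cons, List.prod_nil, List.getD_cons_zero, List.getD_cons_succ,
        pow_succ, pow_zero, one_mul, mul_one, mul_assoc] using h0
      · simpa only [TC.val, List.map, List.prod_cons, List.prod_nil, List.getD_cons_zero, List.getD_cons_succ,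
        pow_succ, pow_zero, one_mul, mul_one, mul_assoc] using h1
      · simpa only [TC.val, List.map, List.prod_cons, List.prod_nil, List.getD_cons_zero, List.getD_cons_succ,
        pow_succ, pow_zero, one_mul, mul_one, mul_assoc] using h2
      · simpa only [TC.val, List.map, List.prod_cons, List.prod_nil, List.getD_cons_zero, List.getD_cons_succ,
        pow_succ, pow_zero, one_mul, mul_one, mul_assoc] using h3
      · simpa only [TC.val, List.map, List.prod_cons, List.prod_nil, List.getD_cons_zero, List.getD_cons_succ,
        pow_succ, pow_zero, one_mul, mul_one, mul_assoc] using h4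
      · simpa only [TC.val, List.map, List.prod_cons, List.prod_nil, List.getD_cons_zero, List.getD_cons_succ,
        pow_succ, pow_zero, one_mul, mul_one, mul_assoc] using h5)
    (by
      simp only [List.mem_cons, List.not_mem_nil, or_false]
      rintro w rfl
      · simpa only [TC.val, List.map, List.prod_cons, List.prod_nil, List.getD_cons_zero, List.getD_cons_succ,
        pow_succ, pow_zero, one_mul, mul_one, mul_assoc] using hs0) hrun
  simpa only [TC.val, List.map, List.prod_cons, List.prod_nil, List.getD_cons_zero, List.getD_cons_succ,
        pow_succ, pow_zero, one_mul, mul_one, mul_assoc] using key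

set_option maxRecDepth 100000 in
theorem tc_C88_8 {G : Type*} [Group G] (H : Subgroup G) (a b y : G) (ha : a ^ 2 = 1) (hb : b ^ 2 = 1)
    (h0 : y ^ 3 = 1)
    (h1 : (a * b) ^ 2 = 1)
    (h2 : (a * y) ^ 2 = 1)
    (h3 : (b * y) ^ 8 = 1)
    (h4 : (a * b * y) ^ 8 = 1)
    (h5 : (b * y⁻¹ * a * b * y) ^ 8 = 1) (hs0 : a ∈ H) (hs1 : b ∈ H) :
    y ∈ H := by
  have hia : a⁻¹ = a := inv_eq_of_mul_eq_one_left (by rw [← sq, ha])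
  have hib : b⁻¹ = b := inv_eq_of_mul_eq_one_left (by rw [← sq, hb])
  have hrun : TC.run 5 13 [0, 1, 2, 4, 3]
    [[3, 3, 3],
      [1, 2, 1, 2],
      [1, 3, 1, 3],
      [2, 3, 2, 3, 2, 3, 2, 3, 2, 3, 2, 3, 2, 3, 2, 3],
      [1, 2, 3, 1, 2, 3, 1, 2, 3, 1, 2, 3, 1, 2, 3, 1, 2, 3, 1, 2, 3, 1, 2, 3],
      [2, 4, 1, 2, 3, 2, 4, 1, 2, 3, 2, 4, 1, 2, 3, 2, 4, 1, 2, 3, 2, 4, 1, 2, 3, 2, 4, 1, 2, 3, 2, 4, 1, 2, 3, 2, 4, 1, 2, 3]]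
    [[1], [2]] [3]
    [
    11, 12, 3, 15, 29, 41, 55, 67, 81, 93, 107, 119, 133, 145, 159, 171, 8, 5, 7, 19, 46, 58,
    72, 84, 56, 196, 210, 224, 236, 251, 261, 275, 289, 301, 316, 326, 340, 354, 366, 381, 391,
    405, 419, 431, 446, 456, 470, 484, 496, 511, 521, 10, 172, 547, 561, 575, 586, 600, 614,
    625, 639, 653, 664, 678, 692, 703, 717, 9, 31, 33, 57, 59, 161, 201, 552, 592, 604, 631,
    643, 705, 743, 758, 768, 782, 796, 808, 823, 833, 847, 861, 873, 888, 898, 912, 926, 938,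
    953, 963, 977, 991, 1003, 1018, 1028, 23, 773, 757, 1055, 1069, 1081, 1095, 1107, 34, 577,
    579, 747, 761, 785, 1060, 1072, 536, 1132, 1146, 1160, 1171, 1185, 48, 228, 1137, 120,
    1210, 1224, 1238, 1249, 1263, 1277, 1288, 1302, 74, 82, 1327, 1341, 85, 798, 1215, 1255,
    1043, 1366, 1380, 1394, 87, 1173, 1419, 1433, 1445, 1459, 1471, 1485, 1497, 86, 800, 1240,
    1293, 1297] 0 1 = true := by decide +kernel
  have key := TC.sound H [1, a, b, y, y⁻¹] [0, 1, 2, 4, 3] _ _ _ _ _ (by simp) (by decide +kernel)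
    (by
      intro g hg
      simp only [List.length_cons, List.length_nil] at hg
      interval_cases g <;> simp [hia, hib])
    (by
      simp only [List.mem_cons, List.not_mem_nil, or_false]
      rintro w (rfl | rfl | rfl | rfl | rfl | rfl)
      · simpa only [TC.val, List.map, List.prod_cons, List.prod_nil, List.getD_cons_zero, List.getD_cons_succ,
        pow_succ, pow_zero, one_mul, mul_one, mul_assoc] using h0
      · simpa only [TC.val, List.map, List.prod_cons, List.prod_nil, List.getD_cons_zero, List.getD_cons_succ,
        pow_succ, pow_zero, one_mul, mul_one, mul_assoc] using h1
      · simpa only [TC.val, List.map, List.prod_cons, List.prod_nil, List.getD_cons_zero, List.getD_cons_succ,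
        pow_succ, pow_zero, one_mul, mul_one, mul_assoc] using h2
      · simpa only [TC.val, List.map, List.prod_cons, List.prod_nil, List.getD_cons_zero, List.getD_cons_succ,
        pow_succ, pow_zero, one_mul, mul_one, mul_assoc] using h3
      · simpa only [TC.val, List.map, List.prod_cons, List.prod_nil, List.getD_cons_zero, List.getD_cons_succ,
        pow_succ, pow_zero, one_mul, mul_one, mul_assoc] using h4
      · simpa only [TC.val, List.map, List.prod_cons, List.prod_nil, List.getD_cons_zero, List.getD_cons_succ,
        pow_succ, pow_zero, one_mul, mul_one, mul_assoc] using h5)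
    (by
      simp only [List.mem_cons, List.not_mem_nil, or_false]
      rintro w (rfl | rfl)
      · simpa only [TC.val, List.map, List.prod_cons, List.prod_nil, List.getD_cons_zero, List.getD_cons_succ,
        pow_succ, pow_zero, one_mul, mul_one, mul_assoc] using hs0
      · simpa only [TC.val, List.map, List.prod_cons, List.prod_nil, List.getD_cons_zero, List.getD_cons_succ,
        pow_succ, pow_zero, one_mul, mul_one, mul_assoc] using hs1) hrun
  simpa only [TC.val, List.map, List.prod_cons, List.prod_nil, List.getD_cons_zero, List.getD_cons_succ,
        pow_succ, pow_zero, one_mul, mul_one, mul_assoc] using key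

set_option maxRecDepth 100000 in
theorem tc_C99_8 {G : Type*} [Group G] (H : Subgroup G) (a b y : G) (ha : a ^ 2 = 1) (hb : b ^ 2 = 1)
    (h0 : y ^ 3 = 1)
    (h1 : (a * b) ^ 2 = 1)
    (h2 : (a * y) ^ 2 = 1)
    (h3 : (b * y) ^ 9 = 1)
    (h4 : (a * b * y) ^ 9 = 1)
    (h5 : (b * y⁻¹ * a * b * y) ^ 8 = 1) (hs0 : a ∈ H) (hs1 : b ∈ H) :
    y ∈ H := by
  have hia : a⁻¹ = a := inv_eq_of_mul_eq_one_left (by rw [← sq, ha])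
  have hib : b⁻¹ = b := inv_eq_of_mul_eq_one_left (by rw [← sq, hb])
  have hrun : TC.run 5 13 [0, 1, 2, 4, 3]
    [[3, 3, 3],
      [1, 2, 1, 2],
      [1, 3, 1, 3],
      [2, 3, 2, 3, 2, 3, 2, 3, 2, 3, 2, 3, 2, 3, 2, 3, 2, 3],
      [1, 2, 3, 1, 2, 3, 1, 2, 3, 1, 2, 3, 1, 2, 3, 1, 2, 3, 1, 2, 3, 1, 2, 3, 1, 2, 3],
      [2, 4, 1, 2, 3, 2, 4, 1, 2, 3, 2, 4, 1, 2, 3, 2, 4, 1, 2, 3, 2, 4, 1, 2, 3, 2, 4, 1, 2, 3, 2, 4, 1, 2, 3, 2, 4, 1, 2, 3]]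
    [[1], [2]] [3]
    [
    11, 12, 4, 14, 28, 42, 54, 69, 79, 93, 107, 119, 134, 144, 158, 172, 184, 199, 209, 223,
    237, 249, 264, 274, 288, 302, 314, 329, 339, 353, 367, 379, 394, 404, 418, 432, 444, 459,
    469, 10, 3, 496, 510, 522, 536, 548, 562, 574, 588, 600, 614, 626, 640, 652, 8, 5, 7, 19,
    59, 70, 71, 72, 84, 96, 149, 214, 553, 565, 579, 591, 484, 677, 691, 705, 716, 730, 744,
    755, 769, 783, 794, 808, 822, 833, 847, 861, 872, 886, 9, 44, 46, 682, 722, 734, 874, 912,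
    926, 938, 952, 964, 978, 990, 1004, 1016, 21, 709, 916, 563, 1041, 1055, 1069, 1081, 1096,
    1106, 1120, 1134, 1146, 1161, 1171, 1185, 1199, 1211, 1226, 1236, 1250, 1264, 1276, 1291,
    1301, 1315, 1329, 1341, 23, 419, 1366, 1380, 1394, 1405, 1419, 1433, 1444, 1458, 22, 109,
    111, 566, 1371, 1411, 1423, 1342, 1484, 1498, 1510, 1524, 1536, 1550, 1562, 73, 124, 136,
    137, 161, 421, 133, 1588, 1603, 1613, 1627, 1641, 1653, 1446, 1679, 1693, 1705, 1719, 1731,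
    1745, 1757, 1771, 1783, 1797, 86, 354, 1821, 1835, 1849, 1860, 1874, 1888, 1899, 1913,
    1927, 1938, 1952, 87, 135, 150, 176, 590, 592, 1046, 1086, 1098, 1099, 1123, 1422, 1540,
    1606, 1943, 1694, 1977, 1991, 2005, 2017, 2032, 2042, 2056, 2070, 2082, 2097, 2107, 2121,
    2135, 2147, 2162, 2172, 2186, 2200, 2212, 2227, 2237, 2251, 101, 1695, 2263, 2277, 2291,
    2303, 2318, 2328, 2342, 2356, 2368, 2383, 2393, 2407, 2421, 2433, 2448, 2458, 2472, 2486,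
    2498, 2513, 2523, 114, 1095, 2550, 2564, 2576, 2590, 2602, 2616, 2628, 112, 1097, 1112,
    1396, 1398, 1683, 1697, 1710, 1722, 1982, 1983, 2031, 2654, 2668, 2680, 138, 1940, 2705,
    2719, 2733, 2744, 2758, 2772, 139, 189, 201, 202, 226, 1826, 1866, 1878, 1905, 1917, 1929,
    2785, 2797, 1877, 198, 2823, 200, 215, 2658, 2812, 2848, 2862, 2876, 2888, 2903, 2913,
    2927, 2941, 2953, 2968, 2978, 2992, 3006, 3018, 3033, 3043, 3057, 3071, 3083, 3098, 3108,
    3122, 166, 2837, 3148, 164, 3134, 3174, 3188, 3200, 3215, 3225, 3239, 3253, 3265, 3280,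
    3290, 3304, 3318, 3330, 3345, 3355, 3369, 3383, 3395, 3410, 3420, 179, 1723, 2022, 2034,
    2592, 2853, 2918, 2983, 3048, 1667, 3447, 3461, 3473, 3487, 3499, 3513, 3525, 177, 1851,
    1853, 2801, 2815, 2816, 248, 3551, 3565, 3576, 3590, 3604, 3615, 3629, 3643, 3654, 3668,
    3682, 3693, 3707, 3721, 3732, 3746, 217, 253, 254, 2007, 2009, 2540, 3698, 3713, 3073,
    3075, 3077] 0 1 = true := by decide +kernel
  have key := TC.sound H [1, a, b, y, y⁻¹] [0, 1, 2, 4, 3] _ _ _ _ _ (by simp) (by decide +kernel)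
    (by
      intro g hg
      simp only [List.length_cons, List.length_nil] at hg
      interval_cases g <;> simp [hia, hib])
    (by
      simp only [List.mem_cons, List.not_mem_nil, or_false]
      rintro w (rfl | rfl | rfl | rfl | rfl | rfl)
      · simpa only [TC.val, List.map, List.prod_cons, List.prod_nil, List.getD_cons_zero, List.getD_cons_succ,
        pow_succ, pow_zero, one_mul, mul_one, mul_assoc] using h0
      · simpa only [TC.val, List.map, List.prod_cons, List.prod_nil, List.getD_cons_zero, List.getD_cons_succ,
        pow_succ, pow_zero, one_mul, mul_one, mul_assoc] using h1
      · simpa only [TC.val, List.map, List.prod_cons, List.prod_nil, List.getD_cons_zero, List.getD_cons_succ,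
        pow_succ, pow_zero, one_mul, mul_one, mul_assoc] using h2
      · simpa only [TC.val, List.map, List.prod_cons, List.prod_nil, List.getD_cons_zero, List.getD_cons_succ,
        pow_succ, pow_zero, one_mul, mul_one, mul_assoc] using h3
      · simpa only [TC.val, List.map, List.prod_cons, List.prod_nil, List.getD_cons_zero, List.getD_cons_succ,
        pow_succ, pow_zero, one_mul, mul_one, mul_assoc] using h4
      · simpa only [TC.val, List.map, List.prod_cons, List.prod_nil, List.getD_cons_zero, List.getD_cons_succ,
        pow_succ, pow_zero, one_mul, mul_one, mul_assoc] using h5)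
    (by
      simp only [List.mem_cons, List.not_mem_nil, or_false]
      rintro w (rfl | rfl)
      · simpa only [TC.val, List.map, List.prod_cons, List.prod_nil, List.getD_cons_zero, List.getD_cons_succ,
        pow_succ, pow_zero, one_mul, mul_one, mul_assoc] using hs0
      · simpa only [TC.val, List.map, List.prod_cons, List.prod_nil, List.getD_cons_zero, List.getD_cons_succ,
        pow_succ, pow_zero, one_mul, mul_one, mul_assoc] using hs1) hrun
  simpa only [TC.val, List.map, List.prod_cons, List.prod_nil, List.getD_cons_zero, List.getD_cons_succ,
        pow_succ, pow_zero, one_mul, mul_one, mul_assoc] using key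

set_option maxRecDepth 100000 in
theorem tc_D8 {G : Type*} [Group G] (H : Subgroup G) (a p y : G) (ha : a ^ 2 = 1) (hp : p ^ 2 = 1)
    (h0 : (a * p) ^ 4 = 1)
    (h1 : y ^ 3 = 1)
    (h2 : ((a * p) ^ 2 * y) ^ 2 = 1)
    (h3 : (a * y) ^ 3 = 1)
    (h4 : (p * a * p * y) ^ 4 = 1)
    (h5 : (p * y) ^ 3 = 1)
    (h6 : (a * p * a * y) ^ 4 = 1)
    (h7 : (a * p * y) ^ 8 = 1) (hs0 : a ∈ H) (hs1 : p ∈ H) :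
    y ∈ H := by
  have hia : a⁻¹ = a := inv_eq_of_mul_eq_one_left (by rw [← sq, ha])
  have hip : p⁻¹ = p := inv_eq_of_mul_eq_one_left (by rw [← sq, hp])
  have hrun : TC.run 5 15 [0, 1, 2, 4, 3]
    [[1, 2, 1, 2, 1, 2, 1, 2],
      [3, 3, 3],
      [1, 2, 1, 2, 3, 1, 2, 1, 2, 3],
      [1, 3, 1, 3, 1, 3],
      [2, 1, 2, 3, 2, 1, 2, 3, 2, 1, 2, 3, 2, 1, 2, 3],
      [2, 3, 2, 3, 2, 3],
      [1, 2, 1, 3, 1, 2, 1, 3, 1, 2, 1, 3, 1, 2, 1, 3],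
      [1, 2, 3, 1, 2, 3, 1, 2, 3, 1, 2, 3, 1, 2, 3, 1, 2, 3, 1, 2, 3, 1, 2, 3]]
    [[1], [2]] [3]
    [
    13, 14, 3, 16, 32, 48, 61, 77, 93, 106, 122, 138, 151, 167, 183, 196, 212, 228, 241, 257,
    273, 286, 302, 12, 17, 10, 7, 51, 33, 8, 331, 20, 55, 68, 81, 83, 85, 157] 0 1 = true := by decide +kernel
  have key := TC.sound H [1, a, p, y, y⁻¹] [0, 1, 2, 4, 3] _ _ _ _ _ (by simp) (by decide +kernel)
    (by
      intro g hg
      simp only [List.length_cons, List.length_nil] at hg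
      interval_cases g <;> simp [hia, hip])
    (by
      simp only [List.mem_cons, List.not_mem_nil, or_false]
      rintro w (rfl | rfl | rfl | rfl | rfl | rfl | rfl | rfl)
      · simpa only [TC.val, List.map, List.prod_cons, List.prod_nil, List.getD_cons_zero, List.getD_cons_succ,
        pow_succ, pow_zero, one_mul, mul_one, mul_assoc] using h0
      · simpa only [TC.val, List.map, List.prod_cons, List.prod_nil, List.getD_cons_zero, List.getD_cons_succ,
        pow_succ, pow_zero, one_mul, mul_one, mul_assoc] using h1
      · simpa only [TC.val, List.map, List.prod_cons, List.prod_nil, List.getD_cons_zero, List.getD_cons_succ,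
        pow_succ, pow_zero, one_mul, mul_one, mul_assoc] using h2
      · simpa only [TC.val, List.map, List.prod_cons, List.prod_nil, List.getD_cons_zero, List.getD_cons_succ,
        pow_succ, pow_zero, one_mul, mul_one, mul_assoc] using h3
      · simpa only [TC.val, List.map, List.prod_cons, List.prod_nil, List.getD_cons_zero, List.getD_cons_succ,
        pow_succ, pow_zero, one_mul, mul_one, mul_assoc] using h4
      · simpa only [TC.val, List.map, List.prod_cons, List.prod_nil, List.getD_cons_zero, List.getD_cons_succ,
        pow_succ, pow_zero, one_mul, mul_one, mul_assoc] using h5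
      · simpa only [TC.val, List.map, List.prod_cons, List.prod_nil, List.getD_cons_zero, List.getD_cons_succ,
        pow_succ, pow_zero, one_mul, mul_one, mul_assoc] using h6
      · simpa only [TC.val, List.map, List.prod_cons, List.prod_nil, List.getD_cons_zero, List.getD_cons_succ,
        pow_succ, pow_zero, one_mul, mul_one, mul_assoc] using h7)
    (by
      simp only [List.mem_cons, List.not_mem_nil, or_false]
      rintro w (rfl | rfl)
      · simpa only [TC.val, List.map, List.prod_cons, List.prod_nil, List.getD_cons_zero, List.getD_cons_succ,
        pow_succ, pow_zero, one_mul, mul_one, mul_assoc] using hs0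
      · simpa only [TC.val, List.map, List.prod_cons, List.prod_nil, List.getD_cons_zero, List.getD_cons_succ,
        pow_succ, pow_zero, one_mul, mul_one, mul_assoc] using hs1) hrun
  simpa only [TC.val, List.map, List.prod_cons, List.prod_nil, List.getD_cons_zero, List.getD_cons_succ,
        pow_succ, pow_zero, one_mul, mul_one, mul_assoc] using key

set_option maxRecDepth 100000 in
theorem tc_E8_8 {G : Type*} [Group G] (H : Subgroup G) (s x : G) (hs : s ^ 2 = 1)
    (h0 : x ^ 3 = 1)
    (h1 : (s * x⁻¹ * s * x) ^ 4 = 1)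
    (h2 : (s * x) ^ 8 = 1)
    (h3 : (s * x * s * x * s * x⁻¹) ^ 8 = 1) (hs0 : s ∈ H) :
    x ∈ H := by
  have his : s⁻¹ = s := inv_eq_of_mul_eq_one_left (by rw [← sq, hs])
  have hrun : TC.run 4 9 [0, 1, 3, 2]
    [[2, 2, 2],
      [1, 3, 1, 2, 1, 3, 1, 2, 1, 3, 1, 2, 1, 3, 1, 2],
      [1, 2, 1, 2, 1, 2, 1, 2, 1, 2, 1, 2, 1, 2, 1, 2],
      [1, 2, 1, 2, 1, 3, 1, 2, 1, 2, 1, 3, 1, 2, 1, 2, 1, 3, 1, 2, 1, 2, 1, 3, 1, 2, 1, 2, 1, 3, 1, 2, 1, 2, 1, 3, 1, 2, 1, 2, 1, 3, 1, 2, 1, 2, 1, 3]]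
    [[1]] [2]
    [
    8, 2, 11, 4, 19, 29, 37, 10, 56, 64, 75, 82, 92, 100, 110, 118, 129, 136, 146, 154, 164,
    172, 183, 190, 200, 208, 218, 226, 237, 244, 254, 262, 272, 280, 291, 298, 308, 316, 326,
    334, 345, 352, 362, 370, 380, 388, 399, 406, 416, 424, 7, 74, 442, 452, 460, 470, 478, 488,
    496, 6, 31, 58, 76, 453, 514, 524, 532, 542, 550, 561, 568, 578, 586, 596, 604, 615, 622,
    632, 640, 650, 658, 669, 676, 686, 694, 704, 712, 723, 730, 740, 748, 758, 766, 777, 784,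
    794, 802, 812, 820, 16, 497, 838, 849, 856, 23, 47, 874, 884, 892, 902, 910, 24, 392, 400,
    454, 472, 490, 885, 928, 938, 946, 500, 886, 907] 0 1 = true := by decide +kernel
  have key := TC.sound H [1, s, x, x⁻¹] [0, 1, 3, 2] _ _ _ _ _ (by simp) (by decide +kernel)
    (by
      intro g hg
      simp only [List.length_cons, List.length_nil] at hg
      interval_cases g <;> simp [his])
    (by
      simp only [List.mem_cons, List.not_mem_nil, or_false]
      rintro w (rfl | rfl | rfl | rfl)
      · simpa only [TC.val, List.map, List.prod_cons, List.prod_nil, List.getD_cons_zero, List.getD_cons_succ,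
        pow_succ, pow_zero, one_mul, mul_one, mul_assoc] using h0
      · simpa only [TC.val, List.map, List.prod_cons, List.prod_nil, List.getD_cons_zero, List.getD_cons_succ,
        pow_succ, pow_zero, one_mul, mul_one, mul_assoc] using h1
      · simpa only [TC.val, List.map, List.prod_cons, List.prod_nil, List.getD_cons_zero, List.getD_cons_succ,
        pow_succ, pow_zero, one_mul, mul_one, mul_assoc] using h2
      · simpa only [TC.val, List.map, List.prod_cons, List.prod_nil, List.getD_cons_zero, List.getD_cons_succ,
        pow_succ, pow_zero, one_mul, mul_one, mul_assoc] using h3)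
    (by
      simp only [List.mem_cons, List.not_mem_nil, or_false]
      rintro w rfl
      · simpa only [TC.val, List.map, List.prod_cons, List.prod_nil, List.getD_cons_zero, List.getD_cons_succ,
        pow_succ, pow_zero, one_mul, mul_one, mul_assoc] using hs0) hrun
  simpa only [TC.val, List.map, List.prod_cons, List.prod_nil, List.getD_cons_zero, List.getD_cons_succ,
        pow_succ, pow_zero, one_mul, mul_one, mul_assoc] using key

set_option maxRecDepth 100000 in
theorem tc_C88_9 {G : Type*} [Group G] (H : Subgroup G) (a b y : G) (ha : a ^ 2 = 1) (hb : b ^ 2 = 1)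
    (h0 : y ^ 3 = 1)
    (h1 : (a * b) ^ 2 = 1)
    (h2 : (a * y) ^ 2 = 1)
    (h3 : (b * y) ^ 8 = 1)
    (h4 : (a * b * y) ^ 8 = 1)
    (h5 : (b * y⁻¹ * a * b * y) ^ 9 = 1) (hs0 : a ∈ H) (hs1 : b ∈ H) :
    y ∈ H := by
  have hia : a⁻¹ = a := inv_eq_of_mul_eq_one_left (by rw [← sq, ha])
  have hib : b⁻¹ = b := inv_eq_of_mul_eq_one_left (by rw [← sq, hb])
  have hrun : TC.run 5 13 [0, 1, 2, 4, 3]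
    [[3, 3, 3],
      [1, 2, 1, 2],
      [1, 3, 1, 3],
      [2, 3, 2, 3, 2, 3, 2, 3, 2, 3, 2, 3, 2, 3, 2, 3],
      [1, 2, 3, 1, 2, 3, 1, 2, 3, 1, 2, 3, 1, 2, 3, 1, 2, 3, 1, 2, 3, 1, 2, 3],
      [2, 4, 1, 2, 3, 2, 4, 1, 2, 3, 2, 4, 1, 2, 3, 2, 4, 1, 2, 3, 2, 4, 1, 2, 3, 2, 4, 1, 2, 3, 2, 4, 1, 2, 3, 2, 4, 1, 2, 3, 2, 4, 1, 2, 3]]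
    [[1], [2]] [3]
    [
    11, 12, 3, 14, 7, 5, 15, 42, 54, 68, 80, 94, 106, 120, 132, 146, 158, 172, 8, 69, 196, 210,
    224, 236, 251, 261, 275, 289, 301, 316, 326, 340, 354, 366, 381, 391, 405, 419, 431, 446,
    456, 470, 484, 496, 511, 521, 535, 549, 561, 576, 586, 600, 614, 626, 641, 10, 185, 664,
    678, 692, 703, 717, 731, 742, 756, 770, 781, 795, 809, 820, 834, 9, 19, 44, 46, 59, 70, 71,
    72, 85, 97, 174, 201, 669, 709, 721, 748, 760, 822, 860, 875, 885, 899, 913, 925, 940, 950,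
    964, 978, 990, 1005, 1015, 1029, 1043, 1055, 1070, 1080, 1094, 1108, 1120, 1135, 1145,
    1159, 1173, 1185, 1200, 1210, 23, 601, 1236, 1250, 1264, 1275, 1289, 35, 228, 890, 1241,
    95, 1314, 1328, 1342, 1354, 874, 1380, 1394, 1406, 1420, 1432, 34, 98, 694, 696, 864, 878,
    902, 1385, 1397, 1315, 1459, 1470, 1484, 1498, 1509, 1523, 87, 1319, 1346, 1225, 1548,
    1562, 1576, 100, 1277, 1601, 1615, 1627, 1641, 1653, 1667, 1679, 99, 917, 1359, 1371, 1461,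
    1475, 1514, 1518, 1658] 0 1 = true := by decide +kernel
  have key := TC.sound H [1, a, b, y, y⁻¹] [0, 1, 2, 4, 3] _ _ _ _ _ (by simp) (by decide +kernel)
    (by
      intro g hg
      simp only [List.length_cons, List.length_nil] at hg
      interval_cases g <;> simp [hia, hib])
    (by
      simp only [List.mem_cons, List.not_mem_nil, or_false]
      rintro w (rfl | rfl | rfl | rfl | rfl | rfl)
      · simpa only [TC.val, List.map, List.prod_cons, List.prod_nil, List.getD_cons_zero, List.getD_cons_succ,
        pow_succ, pow_zero, one_mul, mul_one, mul_assoc] using h0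
      · simpa only [TC.val, List.map, List.prod_cons, List.prod_nil, List.getD_cons_zero, List.getD_cons_succ,
        pow_succ, pow_zero, one_mul, mul_one, mul_assoc] using h1
      · simpa only [TC.val, List.map, List.prod_cons, List.prod_nil, List.getD_cons_zero, List.getD_cons_succ,
        pow_succ, pow_zero, one_mul, mul_one, mul_assoc] using h2
      · simpa only [TC.val, List.map, List.prod_cons, List.prod_nil, List.getD_cons_zero, List.getD_cons_succ,
        pow_succ, pow_zero, one_mul, mul_one, mul_assoc] using h3
      · simpa only [TC.val, List.map, List.prod_cons, List.prod_nil, List.getD_cons_zero, List.getD_cons_succ,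
        pow_succ, pow_zero, one_mul, mul_one, mul_assoc] using h4
      · simpa only [TC.val, List.map, List.prod_cons, List.prod_nil, List.getD_cons_zero, List.getD_cons_succ,
        pow_succ, pow_zero, one_mul, mul_one, mul_assoc] using h5)
    (by
      simp only [List.mem_cons, List.not_mem_nil, or_false]
      rintro w (rfl | rfl)
      · simpa only [TC.val, List.map, List.prod_cons, List.prod_nil, List.getD_cons_zero, List.getD_cons_succ,
        pow_succ, pow_zero, one_mul, mul_one, mul_assoc] using hs0
      · simpa only [TC.val, List.map, List.prod_cons, List.prod_nil, List.getD_cons_zero, List.getD_cons_succ,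
        pow_succ, pow_zero, one_mul, mul_one, mul_assoc] using hs1) hrun
  simpa only [TC.val, List.map, List.prod_cons, List.prod_nil, List.getD_cons_zero, List.getD_cons_succ,
        pow_succ, pow_zero, one_mul, mul_one, mul_assoc] using key

set_option maxRecDepth 100000 in
theorem tc_C99_9 {G : Type*} [Group G] (H : Subgroup G) (a b y : G) (ha : a ^ 2 = 1) (hb : b ^ 2 = 1)
    (h0 : y ^ 3 = 1)
    (h1 : (a * b) ^ 2 = 1)
    (h2 : (a * y) ^ 2 = 1)
    (h3 : (b * y) ^ 9 = 1)
    (h4 : (a * b * y) ^ 9 = 1)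
    (h5 : (b * y⁻¹ * a * b * y) ^ 9 = 1) (hs0 : a ∈ H) (hs1 : b ∈ H) :
    y ∈ H := by
  have hia : a⁻¹ = a := inv_eq_of_mul_eq_one_left (by rw [← sq, ha])
  have hib : b⁻¹ = b := inv_eq_of_mul_eq_one_left (by rw [← sq, hb])
  have hrun : TC.run 5 13 [0, 1, 2, 4, 3]
    [[3, 3, 3],
      [1, 2, 1, 2],
      [1, 3, 1, 3],
      [2, 3, 2, 3, 2, 3, 2, 3, 2, 3, 2, 3, 2, 3, 2, 3, 2, 3],
      [1, 2, 3, 1, 2, 3, 1, 2, 3, 1, 2, 3, 1, 2, 3, 1, 2, 3, 1, 2, 3, 1, 2, 3, 1, 2, 3],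
      [2, 4, 1, 2, 3, 2, 4, 1, 2, 3, 2, 4, 1, 2, 3, 2, 4, 1, 2, 3, 2, 4, 1, 2, 3, 2, 4, 1, 2, 3, 2, 4, 1, 2, 3, 2, 4, 1, 2, 3, 2, 4, 1, 2, 3]]
    [[1], [2]] [3]
    [
    11, 12, 3, 15, 29, 41, 55, 67, 81, 93, 107, 119, 133, 145, 159, 171, 185, 197, 8, 5, 7, 19,
    46, 58, 72, 84, 98, 110, 56, 222, 236, 250, 262, 277, 287, 301, 315, 327, 342, 352, 366,
    380, 392, 407, 417, 431, 445, 457, 472, 482, 496, 510, 522, 537, 547, 561, 575, 587, 602,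
    612, 10, 198, 638, 652, 666, 677, 691, 705, 716, 730, 744, 755, 769, 783, 794, 808, 822,
    833, 847, 9, 31, 33, 57, 59, 161, 187, 227, 292, 357, 643, 683, 695, 835, 873, 888, 898,
    912, 926, 938, 953, 963, 977, 991, 1003, 1018, 1028, 1042, 1056, 1068, 1083, 1093, 1107,
    1121, 1133, 1148, 1158, 1172, 1186, 1198, 1213, 1223, 23, 903, 887, 1250, 1264, 1276, 1290,
    1302, 1316, 1328, 34, 627, 1353, 1367, 1381, 1392, 1406, 1420, 1431, 1445, 48, 252, 254,
    670, 877, 891, 915, 1255, 1267, 1281, 1358, 1398, 1410, 796, 1471, 1485, 1497, 1511, 1523,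
    1537, 1549, 1563, 1575, 60, 267, 279, 280, 629, 146, 1600, 1614, 1628, 1639, 1653, 1667,
    1678, 1692, 1706, 1717, 1731, 74, 82, 1238, 1769, 1783, 1797, 1808, 1822, 1836, 1847, 1861,
    1875, 1886, 87, 85, 83, 135, 930, 1605, 1645, 1657, 1684, 1696, 1722, 1433, 1913, 1409,
    120, 1938, 1952, 1966, 1977, 1991, 2005, 2016, 2030, 2044, 2055, 2069, 100, 108, 2094,
    2108, 2122, 2134, 2149, 2159, 2173, 109, 111, 317, 1943, 1970, 1982, 2022, 2034, 2061, 562,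
    113, 2060, 1849, 2212, 2226, 2238, 2252, 2264, 2278, 2290, 112, 1810, 2316, 2331, 2341,
    2355, 2369, 2381, 2396, 2406, 2420, 2434, 2446, 2461, 2471, 2485, 2499, 2511, 2526, 2536,
    2550, 2564, 2576, 127, 1383, 1385, 1917, 2007, 2148, 2602, 2616, 2628, 2642, 2654, 2668,
    2680, 138, 1669, 1671, 2009, 2033, 2216, 2243, 2255, 2294, 1928, 2705, 2719, 2733, 2745,
    2760, 2770, 2784, 2798, 2810, 2825, 2835, 2849, 2863, 2875, 2890, 2900, 2914, 2928, 2940,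
    2955, 2965, 2979, 2993, 3005, 3020, 3030, 3044, 244, 1931, 3056, 3070, 3084, 3096, 3111,
    3121, 3135, 3149, 3161, 3176, 3186, 3200, 3214, 3226, 3241, 3251, 3265, 3279, 3291, 3306,
    3316, 3330, 3344, 3356, 3371, 3381, 257, 2710, 2759, 3408, 3422, 3434, 281, 332, 344, 345,
    369, 564, 341, 3460, 343, 358, 3412, 3474, 3486, 307, 2750, 2291, 3512, 3526, 3538, 3552,
    3564, 3578, 3590, 346, 391, 3616, 3630, 3641, 3655, 3669, 3680, 3694, 3708, 3719, 3733,
    3747, 3758, 3772, 3786, 3797, 3811, 360, 396, 397, 410, 434, 2280, 3568, 3569, 3595, 3762,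
    3720, 3838, 3850, 372, 2620, 3516, 3530, 3542, 3764, 3780] 0 1 = true := by decide +kernel
  have key := TC.sound H [1, a, b, y, y⁻¹] [0, 1, 2, 4, 3] _ _ _ _ _ (by simp) (by decide +kernel)
    (by
      intro g hg
      simp only [List.length_cons, List.length_nil] at hg
      interval_cases g <;> simp [hia, hib])
    (by
      simp only [List.mem_cons, List.not_mem_nil, or_false]
      rintro w (rfl | rfl | rfl | rfl | rfl | rfl)
      · simpa only [TC.val, List.map, List.prod_cons, List.prod_nil, List.getD_cons_zero, List.getD_cons_succ,
        pow_succ, pow_zero, one_mul, mul_one, mul_assoc] using h0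
      · simpa only [TC.val, List.map, List.prod_cons, List.prod_nil, List.getD_cons_zero, List.getD_cons_succ,
        pow_succ, pow_zero, one_mul, mul_one, mul_assoc] using h1
      · simpa only [TC.val, List.map, List.prod_cons, List.prod_nil, List.getD_cons_zero, List.getD_cons_succ,
        pow_succ, pow_zero, one_mul, mul_one, mul_assoc] using h2
      · simpa only [TC.val, List.map, List.prod_cons, List.prod_nil, List.getD_cons_zero, List.getD_cons_succ,
        pow_succ, pow_zero, one_mul, mul_one, mul_assoc] using h3
      · simpa only [TC.val, List.map, List.prod_cons, List.prod_nil, List.getD_cons_zero, List.getD_cons_succ,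
        pow_succ, pow_zero, one_mul, mul_one, mul_assoc] using h4
      · simpa only [TC.val, List.map, List.prod_cons, List.prod_nil, List.getD_cons_zero, List.getD_cons_succ,
        pow_succ, pow_zero, one_mul, mul_one, mul_assoc] using h5)
    (by
      simp only [List.mem_cons, List.not_mem_nil, or_false]
      rintro w (rfl | rfl)
      · simpa only [TC.val, List.map, List.prod_cons, List.prod_nil, List.getD_cons_zero, List.getD_cons_succ,
        pow_succ, pow_zero, one_mul, mul_one, mul_assoc] using hs0
      · simpa only [TC.val, List.map, List.prod_cons, List.prod_nil, List.getD_cons_zero, List.getD_cons_succ,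
        pow_succ, pow_zero, one_mul, mul_one, mul_assoc] using hs1) hrun
  simpa only [TC.val, List.map, List.prod_cons, List.prod_nil, List.getD_cons_zero, List.getD_cons_succ,
        pow_succ, pow_zero, one_mul, mul_one, mul_assoc] using key

set_option maxRecDepth 100000 in
theorem tc_D9 {G : Type*} [Group G] (H : Subgroup G) (a p y : G) (ha : a ^ 2 = 1) (hp : p ^ 2 = 1)
    (h0 : (a * p) ^ 4 = 1)
    (h1 : y ^ 3 = 1)
    (h2 : ((a * p) ^ 2 * y) ^ 2 = 1)
    (h3 : (a * y) ^ 3 = 1)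
    (h4 : (p * a * p * y) ^ 4 = 1)
    (h5 : (p * y) ^ 3 = 1)
    (h6 : (a * p * a * y) ^ 4 = 1)
    (h7 : (a * p * y) ^ 9 = 1) (hs0 : a ∈ H) (hs1 : p ∈ H) :
    y ∈ H := by
  have hia : a⁻¹ = a := inv_eq_of_mul_eq_one_left (by rw [← sq, ha])
  have hip : p⁻¹ = p := inv_eq_of_mul_eq_one_left (by rw [← sq, hp])
  have hrun : TC.run 5 15 [0, 1, 2, 4, 3]
    [[1, 2, 1, 2, 1, 2, 1, 2],
      [3, 3, 3],
      [1, 2, 1, 2, 3, 1, 2, 1, 2, 3],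
      [1, 3, 1, 3, 1, 3],
      [2, 1, 2, 3, 2, 1, 2, 3, 2, 1, 2, 3, 2, 1, 2, 3],
      [2, 3, 2, 3, 2, 3],
      [1, 2, 1, 3, 1, 2, 1, 3, 1, 2, 1, 3, 1, 2, 1, 3],
      [1, 2, 3, 1, 2, 3, 1, 2, 3, 1, 2, 3, 1, 2, 3, 1, 2, 3, 1, 2, 3, 1, 2, 3, 1, 2, 3]]
    [[1], [2]] [3]
    [
    13, 14, 3, 16, 32, 48, 61, 77, 93, 106, 122, 138, 151, 167, 183, 196, 212, 228, 241, 257,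
    273, 286, 302, 318, 331, 347, 12, 17, 10, 7, 51, 33, 8, 376, 20, 55, 68, 81, 83, 85, 157] 0 1 = true := by decide +kernel
  have key := TC.sound H [1, a, p, y, y⁻¹] [0, 1, 2, 4, 3] _ _ _ _ _ (by simp) (by decide +kernel)
    (by
      intro g hg
      simp only [List.length_cons, List.length_nil] at hg
      interval_cases g <;> simp [hia, hip])
    (by
      simp only [List.mem_cons, List.not_mem_nil, or_false]
      rintro w (rfl | rfl | rfl | rfl | rfl | rfl | rfl | rfl)
      · simpa only [TC.val, List.map, List.prod_cons, List.prod_nil, List.getD_cons_zero, List.getD_cons_succ,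
        pow_succ, pow_zero, one_mul, mul_one, mul_assoc] using h0
      · simpa only [TC.val, List.map, List.prod_cons, List.prod_nil, List.getD_cons_zero, List.getD_cons_succ,
        pow_succ, pow_zero, one_mul, mul_one, mul_assoc] using h1
      · simpa only [TC.val, List.map, List.prod_cons, List.prod_nil, List.getD_cons_zero, List.getD_cons_succ,
        pow_succ, pow_zero, one_mul, mul_one, mul_assoc] using h2
      · simpa only [TC.val, List.map, List.prod_cons, List.prod_nil, List.getD_cons_zero, List.getD_cons_succ,
        pow_succ, pow_zero, one_mul, mul_one, mul_assoc] using h3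
      · simpa only [TC.val, List.map, List.prod_cons, List.prod_nil, List.getD_cons_zero, List.getD_cons_succ,
        pow_succ, pow_zero, one_mul, mul_one, mul_assoc] using h4
      · simpa only [TC.val, List.map, List.prod_cons, List.prod_nil, List.getD_cons_zero, List.getD_cons_succ,
        pow_succ, pow_zero, one_mul, mul_one, mul_assoc] using h5
      · simpa only [TC.val, List.map, List.prod_cons, List.prod_nil, List.getD_cons_zero, List.getD_cons_succ,
        pow_succ, pow_zero, one_mul, mul_one, mul_assoc] using h6
      · simpa only [TC.val, List.map, List.prod_cons, List.prod_nil, List.getD_cons_zero, List.getD_cons_succ,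
        pow_succ, pow_zero, one_mul, mul_one, mul_assoc] using h7)
    (by
      simp only [List.mem_cons, List.not_mem_nil, or_false]
      rintro w (rfl | rfl)
      · simpa only [TC.val, List.map, List.prod_cons, List.prod_nil, List.getD_cons_zero, List.getD_cons_succ,
        pow_succ, pow_zero, one_mul, mul_one, mul_assoc] using hs0
      · simpa only [TC.val, List.map, List.prod_cons, List.prod_nil, List.getD_cons_zero, List.getD_cons_succ,
        pow_succ, pow_zero, one_mul, mul_one, mul_assoc] using hs1) hrun
  simpa only [TC.val, List.map, List.prod_cons, List.prod_nil, List.getD_cons_zero, List.getD_cons_succ,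
        pow_succ, pow_zero, one_mul, mul_one, mul_assoc] using key

set_option maxRecDepth 100000 in
theorem tc_E8_9 {G : Type*} [Group G] (H : Subgroup G) (s x : G) (hs : s ^ 2 = 1)
    (h0 : x ^ 3 = 1)
    (h1 : (s * x⁻¹ * s * x) ^ 4 = 1)
    (h2 : (s * x) ^ 8 = 1)
    (h3 : (s * x * s * x * s * x⁻¹) ^ 9 = 1) (hs0 : s ∈ H) :
    x ∈ H := by
  have his : s⁻¹ = s := inv_eq_of_mul_eq_one_left (by rw [← sq, hs])
  have hrun : TC.run 4 9 [0, 1, 3, 2]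
    [[2, 2, 2],
      [1, 3, 1, 2, 1, 3, 1, 2, 1, 3, 1, 2, 1, 3, 1, 2],
      [1, 2, 1, 2, 1, 2, 1, 2, 1, 2, 1, 2, 1, 2, 1, 2],
      [1, 2, 1, 2, 1, 3, 1, 2, 1, 2, 1, 3, 1, 2, 1, 2, 1, 3, 1, 2, 1, 2, 1, 3, 1, 2, 1, 2, 1, 3, 1, 2, 1, 2, 1, 3, 1, 2, 1, 2, 1, 3, 1, 2, 1, 2, 1, 3, 1, 2, 1, 2, 1, 3]]
    [[1]] [2]
    [
    8, 2, 11, 4, 19, 29, 37, 10, 56, 64, 75, 82, 92, 100, 110, 118, 129, 136, 146, 154, 164,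
    172, 183, 190, 200, 208, 218, 226, 237, 244, 254, 262, 272, 280, 291, 298, 308, 316, 326,
    334, 345, 352, 362, 370, 380, 388, 399, 406, 416, 424, 434, 442, 453, 460, 470, 478, 7, 74,
    496, 506, 514, 524, 532, 542, 550, 6, 507, 568, 578, 586, 596, 604, 615, 622, 632, 640,
    650, 658, 669, 676, 686, 694, 704, 712, 723, 730, 740, 748, 758, 766, 777, 784, 794, 802,
    812, 820, 831, 838, 848, 856, 866, 874, 885, 892, 902, 910, 920, 928, 16, 47, 946, 957,
    964, 974, 982, 992, 1000, 1011, 1018, 1028, 1036, 1046, 1054, 1065, 1072, 1082, 1090, 1100,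
    1108, 1119, 1126, 1136, 1144, 1154, 1162, 1173, 1180, 1190, 1198, 1208, 1216, 1227, 1234,
    1244, 1252, 1262, 1270, 1281, 1288, 1298, 1306, 1316, 1324, 25, 956, 1342, 1352, 1360, 24,
    23, 31, 58, 76, 112, 446, 454, 508, 526, 544, 554, 958, 1312, 87] 0 1 = true := by decide +kernel
  have key := TC.sound H [1, s, x, x⁻¹] [0, 1, 3, 2] _ _ _ _ _ (by simp) (by decide +kernel)
    (by
      intro g hg
      simp only [List.length_cons, List.length_nil] at hg
      interval_cases g <;> simp [his])
    (by
      simp only [List.mem_cons, List.not_mem_nil, or_false]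
      rintro w (rfl | rfl | rfl | rfl)
      · simpa only [TC.val, List.map, List.prod_cons, List.prod_nil, List.getD_cons_zero, List.getD_cons_succ,
        pow_succ, pow_zero, one_mul, mul_one, mul_assoc] using h0
      · simpa only [TC.val, List.map, List.prod_cons, List.prod_nil, List.getD_cons_zero, List.getD_cons_succ,
        pow_succ, pow_zero, one_mul, mul_one, mul_assoc] using h1
      · simpa only [TC.val, List.map, List.prod_cons, List.prod_nil, List.getD_cons_zero, List.getD_cons_succ,
        pow_succ, pow_zero, one_mul, mul_one, mul_assoc] using h2
      · simpa only [TC.val, List.map, List.prod_cons, List.prod_nil, List.getD_cons_zero, List.getD_cons_succ,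
        pow_succ, pow_zero, one_mul, mul_one, mul_assoc] using h3)
    (by
      simp only [List.mem_cons, List.not_mem_nil, or_false]
      rintro w rfl
      · simpa only [TC.val, List.map, List.prod_cons, List.prod_nil, List.getD_cons_zero, List.getD_cons_succ,
        pow_succ, pow_zero, one_mul, mul_one, mul_assoc] using hs0) hrun
  simpa only [TC.val, List.map, List.prod_cons, List.prod_nil, List.getD_cons_zero, List.getD_cons_succ,
        pow_succ, pow_zero, one_mul, mul_one, mul_assoc] using key

set_option maxRecDepth 100000 in
theorem tc_C89 {G : Type*} [Group G] (H : Subgroup G) (a b y : G) (ha : a ^ 2 = 1) (hb : b ^ 2 = 1)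
    (h0 : y ^ 3 = 1)
    (h1 : (a * b) ^ 2 = 1)
    (h2 : (a * y) ^ 2 = 1)
    (h3 : (b * y) ^ 8 = 1)
    (h4 : (a * b * y) ^ 9 = 1) (hs0 : a ∈ H) (hs1 : b ∈ H) :
    (a * b * y) ^ 3 ∈ H := by
  have hia : a⁻¹ = a := inv_eq_of_mul_eq_one_left (by rw [← sq, ha])
  have hib : b⁻¹ = b := inv_eq_of_mul_eq_one_left (by rw [← sq, hb])
  have hrun : TC.run 5 12 [0, 1, 2, 4, 3]
    [[3, 3, 3],
      [1, 2, 1, 2],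
      [1, 3, 1, 3],
      [2, 3, 2, 3, 2, 3, 2, 3, 2, 3, 2, 3, 2, 3, 2, 3],
      [1, 2, 3, 1, 2, 3, 1, 2, 3, 1, 2, 3, 1, 2, 3, 1, 2, 3, 1, 2, 3, 1, 2, 3, 1, 2, 3]]
    [[1], [2]] [1, 2, 3, 1, 2, 3, 1, 2, 3]
    [
    10, 11, 3, 13, 7, 5, 14, 39, 50, 63, 74, 87, 98, 111, 122, 135, 146, 159, 8, 18, 55, 66,
    79, 90, 103, 171, 181, 194, 207, 217, 230, 243, 253, 266, 279, 289, 302, 315, 325, 338,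
    351, 361, 374, 9, 41, 43, 161, 186, 223, 234, 259, 270, 147, 397, 410, 423, 433, 446, 459,
    469, 482, 495, 505, 518, 531, 541, 554, 33, 363, 578, 591, 602, 615, 626, 639, 650, 32, 65,
    67, 137, 211, 402, 439, 450, 475, 486, 327, 674, 687, 698, 711, 722, 735, 746, 68, 269,
    425, 123, 769, 782, 91, 89, 507, 806, 819, 830, 843, 854, 867, 878, 92, 651, 901, 914, 927,
    937, 950, 963, 973, 986, 999, 1009, 1022, 1035, 93, 113, 485, 774, 1047, 1057, 1070, 1083,
    1093, 1106, 1119, 1129, 1142, 1155, 1165, 1178, 1191, 105, 799, 543, 1213, 1226, 1239,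
    1249, 1262, 1275, 1285, 1298, 1311, 1321, 1334, 1347, 117, 427, 449, 737, 750, 882, 1099,
    1135, 1171, 1182, 1359, 1370, 1383, 1394, 1407, 1418, 140, 461, 463, 810, 1203, 1442, 1455,
    1466, 1479, 1490, 164, 245, 247, 678, 703, 714, 727, 738, 739, 1491, 1513, 1526, 691, 701,
    1481, 291, 1550, 1563, 281, 283, 1573, 1586, 1599, 1609, 1622, 1635, 1645, 1658, 1671,
    1681, 1694, 1707, 1717, 1730, 273, 1514, 1755, 1766, 1779, 1790, 272, 1467, 713, 715, 1518,
    1543, 1722, 1770, 1419, 1826, 1839, 1850, 1863, 1874, 452, 1181, 1825, 1898, 1911, 1921,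
    1934, 823, 1830, 1843, 1853, 1719, 1957, 1970, 1983, 1993, 2006, 2019, 465, 1926, 1167,
    2042, 2055, 2066, 488, 1157, 1159, 1855, 1866, 1878, 1913, 1875, 2089, 2102, 2115, 2125,
    2138, 2151, 2161, 2174, 729, 1781, 1783, 1865, 1867, 2057, 2166, 2163, 2197, 2210, 2223,
    741, 2094, 2131, 2142, 2153, 2156] 0 1 = true := by decide +kernel
  have key := TC.sound H [1, a, b, y, y⁻¹] [0, 1, 2, 4, 3] _ _ _ _ _ (by simp) (by decide +kernel)
    (by
      intro g hg
      simp only [List.length_cons, List.length_nil] at hg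
      interval_cases g <;> simp [hia, hib])
    (by
      simp only [List.mem_cons, List.not_mem_nil, or_false]
      rintro w (rfl | rfl | rfl | rfl | rfl)
      · simpa only [TC.val, List.map, List.prod_cons, List.prod_nil, List.getD_cons_zero, List.getD_cons_succ,
        pow_succ, pow_zero, one_mul, mul_one, mul_assoc] using h0
      · simpa only [TC.val, List.map, List.prod_cons, List.prod_nil, List.getD_cons_zero, List.getD_cons_succ,
        pow_succ, pow_zero, one_mul, mul_one, mul_assoc] using h1
      · simpa only [TC.val, List.map, List.prod_cons, List.prod_nil, List.getD_cons_zero, List.getD_cons_succ,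
        pow_succ, pow_zero, one_mul, mul_one, mul_assoc] using h2
      · simpa only [TC.val, List.map, List.prod_cons, List.prod_nil, List.getD_cons_zero, List.getD_cons_succ,
        pow_succ, pow_zero, one_mul, mul_one, mul_assoc] using h3
      · simpa only [TC.val, List.map, List.prod_cons, List.prod_nil, List.getD_cons_zero, List.getD_cons_succ,
        pow_succ, pow_zero, one_mul, mul_one, mul_assoc] using h4)
    (by
      simp only [List.mem_cons, List.not_mem_nil, or_false]
      rintro w (rfl | rfl)
      · simpa only [TC.val, List.map, List.prod_cons, List.prod_nil, List.getD_cons_zero, List.getD_cons_succ,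
        pow_succ, pow_zero, one_mul, mul_one, mul_assoc] using hs0
      · simpa only [TC.val, List.map, List.prod_cons, List.prod_nil, List.getD_cons_zero, List.getD_cons_succ,
        pow_succ, pow_zero, one_mul, mul_one, mul_assoc] using hs1) hrun
  simpa only [TC.val, List.map, List.prod_cons, List.prod_nil, List.getD_cons_zero, List.getD_cons_succ,
        pow_succ, pow_zero, one_mul, mul_one, mul_assoc] using key

set_option maxRecDepth 100000 in
theorem tc_E9 {G : Type*} [Group G] (H : Subgroup G) (s x : G) (hs : s ^ 2 = 1)
    (h0 : x ^ 3 = 1)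
    (h1 : (s * x⁻¹ * s * x) ^ 4 = 1)
    (h2 : (s * x) ^ 9 = 1) (hs0 : x ∈ H) :
    (s * x) ^ 3 ∈ H := by
  have his : s⁻¹ = s := inv_eq_of_mul_eq_one_left (by rw [← sq, hs])
  have hrun : TC.run 4 8 [0, 1, 3, 2]
    [[2, 2, 2],
      [1, 3, 1, 2, 1, 3, 1, 2, 1, 3, 1, 2, 1, 3, 1, 2],
      [1, 2, 1, 2, 1, 2, 1, 2, 1, 2, 1, 2, 1, 2, 1, 2, 1, 2]]
    [[2]] [1, 2, 1, 2, 1, 2]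
    [
    7, 1, 11, 17, 26, 33, 43, 49, 58, 65, 75, 81, 90, 97, 5, 12, 98, 113, 122, 129, 138, 145,
    154, 161, 170, 177, 6, 28, 92, 178, 193, 203, 209, 218, 225, 235, 241, 21, 42, 257, 266,
    273, 282, 289, 298, 305, 314, 321, 22, 44, 76, 124, 202, 337, 346, 353, 362, 369, 378, 385,
    394, 401, 46, 60, 204, 402, 417, 427, 433, 442, 449, 459, 465, 53, 284, 426, 481, 490, 497,
    506, 513, 78, 236, 428, 155, 529, 538, 545, 555, 561, 570, 577, 149, 347, 593, 348, 578,
    609, 618, 625, 634, 641, 214, 572, 299, 657, 300, 450, 673, 682, 689, 698, 705, 714, 721,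
    730, 737, 302, 444, 386, 753, 325, 380, 732, 706, 769, 373, 636, 700, 701] 0 1 = true := by decide +kernel
  have key := TC.sound H [1, s, x, x⁻¹] [0, 1, 3, 2] _ _ _ _ _ (by simp) (by decide +kernel)
    (by
      intro g hg
      simp only [List.length_cons, List.length_nil] at hg
      interval_cases g <;> simp [his])
    (by
      simp only [List.mem_cons, List.not_mem_nil, or_false]
      rintro w (rfl | rfl | rfl)
      · simpa only [TC.val, List.map, List.prod_cons, List.prod_nil, List.getD_cons_zero, List.getD_cons_succ,
        pow_succ, pow_zero, one_mul, mul_one, mul_assoc] using h0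
      · simpa only [TC.val, List.map, List.prod_cons, List.prod_nil, List.getD_cons_zero, List.getD_cons_succ,
        pow_succ, pow_zero, one_mul, mul_one, mul_assoc] using h1
      · simpa only [TC.val, List.map, List.prod_cons, List.prod_nil, List.getD_cons_zero, List.getD_cons_succ,
        pow_succ, pow_zero, one_mul, mul_one, mul_assoc] using h2)
    (by
      simp only [List.mem_cons, List.not_mem_nil, or_false]
      rintro w rfl
      · simpa only [TC.val, List.map, List.prod_cons, List.prod_nil, List.getD_cons_zero, List.getD_cons_succ,
        pow_succ, pow_zero, one_mul, mul_one, mul_assoc] using hs0) hrun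
  simpa only [TC.val, List.map, List.prod_cons, List.prod_nil, List.getD_cons_zero, List.getD_cons_succ,
        pow_succ, pow_zero, one_mul, mul_one, mul_assoc] using key

set_option maxRecDepth 100000 in
theorem tc_S4a {G : Type*} [Group G] (s x : G) (hs : s ^ 2 = 1)
    (h0 : x ^ 3 = 1)
    (h1 : (s * x) ^ 4 = 1) :
    (s * x⁻¹ * s * x) ^ 3 = 1 := by
  have his : s⁻¹ = s := inv_eq_of_mul_eq_one_left (by rw [← sq, hs])
  have hrun : TC.run 4 6 [0, 1, 3, 2]
    [[2, 2, 2],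
      [1, 2, 1, 2, 1, 2, 1, 2]]
    [] [1, 3, 1, 2, 1, 3, 1, 2, 1, 3, 1, 2]
    [
    1, 8, 13, 20, 25, 32, 37, 5, 2, 49, 56, 61, 68, 73, 11, 10, 26, 22, 74, 91, 98, 23, 104,
    109, 116, 121, 35, 34, 100] 0 1 = true := by decide +kernel
  have key := TC.sound ⊥ [1, s, x, x⁻¹] [0, 1, 3, 2] _ _ _ _ _ (by simp) (by decide +kernel)
    (by
      intro g hg
      simp only [List.length_cons, List.length_nil] at hg
      interval_cases g <;> simp [his])
    (by
      simp only [List.mem_cons, List.not_mem_nil, or_false]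
      rintro w (rfl | rfl)
      · simpa only [TC.val, List.map, List.prod_cons, List.prod_nil, List.getD_cons_zero, List.getD_cons_succ,
        pow_succ, pow_zero, one_mul, mul_one, mul_assoc] using h0
      · simpa only [TC.val, List.map, List.prod_cons, List.prod_nil, List.getD_cons_zero, List.getD_cons_succ,
        pow_succ, pow_zero, one_mul, mul_one, mul_assoc] using h1)
    (by simp) hrun
  rw [Subgroup.mem_bot] at key
  simpa only [TC.val, List.map, List.prod_cons, List.prod_nil, List.getD_cons_zero, List.getD_cons_succ,
        pow_succ, pow_zero, one_mul, mul_one, mul_assoc] using key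

set_option maxRecDepth 100000 in
theorem tc_S4c {G : Type*} [Group G] (a b y : G) (ha : a ^ 2 = 1) (hb : b ^ 2 = 1)
    (h0 : y ^ 3 = 1)
    (h1 : (a * b) ^ 2 = 1)
    (h2 : (a * y) ^ 2 = 1)
    (h3 : (a * b * y) ^ 3 = 1) :
    (b * y) ^ 4 = 1 := by
  have hia : a⁻¹ = a := inv_eq_of_mul_eq_one_left (by rw [← sq, ha])
  have hib : b⁻¹ = b := inv_eq_of_mul_eq_one_left (by rw [← sq, hb])
  have hrun : TC.run 5 9 [0, 1, 2, 4, 3]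
    [[3, 3, 3],
      [1, 2, 1, 2],
      [1, 3, 1, 3],
      [1, 2, 3, 1, 2, 3, 1, 2, 3]]
    [] [2, 3, 2, 3, 2, 3, 2, 3]
    [
    3, 12, 5, 1, 30, 7, 29, 48, 55, 65, 75, 82, 8, 46, 6, 24, 10, 110, 120, 127, 137, 16, 118,
    15, 84, 163, 173, 26, 97, 122, 133, 102, 35, 132] 0 1 = true := by decide +kernel
  have key := TC.sound ⊥ [1, a, b, y, y⁻¹] [0, 1, 2, 4, 3] _ _ _ _ _ (by simp) (by decide +kernel)
    (by
      intro g hg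
      simp only [List.length_cons, List.length_nil] at hg
      interval_cases g <;> simp [hia, hib])
    (by
      simp only [List.mem_cons, List.not_mem_nil, or_false]
      rintro w (rfl | rfl | rfl | rfl)
      · simpa only [TC.val, List.map, List.prod_cons, List.prod_nil, List.getD_cons_zero, List.getD_cons_succ,
        pow_succ, pow_zero, one_mul, mul_one, mul_assoc] using h0
      · simpa only [TC.val, List.map, List.prod_cons, List.prod_nil, List.getD_cons_zero, List.getD_cons_succ,
        pow_succ, pow_zero, one_mul, mul_one, mul_assoc] using h1
      · simpa only [TC.val, List.map, List.prod_cons, List.prod_nil, List.getD_cons_zero, List.getD_cons_succ,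
        pow_succ, pow_zero, one_mul, mul_one, mul_assoc] using h2
      · simpa only [TC.val, List.map, List.prod_cons, List.prod_nil, List.getD_cons_zero, List.getD_cons_succ,
        pow_succ, pow_zero, one_mul, mul_one, mul_assoc] using h3)
    (by simp) hrun
  rw [Subgroup.mem_bot] at key
  simpa only [TC.val, List.map, List.prod_cons, List.prod_nil, List.getD_cons_zero, List.getD_cons_succ,
        pow_succ, pow_zero, one_mul, mul_one, mul_assoc] using key

set_option maxRecDepth 100000 in
theorem tc_A4 {G : Type*} [Group G] (s x : G) (hs : s ^ 2 = 1)
    (h0 : x ^ 3 = 1)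
    (h1 : (s * x) ^ 3 = 1) :
    (s * x⁻¹ * s * x) ^ 2 = 1 := by
  have his : s⁻¹ = s := inv_eq_of_mul_eq_one_left (by rw [← sq, hs])
  have hrun : TC.run 4 6 [0, 1, 3, 2]
    [[2, 2, 2],
      [1, 2, 1, 2, 1, 2]]
    [] [1, 3, 1, 2, 1, 3, 1, 2]
    [
    1, 8, 13, 20, 25, 5, 2, 37, 44, 49, 11, 10, 26, 22, 50, 23] 0 1 = true := by decide +kernel
  have key := TC.sound ⊥ [1, s, x, x⁻¹] [0, 1, 3, 2] _ _ _ _ _ (by simp) (by decide +kernel)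
    (by
      intro g hg
      simp only [List.length_cons, List.length_nil] at hg
      interval_cases g <;> simp [his])
    (by
      simp only [List.mem_cons, List.not_mem_nil, or_false]
      rintro w (rfl | rfl)
      · simpa only [TC.val, List.map, List.prod_cons, List.prod_nil, List.getD_cons_zero, List.getD_cons_succ,
        pow_succ, pow_zero, one_mul, mul_one, mul_assoc] using h0
      · simpa only [TC.val, List.map, List.prod_cons, List.prod_nil, List.getD_cons_zero, List.getD_cons_succ,
        pow_succ, pow_zero, one_mul, mul_one, mul_assoc] using h1)
    (by simp) hrun
  rw [Subgroup.mem_bot] at key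
  simpa only [TC.val, List.map, List.prod_cons, List.prod_nil, List.getD_cons_zero, List.getD_cons_succ,
        pow_succ, pow_zero, one_mul, mul_one, mul_assoc] using key


/-- The consequences of the hypotheses used throughout. -/
structure Hyp (G : Type*) [Group G] : Prop where
  tor : ∀ g : G, (∃ k : ℕ, g ^ 2 ^ k = 1) ∨ g ^ 9 = 1
  prod : ∀ x y : G, (x ^ 4 = 1 ∨ x ^ 3 = 1) → (y ^ 4 = 1 ∨ y ^ 3 = 1) →
    (x * y) ^ 8 = 1 ∨ (x * y) ^ 9 = 1
  six : ∀ a x : G, a ^ 2 = 1 → x ^ 3 = 1 → Commute a x → a = 1 ∨ x = 1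

namespace Hyp

section basic
variable {G : Type*} [Group G]

theorem eq_one_of_pows {g : G} {k m : ℕ} (h : g ^ 2 ^ k = 1) (h' : g ^ 3 ^ m = 1) : g = 1 := by
  have h1 := orderOf_dvd_of_pow_eq_one h
  have h2 := orderOf_dvd_of_pow_eq_one h'
  have hc : Nat.Coprime (2 ^ k) (3 ^ m) := Nat.Coprime.pow _ _ (by norm_num)
  have := Nat.eq_one_of_dvd_coprimes hc h1 h2
  exact orderOf_eq_one_iff.1 this

theorem eq_one_two_three {g : G} (h : g ^ 2 = 1) (h' : g ^ 3 = 1) : g = 1 :=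
  eq_one_of_pows (k := 1) (m := 1) (by simpa using h) (by simpa using h')

theorem eq_one_two_nine {g : G} (h : g ^ 2 = 1) (h' : g ^ 9 = 1) : g = 1 :=
  eq_one_of_pows (k := 1) (m := 2) (by simpa using h) (by simpa using h')

theorem eq_one_four_three {g : G} (h : g ^ 4 = 1) (h' : g ^ 3 = 1) : g = 1 :=
  eq_one_of_pows (k := 2) (m := 1) (by simpa using h) (by simpa using h')

theorem eq_one_four_nine {g : G} (h : g ^ 4 = 1) (h' : g ^ 9 = 1) : g = 1 :=
  eq_one_of_pows (k := 2) (m := 2) (by simpa using h) (by simpa using h')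

theorem eq_one_eight_three {g : G} (h : g ^ 8 = 1) (h' : g ^ 3 = 1) : g = 1 :=
  eq_one_of_pows (k := 3) (m := 1) (by simpa using h) (by simpa using h')

theorem eq_one_eight_nine {g : G} (h : g ^ 8 = 1) (h' : g ^ 9 = 1) : g = 1 :=
  eq_one_of_pows (k := 3) (m := 2) (by simpa using h) (by simpa using h')

/-- A nontrivial `2`-element has a power which is an involution. -/
theorem exists_inv_pow {g : G} {k : ℕ} (h : g ^ 2 ^ k = 1) (hg : g ≠ 1) :
    ∃ m : ℕ, g ^ m ≠ 1 ∧ (g ^ m) ^ 2 = 1 := by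
  classical
  have hex : ∃ k, g ^ 2 ^ k = 1 := ⟨k, h⟩
  have h1 := Nat.find_spec hex
  have hpos : Nat.find hex ≠ 0 := by
    intro h0
    rw [h0] at h1
    exact hg (by simpa using h1)
  obtain ⟨j, hj⟩ := Nat.exists_eq_succ_of_ne_zero hpos
  refine ⟨2 ^ j, fun h2 => ?_, ?_⟩
  · have := Nat.find_min hex (m := j) (by omega)
    exact this h2
  · rw [← pow_mul, ← pow_succ]
    rw [hj] at h1
    exact h1

/-- If `a` is an involution and `(a * a^g)^9 = 1`, then `g = c * d` with `c` centralizing `a`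
and `d` inverted by `a`. -/
theorem decomp {a g : G} (ha : a ^ 2 = 1) (h : (a * (g⁻¹ * a * g)) ^ 9 = 1) :
    ∃ d : G, d = (a * (g⁻¹ * a * g)) ^ 5 ∧ d ^ 9 = 1 ∧ SemiconjBy a d d⁻¹ ∧ Commute (g * d⁻¹) a := by
  have haa : a * a = 1 := by rw [← sq, ha]
  set r := a * (g⁻¹ * a * g) with hr
  have har : SemiconjBy a r r⁻¹ := by
    have hai : a⁻¹ = a := inv_eq_of_mul_eq_one_left haa
    rw [SemiconjBy, hr]
    simp only [mul_inv_rev, inv_inv, hai, mul_assoc]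
    rw [haa]
    simp only [← mul_assoc, haa, one_mul, mul_one]
  have had : SemiconjBy a (r ^ 5) (r ^ 5)⁻¹ := by
    have := har.pow_right 5
    rwa [inv_pow] at this
  refine ⟨r ^ 5, rfl, ?_, had, ?_⟩
  · rw [← pow_mul, mul_comm, pow_mul, h, one_pow]
  · have e1 : r ^ 5 * r ^ 5 = r := by
      rw [← pow_add, show 5 + 5 = 9 + 1 from rfl, pow_add, h, one_mul, pow_one]
    have e2 : (r ^ 5)⁻¹ * a = a * r ^ 5 := had.eq.symm
    have e3 : (r ^ 5)⁻¹ * a * r ^ 5 = g⁻¹ * a * g := by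
      rw [e2, mul_assoc, e1, hr, ← mul_assoc, haa, one_mul]
    have e4 : a * r ^ 5 = r ^ 5 * (g⁻¹ * a * g) := by
      rw [← e3]; group
    show g * (r ^ 5)⁻¹ * a = a * (g * (r ^ 5)⁻¹)
    rw [mul_assoc, e2]
    have e5 : a * r ^ 5 = (g⁻¹ * a * g) * (r ^ 5)⁻¹ := by
      rw [← e3, ← e2]; group
    rw [e5]; group

end basic

variable {G : Type*} [Group G] (hG : Hyp G)
include hG

/-- A `3`-element commuting with an involution is trivial. -/
theorem three_cent {a g : G} (ha : a ^ 2 = 1) (ha1 : a ≠ 1) (hg : g ^ 9 = 1) (h : Commute a g) :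
    g = 1 := by
  have h3 : g ^ 3 = 1 := by
    rcases hG.six a (g ^ 3) ha (by rw [← pow_mul]; exact hg) (h.pow_right 3) with h | h
    · exact absurd h ha1
    · exact h
  rcases hG.six a g ha h3 h with h | h
  · exact absurd h ha1
  · exact h

theorem cent_inv {a g : G} (ha : a ^ 2 = 1) (ha1 : a ≠ 1) (h : Commute a g) :
    ∃ k : ℕ, g ^ 2 ^ k = 1 := by
  rcases hG.tor g with h1 | h1
  · exact h1
  · exact ⟨0, by simpa using hG.three_cent ha ha1 h1 h⟩

theorem cent_three {x g : G} (hx : x ^ 3 = 1) (hx1 : x ≠ 1) (h : Commute x g) : g ^ 9 = 1 := by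
  rcases hG.tor g with ⟨k, h1⟩ | h1
  · by_cases hg : g = 1
    · simp [hg]
    · obtain ⟨m, hm, hm2⟩ := exists_inv_pow h1 hg
      rcases hG.six (g ^ m) x hm2 hx (h.symm.pow_left m) with h | h
      · exact absurd h hm
      · exact absurd h hx1
  · exact h1

/-- Lemma A. -/
theorem lemA {a y g : G} (ha : a ^ 2 = 1) (ha1 : a ≠ 1) (hy : y ^ 3 = 1) (hy1 : y ≠ 1)
    (h : SemiconjBy a y y⁻¹) (hg : Commute y g) : SemiconjBy a g g⁻¹ := by
  have ha' : SemiconjBy a y⁻¹ y := by simpa using h.inv_right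
  have hgy : SemiconjBy g y y := hg.symm
  have hr : SemiconjBy (a * (g⁻¹ * a * g)) y y := by
    refine SemiconjBy.mul_left ha' ?_
    refine SemiconjBy.mul_left (SemiconjBy.mul_left ?_ h) hgy
    exact SemiconjBy.inv_symm_left (hgy.inv_right)
  have h9 := hG.cent_three hy hy1 (g := a * (g⁻¹ * a * g)) hr.symm
  obtain ⟨d, hd, hd9, had, hc⟩ := decomp ha h9
  have hdy : Commute y d := by rw [hd]; exact Commute.pow_right hr.symm 5
  have hcy : (g * d⁻¹) ^ 9 = 1 := hG.cent_three hy hy1 (hg.mul_right hdy.inv_right)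
  have := hG.three_cent ha ha1 hcy hc.symm
  have : g = d := by rwa [mul_inv_eq_one] at this
  rw [this]; exact had

/-- The centralizer of an inverted element of order three is abelian. -/
theorem lemA_comm {a y g k : G} (ha : a ^ 2 = 1) (ha1 : a ≠ 1) (hy : y ^ 3 = 1) (hy1 : y ≠ 1)
    (h : SemiconjBy a y y⁻¹) (hg : Commute y g) (hk : Commute y k) : Commute g k := by
  have h1 := hG.lemA ha ha1 hy hy1 h hg
  have h2 := hG.lemA ha ha1 hy hy1 h hk
  have h3 := hG.lemA ha ha1 hy hy1 h (hg.mul_right hk)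
  have h4 := h1.mul_right h2
  have h5 : (g * k)⁻¹ = g⁻¹ * k⁻¹ := by
    have := h3.eq.symm.trans h4.eq
    exact mul_right_cancel this
  have h6 : g * k = k * g := by
    have := congrArg (·⁻¹) h5
    simpa using this
  exact h6

end Hyp


/-- Local finiteness. -/
def LF (G : Type*) [Group G] : Prop := ∀ S : Subgroup G, S.FG → Finite S

theorem LF.of_finite (G : Type*) [Group G] [Finite G] : LF G := fun S _ => inferInstance

theorem LF.of_comm {G : Type*} [Group G] (hc : ∀ x y : G, x * y = y * x)
    (ht : ∀ x : G, IsOfFinOrder x) : LF G := by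
  intro S hS
  letI : CommGroup S := { (inferInstance : Group S) with
    mul_comm := fun x y => Subtype.ext (hc x y) }
  haveI : Group.FG S := (Group.fg_iff_subgroup_fg S).2 hS
  have htor : ∀ x : S, IsOfFinOrder x := by
    intro x
    obtain ⟨n, hn, h⟩ := isOfFinOrder_iff_pow_eq_one.1 (ht (x : G))
    exact isOfFinOrder_iff_pow_eq_one.2 ⟨n, hn, Subtype.ext (by simpa using h)⟩
  exact CommGroup.finite_of_fg_isMulTorsion S htor

theorem LF.of_surjective {G G' : Type*} [Group G] [Group G'] (f : G →* G')
    (hf : Function.Surjective f) (h : LF G) : LF G' := by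
  intro S hS
  obtain ⟨s, hs⟩ := hS
  classical
  obtain ⟨t, ht⟩ : ∃ t : Finset G, t.image f = s := by
    refine ⟨s.image (fun y => (hf y).choose), ?_⟩
    rw [Finset.image_image]
    ext y
    simp only [Finset.mem_image, Function.comp]
    constructor
    · rintro ⟨z, hz, rfl⟩
      rw [(hf z).choose_spec]; exact hz
    · intro hy
      exact ⟨y, hy, (hf y).choose_spec⟩
  have hfin : Finite (Subgroup.closure (t : Set G)) := h _ ⟨t, rfl⟩
  have : S = (Subgroup.closure (t : Set G)).map f := by
    rw [MonoidHom.map_closure, ← hs, ← ht]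
    simp
  rw [this]
  have : Finite ((fun x => f x) '' (Subgroup.closure (t : Set G) : Set G)) :=
    Set.Finite.image _ (Set.toFinite _)
  exact this

theorem LF.ext {G : Type*} [Group G] (N : Subgroup G) [N.Normal] (hN : LF N) (hQ : LF (G ⧸ N)) :
    LF G := by
  intro S hS
  haveI : Group.FG S := (Group.fg_iff_subgroup_fg S).2 hS
  let f : S →* G ⧸ N := (QuotientGroup.mk' N).comp S.subtype
  have hrange : Finite f.range := by
    apply hQ
    exact (Group.fg_iff_subgroup_fg _).1 (inferInstance : Group.FG f.range)
  have hidx : f.ker.index ≠ 0 := by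
    rw [Subgroup.index_ker]
    exact Nat.card_ne_zero.2 ⟨⟨1⟩, hrange⟩
  have hkfg : f.ker.FG := by
    haveI : f.ker.FiniteIndex := ⟨hidx⟩
    exact (Group.fg_iff_subgroup_fg _).1 (Subgroup.fg_of_index_ne_zero f.ker)
  have hmem : ∀ x : f.ker, ((x : S) : G) ∈ N := by
    intro x
    have := x.2
    rw [MonoidHom.mem_ker] at this
    exact (QuotientGroup.eq_one_iff _).1 this
  let φ : f.ker →* N := (S.subtype.comp f.ker.subtype).codRestrict N hmem
  have hφ : Function.Injective φ := by
    intro x y hxy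
    have : ((x : S) : G) = ((y : S) : G) := congrArg (fun z : N => (z : G)) hxy
    exact Subtype.ext (Subtype.ext this)
  haveI : Group.FG f.ker := (Group.fg_iff_subgroup_fg _).2 hkfg
  have hr2 : Finite φ.range := hN _ ((Group.fg_iff_subgroup_fg _).1 (inferInstance : Group.FG φ.range))
  have hkfin : Finite f.ker := Finite.of_equiv _ (MonoidHom.ofInjective hφ).toEquiv.symm
  haveI : f.ker.FiniteIndex := ⟨hidx⟩
  haveI : Finite (S ⧸ f.ker) := Subgroup.finite_quotient_of_finiteIndex
  exact Finite.of_equiv _ (Subgroup.groupEquivQuotientProdSubgroup (s := f.ker)).symm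


section twogroup
variable {T : Type*} [Group T] (a : T) (ha : a ^ 2 = 1) (hac : ∀ t, Commute a t)
  (h2 : ∀ t : T, ∃ k : ℕ, t ^ 2 ^ k = 1) (hu : ∀ t : T, t ^ 2 = 1 → t = 1 ∨ t = a)

/-- A `2`-element whose square is nontrivial has a power of order four. -/
theorem exists_four_pow {G : Type*} [Group G] {g : G} {k : ℕ} (h : g ^ 2 ^ k = 1) (hg : g ^ 2 ≠ 1) :
    ∃ m : ℕ, (g ^ m) ^ 2 ≠ 1 ∧ (g ^ m) ^ 4 = 1 := by
  obtain ⟨m, h1, h3⟩ := Hyp.exists_inv_pow (g := g ^ 2) (k := k) (by rw [← pow_mul, mul_comm, pow_mul, h, one_pow]) hg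
  refine ⟨m, ?_, ?_⟩
  · rwa [← pow_mul, mul_comm, pow_mul]
  · rw [← pow_mul, mul_comm m 4, show 4 * m = 2 * m * 2 by ring, pow_mul, pow_mul]
    exact h3

include hu in
theorem sq_eq_of_four {j : T} (hj : j ^ 4 = 1) (hj2 : j ^ 2 ≠ 1) : j ^ 2 = a := by
  rcases hu (j ^ 2) (by rw [← pow_mul]; exact hj) with h | h
  · exact absurd h hj2
  · exact h

include ha hac h2 hu in
theorem cent_sq {i c d : T} (hi : i ^ 2 = a) (ha1 : a ≠ 1) (hc : Commute i c) (hd : Commute i d)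
    (h : c ^ 2 = d ^ 2) : c * d⁻¹ = 1 ∨ c * d⁻¹ = a := by
  apply hu
  by_contra hne
  obtain ⟨k, hk⟩ := h2 (c * d⁻¹)
  obtain ⟨m, hm2, hm4⟩ := exists_four_pow hk hne
  have hinv : SemiconjBy c⁻¹ (c * d⁻¹) (c * d⁻¹)⁻¹ := by
    rw [SemiconjBy]
    have h' : d⁻¹ = d * (c ^ 2)⁻¹ := by rw [h]; group
    have h3 : c⁻¹ * (c * d⁻¹) = d⁻¹ := by group
    rw [h3]
    calc d⁻¹ = d * (c ^ 2)⁻¹ := h'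
      _ = _ := by group
  have hi4 : i⁻¹ ^ 2 = a := by rw [inv_pow, hi]; exact inv_eq_of_mul_eq_one_left (by rw [← sq, ha])
  set w := (c * d⁻¹) ^ m with hw
  have hwi : Commute i w := (hc.mul_right hd.inv_right).pow_right m
  have hw2 : w ^ 2 = a := sq_eq_of_four a hu hm4 hm2
  have h5 : (w * i⁻¹) ^ 2 = 1 := by
    rw [(hwi.symm.inv_right).mul_pow, hw2, hi4, ← sq, ha]
  have hcw : Commute c w := by
    have : w = i ∨ w = a * i := by
      rcases hu _ h5 with h6 | h6
      · left; exact mul_inv_eq_one.1 h6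
      · right; rw [← h6]; group
    rcases this with h7 | h7
    · rw [h7]; exact hc.symm
    · rw [h7]; exact (hac c).symm.mul_right hc.symm
  have h8 : SemiconjBy c⁻¹ w w⁻¹ := by
    have := hinv.pow_right m
    rwa [inv_pow] at this
  have h9 : w = w⁻¹ := by
    have e1 := h8.eq
    have e2 : c⁻¹ * w = w * c⁻¹ := hcw.inv_left.eq
    rw [e2] at e1
    exact mul_right_cancel e1
  have : w ^ 2 = 1 := by rw [sq]; nth_rewrite 2 [h9]; simp
  exact ha1 (hw2 ▸ this)

include ha hac h2 hu in
theorem cent_powers {i : T} (hi : i ^ 2 = a) (ha1 : a ≠ 1) (n : ℕ) : ∀ c d : T, Commute i c → Commute i d →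
    c ^ 2 ^ n = 1 → d ^ 2 ^ n = 1 → ∃ k : ℕ, c = d ^ k ∨ d = c ^ k := by
  induction n with
  | zero =>
    intro c d _ _ hc hd
    exact ⟨0, Or.inl (by simpa using hc)⟩
  | succ n ih =>
    have key : ∀ c d : T, Commute i c → Commute i d → ∀ k : ℕ, c ^ 2 = (d ^ 2) ^ k →
        ∃ k : ℕ, c = d ^ k ∨ d = c ^ k := by
      intro c d hc hd k hk
      have h3 : c ^ 2 = (d ^ k) ^ 2 := by rw [hk, ← pow_mul, ← pow_mul, mul_comm]
      rcases cent_sq a ha hac h2 hu hi ha1 hc (hd.pow_right k) h3 with h4 | h4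
      · exact ⟨k, Or.inl (mul_inv_eq_one.1 h4)⟩
      · by_cases hd1 : d = 1
        · exact ⟨0, Or.inr (by simpa using hd1)⟩
        · obtain ⟨l, hl⟩ := h2 d
          obtain ⟨m, hm1, hm2⟩ := Hyp.exists_inv_pow hl hd1
          have hm : d ^ m = a := (hu _ hm2).resolve_left hm1
          refine ⟨m + k, Or.inl ?_⟩
          rw [pow_add, hm, ← h4]; group
    intro c d hc hd hcn hdn
    have e : ∀ z : T, z ^ 2 ^ (n + 1) = 1 → (z ^ 2) ^ 2 ^ n = 1 := by
      intro z hz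
      rw [← pow_mul, mul_comm, ← pow_succ]; exact hz
    obtain ⟨k, hk | hk⟩ := ih (c ^ 2) (d ^ 2) (hc.pow_right 2) (hd.pow_right 2) (e _ hcn) (e _ hdn)
    · exact key c d hc hd k hk
    · obtain ⟨k', h'⟩ := key d c hd hc k hk
      exact ⟨k', h'.symm⟩

include ha hac h2 hu in
theorem cent_comm {i : T} (hi : i ^ 2 = a) (ha1 : a ≠ 1) {c d : T} (hc : Commute i c)
    (hd : Commute i d) : Commute c d := by
  obtain ⟨k, hk⟩ := h2 c
  obtain ⟨l, hl⟩ := h2 d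
  have h3 : c ^ 2 ^ (k + l) = 1 := by rw [pow_add, pow_mul, hk, one_pow]
  have h4 : d ^ 2 ^ (k + l) = 1 := by rw [add_comm, pow_add, pow_mul, hl, one_pow]
  obtain ⟨m, h | h⟩ := cent_powers a ha hac h2 hu hi ha1 (k + l) c d hc hd h3 h4
  · rw [h]; exact (Commute.refl d).pow_left m
  · rw [h]; exact (Commute.refl c).pow_right m

include ha hac h2 hu in
theorem cent_finite {i : T} (hi : i ^ 2 = a) (ha1 : a ≠ 1) (n : ℕ) :
    {c : T | Commute i c ∧ c ^ 2 ^ n = 1}.Finite := by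
  induction n with
  | zero =>
    refine (Set.finite_singleton (1 : T)).subset ?_
    rintro c ⟨_, h⟩
    simpa using h
  | succ n ih =>
    let S := {c : T | Commute i c ∧ c ^ 2 ^ (n + 1) = 1}
    refine Set.Finite.of_finite_fibers (f := fun c => c ^ 2) (ih.subset ?_) ?_
    · rintro _ ⟨c, ⟨hc, hcn⟩, rfl⟩
      refine ⟨hc.pow_right 2, ?_⟩
      show (c ^ 2) ^ 2 ^ n = 1
      rw [← pow_mul, mul_comm, ← pow_succ]; exact hcn
    · rintro _ ⟨c, ⟨hc, hcn⟩, rfl⟩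
      refine (Set.toFinite ({c, a * c} : Set T)).subset ?_
      rintro d ⟨⟨hd, _⟩, hdc⟩
      rcases cent_sq a ha hac h2 hu hi ha1 hd hc hdc with h | h
      · left; exact mul_inv_eq_one.1 h
      · right
        show d = a * c
        rw [← h]; group

/-- `j` inverts `i`. -/
def Nb (a i : T) : Set T := {j | j ^ 2 = a ∧ SemiconjBy j i i⁻¹}

variable (hp : ∀ x y : T, x ^ 2 = a → y ^ 2 = a → (x * y) ^ 8 = 1)

include ha in
theorem a_inv : a⁻¹ = a := inv_eq_of_mul_eq_one_left (by rw [← sq, ha])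

include ha hac h2 hu hp in
theorem nb_finite {i : T} (hi : i ^ 2 = a) (ha1 : a ≠ 1) : (Nb a i).Finite := by
  by_cases hne : (Nb a i).Nonempty
  · obtain ⟨j0, hj0, hj0i⟩ := hne
    have hf := cent_finite a ha hac h2 hu hi ha1 3
    refine (hf.image (fun c => c * j0)).subset ?_
    rintro j ⟨hj, hji⟩
    refine ⟨j * j0⁻¹, ⟨?_, ?_⟩, by simp⟩
    · have : SemiconjBy (j * j0⁻¹) i⁻¹ i⁻¹ := hji.mul_left hj0i.inv_symm_left
      have := this.inv_right
      rw [inv_inv] at this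
      exact Commute.symm this
    · exact hp j j0⁻¹ hj (by rw [inv_pow, hj0, a_inv a ha])
  · rw [Set.not_nonempty_iff_eq_empty.1 hne]; exact Set.finite_empty

include ha hac hu hp in
theorem q_finite (hf : ∀ i : T, i ^ 2 = a → (Nb a i).Finite) (ha1 : a ≠ 1) :
    {j : T | j ^ 2 = a}.Finite := by
  by_cases hne : ∃ i : T, i ^ 2 = a
  · obtain ⟨i, hi⟩ := hne
    have hU : (⋃ w ∈ Nb a i, Nb a w).Finite := (hf i hi).biUnion (fun w hw => hf w hw.1)
    refine ((Set.toFinite ({i, a * i} : Set T)).union hU).subset ?_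
    intro j hj
    have hj : j ^ 2 = a := hj
    have inv_eq : ∀ z : T, z ^ 2 = a → z⁻¹ = a * z := by
      intro z hz
      have hz3 : z⁻¹ = z ^ 2 * (z ^ 2)⁻¹ * (z ^ 2)⁻¹ * z := by group
      rw [hz, a_inv a ha] at hz3
      rw [hz3, ← sq, ha, one_mul]
    have haa : a * a = 1 := by rw [← sq, ha]
    set r := i * j⁻¹ with hr
    have h8 : r ^ 8 = 1 := hp i j⁻¹ hi (by rw [inv_pow, hj, a_inv a ha])
    have hri : r⁻¹ = j⁻¹ * i := by
      rw [hr, mul_inv_rev, inv_inv, inv_eq i hi, inv_eq j hj, ← mul_assoc, (hac j).eq]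
    have hir : SemiconjBy i r⁻¹ r := by
      rw [SemiconjBy, hri, hr]; group
    have hjr : SemiconjBy j r⁻¹ r := by
      rw [SemiconjBy, hri, hr]; group
    have hir' : SemiconjBy i r r⁻¹ := by simpa using hir.inv_right
    have hjr' : SemiconjBy j r r⁻¹ := by simpa using hjr.inv_right
    -- a power of `r` of order four
    have fin : ∀ w : T, w ^ 2 = a → SemiconjBy i w w⁻¹ → SemiconjBy j w w⁻¹ →
        j ∈ (⋃ w ∈ Nb a i, Nb a w) := by
      intro w hw hiw hjw
      have hwi : SemiconjBy w i i⁻¹ := by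
        have e := hiw.eq
        rw [inv_eq w hw] at e
        show w * i = i⁻¹ * w
        rw [inv_eq i hi, mul_assoc, e, mul_assoc, ← mul_assoc a a, haa, one_mul]
      simp only [Set.mem_iUnion]
      exact ⟨w, ⟨hw, hwi⟩, hj, hjw⟩
    by_cases r2 : r ^ 2 = 1
    · left
      rcases hu r r2 with h | h
      · left; rw [hr] at h; exact (mul_inv_eq_one.1 h).symm
      · right
        show j = a * i
        have : i = a * j := by rw [← h, hr]; group
        rw [this, ← mul_assoc, haa, one_mul]
    · right
      by_cases r4 : r ^ 4 = 1
      · exact fin r (sq_eq_of_four a hu r4 r2) hir' hjr'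
      · refine fin (r ^ 2) (sq_eq_of_four a hu (by rw [← pow_mul]; exact h8)
          (by rw [← pow_mul]; exact r4)) ?_ ?_
        · have := hir'.pow_right 2
          rwa [inv_pow] at this
        · have := hjr'.pow_right 2
          rwa [inv_pow] at this
  · have : {j : T | j ^ 2 = a} = ∅ := by
      ext j
      simp only [Set.mem_ofPred_eq, Set.mem_empty_iff_false, iff_false]
      exact fun h => hne ⟨j, h⟩
    rw [this]; exact Set.finite_empty

include ha hac h2 hu hp in
theorem twogroup_LF (ha1 : a ≠ 1) : LF T := by
  have hq := q_finite a ha hac hu hp (fun i hi => nb_finite a ha hac h2 hu hp hi ha1) ha1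
  by_cases hne : ∃ i : T, i ^ 2 = a
  · obtain ⟨i, hi⟩ := hne
    let Q := {j : T | j ^ 2 = a}
    haveI : Finite Q := hq
    let act : T →* Equiv.Perm Q :=
      { toFun := fun t => (MulAut.conj t).toEquiv.subtypeEquiv (fun j => by
          show j ^ 2 = a ↔ (t * j * t⁻¹) ^ 2 = a
          have : (t * j * t⁻¹) ^ 2 = t * j ^ 2 * t⁻¹ := by rw [sq, sq]; group
          rw [this]
          constructor
          · intro h; rw [h, ← (hac t).eq]; group
          · intro h
            have h3 : j ^ 2 = t⁻¹ * a * t := by rw [← h]; group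
            rw [h3, mul_assoc, (hac t).eq]; group)
        map_one' := by ext x; simp
        map_mul' := by intro x y; ext z; simp [mul_assoc] }
    refine LF.ext act.ker (LF.of_comm ?_ ?_) ?_
    · have hcom : ∀ x : act.ker, Commute i (x : T) := by
        intro x
        have h3 := x.2
        rw [MonoidHom.mem_ker] at h3
        have h4 := congrArg (fun e : Equiv.Perm Q => ((e ⟨i, hi⟩ : Q) : T)) h3
        have h5 : (x : T) * i * (x : T)⁻¹ = i := h4
        show i * x = x * i
        nth_rewrite 1 [← h5]; group
      intro x y
      exact Subtype.ext (cent_comm a ha hac h2 hu hi ha1 (hcom x) (hcom y)).eq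
    · intro x
      obtain ⟨k, hk⟩ := h2 (x : T)
      exact isOfFinOrder_iff_pow_eq_one.2 ⟨2 ^ k, by positivity, Subtype.ext (by simpa using hk)⟩
    · haveI : Finite (T ⧸ act.ker) :=
        Finite.of_equiv _ (QuotientGroup.quotientKerEquivRange act).toEquiv.symm
      exact LF.of_finite _
  · have hall : ∀ t : T, t = 1 ∨ t = a := by
      intro t
      by_cases ht : t ^ 2 = 1
      · exact hu t ht
      · exfalso
        obtain ⟨k, hk⟩ := h2 t
        obtain ⟨m, hm2, hm4⟩ := exists_four_pow hk ht
        exact hne ⟨t ^ m, sq_eq_of_four a hu hm4 hm2⟩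
    haveI : Finite T := by
      refine Set.finite_univ_iff.1 ((Set.toFinite ({1, a} : Set T)).subset ?_)
      intro t _
      exact hall t
    exact LF.of_finite _

end twogroup


namespace Hyp

section basic2
variable {G : Type*} [Group G]

theorem inv_self {a : G} (ha : a ^ 2 = 1) : a⁻¹ = a := inv_eq_of_mul_eq_one_left (by rw [← sq, ha])

theorem semi_of_sq {a x : G} (ha : a ^ 2 = 1) (h : (a * x) ^ 2 = 1) : SemiconjBy a x x⁻¹ := by
  have h1 := inv_self h
  rw [mul_inv_rev, inv_self ha] at h1
  exact h1.symm

theorem sq_of_semi {a x : G} (ha : a ^ 2 = 1) (h : SemiconjBy a x x⁻¹) : (a * x) ^ 2 = 1 := by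
  rw [sq]
  nth_rewrite 1 [h.eq]
  calc x⁻¹ * a * (a * x) = x⁻¹ * a ^ 2 * x := by rw [sq]; group
    _ = 1 := by rw [ha]; group

theorem sq_of_semi' {a x : G} (ha : a ^ 2 = 1) (h : SemiconjBy a x x⁻¹) : (x * a) ^ 2 = 1 := by
  rw [sq]
  calc x * a * (x * a) = x * (a * x) * a := by group
    _ = x * (x⁻¹ * a) * a := by rw [h.eq]
    _ = a ^ 2 := by rw [sq]; group
    _ = 1 := ha

theorem conj_pow' (g x : G) (n : ℕ) : (g⁻¹ * x * g) ^ n = g⁻¹ * x ^ n * g := by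
  have := conj_pow (i := n) (a := g⁻¹) (b := x)
  simpa using this

theorem conj_pow_one {g x : G} {n : ℕ} (h : x ^ n = 1) : (g⁻¹ * x * g) ^ n = 1 := by
  rw [conj_pow', h]; group

theorem conj_ne_one {g x : G} (h : x ≠ 1) : g⁻¹ * x * g ≠ 1 := by
  intro h1
  apply h
  calc x = g * (g⁻¹ * x * g) * g⁻¹ := by group
    _ = 1 := by rw [h1]; group

theorem mem_cent {a g : G} : g ∈ Subgroup.centralizer {a} ↔ Commute a g := by
  rw [Subgroup.mem_centralizer_singleton_iff]
  constructor
  · intro h; exact h.symm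
  · intro h; exact h.eq.symm

theorem semi_conj_of_comm {a i x : G} (hai : Commute a i) (h : SemiconjBy a x x⁻¹) :
    SemiconjBy a (i⁻¹ * x * i) (i⁻¹ * x * i)⁻¹ := by
  have h1 : SemiconjBy a i⁻¹ i⁻¹ := hai.inv_right
  have h2 : SemiconjBy a i i := hai
  have := (h1.mul_right h).mul_right h2
  rwa [show i⁻¹ * x⁻¹ * i = (i⁻¹ * x * i)⁻¹ by group] at this

theorem semi_one_of_comm {a x : G} (h : SemiconjBy a x x⁻¹) (hc : Commute a x) : x ^ 2 = 1 := by
  have : x⁻¹ * a = x * a := by rw [← h.eq, hc.eq]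
  have := mul_right_cancel this
  rw [sq]; nth_rewrite 1 [← this]; group

end basic2

section caseA
variable {G : Type*} [Group G] (hG : Hyp G)
  (hA : ∀ a b : G, a ^ 2 = 1 → b ^ 2 = 1 → a ≠ 1 → b ≠ 1 → Commute a b → a = b)
include hG hA

theorem A1 {a b : G} (ha : a ^ 2 = 1) (hb : b ^ 2 = 1) (ha1 : a ≠ 1) (hb1 : b ≠ 1) :
    (a * b) ^ 9 = 1 := by
  have four : ∀ z : G, z ^ 2 = 1 → z ^ 4 = 1 := by
    intro z hz
    rw [show 4 = 2 * 2 from rfl, pow_mul, hz, one_pow]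
  rcases hG.prod a b (Or.inl (four a ha)) (Or.inl (four b hb)) with h | h
  · by_cases hab : a * b = 1
    · rw [hab, one_pow]
    · obtain ⟨m, hm1, hm2⟩ := exists_inv_pow (k := 3) (g := a * b) (by simpa using h) hab
      have h1 : SemiconjBy a (a * b) (a * b)⁻¹ := by
        rw [SemiconjBy, mul_inv_rev, inv_self ha, inv_self hb, ← mul_assoc, ← sq, ha, mul_assoc, ← sq, ha]
        simp
      have h2 : SemiconjBy b (a * b) (a * b)⁻¹ := by
        rw [SemiconjBy, mul_inv_rev, inv_self ha, inv_self hb, mul_assoc]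
      have h3 := h1.pow_right m
      have h4 := h2.pow_right m
      rw [inv_pow, inv_self hm2] at h3 h4
      have h5 := hA _ _ ha hm2 ha1 hm1 h3
      have h6 := hA _ _ hb hm2 hb1 hm1 h4
      rw [h6, ← h5, ← sq, ha, one_pow]
  · exact h

theorem prodInv {a u w : G} (ha : a ^ 2 = 1) (ha1 : a ≠ 1) (hu : SemiconjBy a u u⁻¹)
    (hw : SemiconjBy a w w⁻¹) (hu9 : u ^ 9 = 1) (hw9 : w ^ 9 = 1) : (u * w) ^ 9 = 1 := by
  have h1 := sq_of_semi' ha hu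
  have h2 := sq_of_semi ha hw
  have ne : ∀ z : G, z ^ 9 = 1 → z ≠ a := by
    rintro z hz rfl
    exact ha1 (eq_one_two_nine ha hz)
  have h3 : u * a ≠ 1 := by
    intro h
    apply ne u hu9
    rw [mul_eq_one_iff_eq_inv, inv_self ha] at h
    exact h
  have h4 : a * w ≠ 1 := by
    intro h
    apply ne w hw9
    rw [mul_eq_one_iff_eq_inv'] at h
    rw [h, inv_self ha]
  have := hG.A1 hA h1 h2 h3 h4
  rwa [show u * a * (a * w) = u * (a ^ 2) * w by rw [sq]; group, ha, mul_one] at this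

theorem cent_invol {a t : G} (ha : a ^ 2 = 1) (ha1 : a ≠ 1) (ht : t ^ 2 = 1) (h : Commute a t) :
    t = 1 ∨ t = a := by
  by_cases h1 : t = 1
  · exact Or.inl h1
  · exact Or.inr (hA _ _ ha ht ha1 h1 h).symm

theorem F3 {i x : G} (hi : i ^ 4 = 1) (hi2 : i ^ 2 ≠ 1) (hx : x ^ 3 = 1)
    (h : SemiconjBy (i ^ 2) x x⁻¹) : Commute x (i⁻¹ * x * i) := by
  by_cases hx1 : x = 1
  · rw [hx1]; exact Commute.one_left _
  have ha : (i ^ 2) ^ 2 = 1 := by rw [← pow_mul]; exact hi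
  have hai : Commute (i ^ 2) i := (Commute.refl i).pow_left 2
  have hu := semi_conj_of_comm hai h
  have h9 : ∀ z : G, z ^ 3 = 1 → z ^ 9 = 1 := by
    intro z hz
    rw [show 9 = 3 * 3 from rfl, pow_mul, hz, one_pow]
  have hx9 := h9 x hx
  have hu9 := conj_pow_one (g := i) hx9
  have hx' : SemiconjBy (i ^ 2) x⁻¹ x⁻¹⁻¹ := h.inv_right
  have q0 := sq_of_semi ha h
  have q1 := hG.prodInv hA ha hi2 hu h hu9 hx9
  have q2 := hG.prodInv hA ha hi2 hu hx' hu9 (by rw [inv_pow, hx9, inv_one])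
  have hno : ¬ Commute (i ^ 2) x := by
    intro hc
    exact hx1 (hG.three_cent ha hi2 hx9 hc)
  rcases hG.prod i x (Or.inl hi) (Or.inr hx) with h8 | h9'
  · have := tc_F8 (Subgroup.centralizer {i ^ 2}) i x hi hx q0 h8 q2 (mem_cent.2 hai)
    rw [mem_cent] at this
    have ht2 : ((i * x) ^ 4) ^ 2 = 1 := by rw [← pow_mul]; exact h8
    rcases hG.cent_invol hA ha hi2 ht2 this with h1 | h1
    · set u := i⁻¹ * x * i with hu_def
      have e1 : (i * x) ^ 4 = (i ^ 2 * (u * x)) * (i ^ 2 * (u * x)) := by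
        rw [hu_def]; simp only [pow_succ, pow_zero, one_mul]; group
      have e2 : i ^ 2 * (u * x) = (u⁻¹ * x⁻¹) * i ^ 2 := (hu.mul_right h).eq
      rw [e1] at h1
      nth_rewrite 1 [e2] at h1
      rw [show u⁻¹ * x⁻¹ * i ^ 2 * (i ^ 2 * (u * x)) = u⁻¹ * x⁻¹ * (i ^ 4) * (u * x) by group, hi,
        mul_one] at h1
      show x * u = u * x
      calc x * u = x * u * (u⁻¹ * x⁻¹ * (u * x)) := by rw [h1, mul_one]
        _ = u * x := by group
    · exfalso
      apply hno
      have h2 : Commute (i ^ 2) (i * x) := by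
        rw [← h1]; exact (Commute.refl _).pow_left 4
      have := hai.inv_right.mul_right h2
      rwa [inv_mul_cancel_left] at this
  · exfalso
    have := tc_F9 (Subgroup.centralizer {i ^ 2}) i x hi hx q0 h9' q1 q2 (mem_cent.2 hai)
    exact hno (mem_cent.1 this)

theorem A3 {i x : G} (hi : i ^ 4 = 1) (hi2 : i ^ 2 ≠ 1) (hx : x ^ 9 = 1)
    (h : SemiconjBy (i ^ 2) x x⁻¹) : Commute x (i⁻¹ * x * i) := by
  by_cases hx3 : x ^ 3 = 1
  · exact hG.F3 hA hi hi2 hx3 h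
  have ha : (i ^ 2) ^ 2 = 1 := by rw [← pow_mul]; exact hi
  have hai : Commute (i ^ 2) i := (Commute.refl i).pow_left 2
  have hy : (x ^ 3) ^ 3 = 1 := by rw [← pow_mul]; exact hx
  have hya : SemiconjBy (i ^ 2) (x ^ 3) (x ^ 3)⁻¹ := by
    have := h.pow_right 3
    rwa [inv_pow] at this
  have h1 := hG.F3 hA hi hi2 hy hya
  have h2 : Commute x (i⁻¹ * x ^ 3 * i) :=
    hG.lemA_comm ha hi2 hy hx3 hya ((Commute.refl x).pow_left 3) h1
  refine hG.lemA_comm (y := i⁻¹ * x ^ 3 * i) ha hi2 (conj_pow_one hy) (conj_ne_one hx3)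
    (semi_conj_of_comm hai hya) h2.symm ?_
  rw [← conj_pow']
  exact (Commute.refl _).pow_left 3

theorem A4 {j b : G} (hj : j ^ 4 = 1) (hj2 : j ^ 2 ≠ 1) (hb : b ^ 2 = 1) :
    (j * b) ^ 4 = 1 ∧ (j * b) ^ 2 ≠ 1 := by
  by_cases hb1 : b = 1
  · rw [hb1, mul_one]; exact ⟨hj, hj2⟩
  have ha : (j ^ 2) ^ 2 = 1 := by rw [← pow_mul]; exact hj
  have hx9 : (j ^ 2 * b) ^ 9 = 1 := hG.A1 hA ha hb hj2 hb1
  set x := j ^ 2 * b with hx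
  have hxa : SemiconjBy (j ^ 2) x x⁻¹ := by
    apply semi_of_sq ha
    rw [hx, ← mul_assoc, ← sq, ha, one_mul, hb]
  have hji : (j⁻¹) ^ 2 = j ^ 2 := by rw [inv_pow, inv_self ha]
  have h1 := hG.A3 hA (i := j⁻¹) (x := x) (by rw [inv_pow, hj, inv_one]) (by rw [hji]; exact hj2) hx9
    (by rw [hji]; exact hxa)
  rw [inv_inv] at h1
  have hua := semi_conj_of_comm (i := j⁻¹) (((Commute.refl j).pow_left 2).inv_right) hxa
  rw [inv_inv] at hua
  set u := j * x * j⁻¹ with hu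
  have hu9 : u ^ 9 = 1 := by
    have := conj_pow_one (g := j⁻¹) hx9
    rwa [inv_inv] at this
  have hw9 : (u * x) ^ 9 = 1 := by rw [h1.symm.mul_pow, hu9, hx9, one_mul]
  have hwa : SemiconjBy (j ^ 2) (u * x) (u * x)⁻¹ := by
    have := hua.mul_right hxa
    rwa [← mul_inv_rev, h1.eq] at this
  have e1 : j * b = j⁻¹ * x := by rw [hx]; group
  have e2 : (j * b) ^ 2 = j ^ 2 * (u * x) := by
    rw [← hji, e1, hu]; simp only [pow_succ, pow_zero, one_mul]; group
  have e3 := sq_of_semi ha hwa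
  constructor
  · rw [show 4 = 2 * 2 from rfl, pow_mul, e2, e3]
  · rw [e2]
    intro h
    rw [mul_eq_one_iff_eq_inv', inv_self ha] at h
    rw [h] at hw9
    exact hj2 (eq_one_two_nine ha hw9)

theorem A5 {m : G} (hm : m ∈ Subgroup.closure {t : G | t ^ 2 = 1}) :
    ∀ j : G, j ^ 4 = 1 → j ^ 2 ≠ 1 → (j * m) ^ 4 = 1 ∧ (j * m) ^ 2 ≠ 1 := by
  induction hm using Subgroup.closure_induction'' with
  | mem x hx => intro j hj hj2; exact hG.A4 hA hj hj2 hx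
  | inv_mem x hx => intro j hj hj2; exact hG.A4 hA hj hj2 (by rw [inv_pow, hx, inv_one])
  | one => intro j hj hj2; rw [mul_one]; exact ⟨hj, hj2⟩
  | mul x y _ _ hx hy =>
    intro j hj hj2
    obtain ⟨h1, h2⟩ := hx j hj hj2
    rw [← mul_assoc]
    exact hy _ h1 h2

theorem A5' {m : G} (hm : m ∈ Subgroup.closure {t : G | t ^ 2 = 1}) (h4 : m ^ 4 = 1) : m ^ 2 = 1 := by
  by_contra h
  have := (hG.A5 hA (inv_mem hm) m h4 h).2
  simp at this

omit hG hA in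
theorem inverted_mem {a x : G} (ha : a ^ 2 = 1) (h : SemiconjBy a x x⁻¹) :
    x ∈ Subgroup.closure {t : G | t ^ 2 = 1} := by
  have h1 : x * a ∈ Subgroup.closure {t : G | t ^ 2 = 1} :=
    Subgroup.subset_closure (sq_of_semi' ha h)
  have h2 : a ∈ Subgroup.closure {t : G | t ^ 2 = 1} := Subgroup.subset_closure ha
  have := mul_mem h1 (inv_mem h2)
  rwa [mul_inv_cancel_right] at this

theorem A6 {a x y : G} (ha : a ^ 2 = 1) (ha1 : a ≠ 1) (hx : SemiconjBy a x x⁻¹)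
    (hy : SemiconjBy a y y⁻¹) (hx9 : x ^ 9 = 1) (hy9 : y ^ 9 = 1) : Commute x y := by
  have h9 := hG.prodInv hA ha ha1 hx hy hx9 hy9
  obtain ⟨d, _, hd9, hda, hc⟩ := decomp (g := x * y) ha
    (hG.A1 hA ha (conj_pow_one ha) ha1 (conj_ne_one ha1))
  have hcM : x * y * d⁻¹ ∈ Subgroup.closure {t : G | t ^ 2 = 1} :=
    mul_mem (mul_mem (inverted_mem ha hx) (inverted_mem ha hy)) (inv_mem (inverted_mem ha hda))
  have hc2 : (x * y * d⁻¹) ^ 2 = 1 := by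
    by_contra hne
    obtain ⟨k, hk⟩ := hG.cent_inv ha ha1 hc.symm
    obtain ⟨m, hm2, hm4⟩ := exists_four_pow hk hne
    exact hm2 (hG.A5' hA (pow_mem hcM m) hm4)
  rcases hG.cent_invol hA ha ha1 hc2 hc.symm with h | h
  · have e : x * y = d := mul_inv_eq_one.1 h
    have h1 : SemiconjBy a (x * y) (x * y)⁻¹ := by rw [e]; exact hda
    have h2 := hx.mul_right hy
    have h3 := mul_right_cancel (h1.eq.symm.trans h2.eq)
    have h4 := congrArg (·⁻¹) h3
    simp at h4
    exact h4
  · have e : x * y = a * d := by rw [← h]; group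
    have e2 : (x * y) ^ 2 = 1 := by rw [e]; exact sq_of_semi ha hda
    have e3 := eq_one_two_nine e2 h9
    rw [mul_eq_one_iff_eq_inv] at e3
    rw [e3]; exact (Commute.refl y).inv_left

theorem caseA_LF {a : G} (ha : a ^ 2 = 1) (ha1 : a ≠ 1) : LF G := by
  let K : Subgroup G :=
    { carrier := {x | x ^ 9 = 1 ∧ SemiconjBy a x x⁻¹}
      one_mem' := ⟨one_pow _, by simp [SemiconjBy]⟩
      mul_mem' := by
        rintro x y ⟨hx9, hx⟩ ⟨hy9, hy⟩
        have hc := hG.A6 hA ha ha1 hx hy hx9 hy9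
        refine ⟨by rw [hc.mul_pow, hx9, hy9, one_mul], ?_⟩
        have := hx.mul_right hy
        rwa [← mul_inv_rev, ← hc.eq] at this
      inv_mem' := by
        rintro x ⟨hx9, hx⟩
        exact ⟨by rw [inv_pow, hx9, inv_one], hx.inv_right⟩ }
  have hdec : ∀ g : G, ∃ d ∈ K, Commute (g * d⁻¹) a := by
    intro g
    obtain ⟨d, _, hd9, hda, hc⟩ := decomp (g := g) ha
      (hG.A1 hA ha (conj_pow_one ha) ha1 (conj_ne_one ha1))
    exact ⟨d, ⟨hd9, hda⟩, hc⟩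
  haveI hKn : K.Normal := by
    constructor
    rintro x ⟨hx9, hx⟩ g
    obtain ⟨d, ⟨hd9, hd⟩, hc⟩ := hdec g
    have hcom := hG.A6 hA ha ha1 hd hx hd9 hx9
    have e : g * x * g⁻¹ = (g * d⁻¹)⁻¹⁻¹ * x * (g * d⁻¹)⁻¹ := by
      calc g * x * g⁻¹ = g * d⁻¹ * (d * x) * g⁻¹ := by group
        _ = g * d⁻¹ * (x * d) * g⁻¹ := by rw [hcom.eq]
        _ = _ := by group
    rw [e]
    exact ⟨conj_pow_one hx9, semi_conj_of_comm hc.symm.inv_right hx⟩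
  refine LF.ext K ?_ ?_
  · apply LF.of_comm
    · rintro ⟨x, hx9, hx⟩ ⟨y, hy9, hy⟩
      exact Subtype.ext (hG.A6 hA ha ha1 hx hy hx9 hy9).eq
    · rintro ⟨x, hx9, hx⟩
      exact isOfFinOrder_iff_pow_eq_one.2 ⟨9, by norm_num, Subtype.ext hx9⟩
  · let C := Subgroup.centralizer ({a} : Set G)
    refine LF.of_surjective ((QuotientGroup.mk' K).comp C.subtype) ?_ ?_
    · intro q
      obtain ⟨g, rfl⟩ := QuotientGroup.mk'_surjective K q
      obtain ⟨d, hd, hc⟩ := hdec g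
      refine ⟨⟨g * d⁻¹, mem_cent.2 hc.symm⟩, ?_⟩
      show (QuotientGroup.mk (g * d⁻¹) : G ⧸ K) = QuotientGroup.mk g
      rw [QuotientGroup.eq]
      have : (g * d⁻¹)⁻¹ * g = d := by group
      rw [this]; exact hd
    · have haC : a ∈ C := mem_cent.2 (Commute.refl a)
      refine twogroup_LF (T := C) ⟨a, haC⟩ (Subtype.ext ha) ?_ ?_ ?_ ?_ ?_
      · rintro ⟨t, ht⟩
        exact Subtype.ext (mem_cent.1 ht).eq
      · rintro ⟨t, ht⟩
        obtain ⟨k, hk⟩ := hG.cent_inv ha ha1 (mem_cent.1 ht)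
        exact ⟨k, Subtype.ext hk⟩
      · rintro ⟨t, ht⟩ ht2
        have ht2 : t ^ 2 = 1 := congrArg Subtype.val ht2
        rcases hG.cent_invol hA ha ha1 ht2 (mem_cent.1 ht) with h | h
        · left; exact Subtype.ext h
        · right; exact Subtype.ext h
      · rintro ⟨x, hx⟩ ⟨y, hy⟩ hxa hya
        have hxa : x ^ 2 = a := congrArg Subtype.val hxa
        have hya : y ^ 2 = a := congrArg Subtype.val hya
        apply Subtype.ext
        show (x * y) ^ 8 = 1
        have f : ∀ z : G, z ^ 2 = a → z ^ 4 = 1 := by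
          intro z hz
          rw [show 4 = 2 * 2 from rfl, pow_mul, hz, ha]
        rcases hG.prod x y (Or.inl (f x hxa)) (Or.inl (f y hya)) with h | h
        · exact h
        · rw [hG.three_cent ha ha1 h ((mem_cent.1 hx).mul_right (mem_cent.1 hy)), one_pow]
      · intro h
        exact ha1 (congrArg Subtype.val h)

end caseA
end Hyp


namespace Hyp

section caseB
variable {G : Type*} [Group G]

/-- `a` inverts an element of order three. -/
def InJ (a : G) : Prop := ∃ y : G, y ^ 3 = 1 ∧ y ≠ 1 ∧ (a * y) ^ 2 = 1

theorem four_of_two {z : G} (hz : z ^ 2 = 1) : z ^ 4 = 1 := by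
  rw [show 4 = 2 * 2 from rfl, pow_mul, hz, one_pow]

theorem comm_of_sq {a b : G} (ha : a ^ 2 = 1) (hb : b ^ 2 = 1) (h : (a * b) ^ 2 = 1) : Commute a b := by
  have := inv_self h
  rw [mul_inv_rev, inv_self ha, inv_self hb] at this
  exact this.symm

theorem InJ.conj {a : G} (g : G) (h : InJ a) : InJ (g⁻¹ * a * g) := by
  obtain ⟨y, hy, hy1, hay⟩ := h
  refine ⟨g⁻¹ * y * g, conj_pow_one hy, conj_ne_one hy1, ?_⟩
  rw [show g⁻¹ * a * g * (g⁻¹ * y * g) = g⁻¹ * (a * y) * g by group]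
  exact conj_pow_one hay

variable (hG : Hyp G)
include hG

theorem not_comm {a y : G} (ha : a ^ 2 = 1) (ha1 : a ≠ 1) (hy : y ^ 3 = 1) (hy1 : y ≠ 1) :
    ¬ Commute a y := by
  intro h
  rcases hG.six a y ha hy h with h | h
  · exact ha1 h
  · exact hy1 h

theorem C89 {a b y : G} (ha : a ^ 2 = 1) (ha1 : a ≠ 1) (hb : b ^ 2 = 1) (hy : y ^ 3 = 1)
    (hab : (a * b) ^ 2 = 1) (hay : (a * y) ^ 2 = 1) (h8 : (b * y) ^ 8 = 1)
    (h9 : (a * b * y) ^ 9 = 1) : (a * b * y) ^ 3 = 1 ∧ (b * y) ^ 4 = 1 := by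
  have h := tc_C89 (Subgroup.centralizer {a}) a b y ha hb hy hab hay h8 h9
    (mem_cent.2 (Commute.refl a)) (mem_cent.2 (comm_of_sq ha hb hab))
  have h3 : (a * b * y) ^ 3 = 1 :=
    hG.three_cent ha ha1 (by rw [← pow_mul, mul_comm, pow_mul, h9, one_pow]) (mem_cent.1 h)
  exact ⟨h3, tc_S4c a b y ha hb hy hab hay h3⟩

theorem lemC {a b y : G} (ha : a ^ 2 = 1) (ha1 : a ≠ 1) (hb : b ^ 2 = 1) (hy : y ^ 3 = 1)
    (hy1 : y ≠ 1) (hab : (a * b) ^ 2 = 1) (hay : (a * y) ^ 2 = 1) :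
    ((b * y) ^ 3 = 1 ∧ (a * b * y) ^ 4 = 1) ∨ ((a * b * y) ^ 3 = 1 ∧ (b * y) ^ 4 = 1) := by
  have hc := comm_of_sq ha hb hab
  have hno := hG.not_comm ha ha1 hy hy1
  have hp := hG.prod b (y⁻¹ * (a * b) * y) (Or.inl (four_of_two hb))
    (Or.inl (four_of_two (conj_pow_one hab)))
  rw [show b * (y⁻¹ * (a * b) * y) = b * y⁻¹ * a * b * y by group] at hp
  have ma := (mem_cent.2 (Commute.refl a))
  have mb := (mem_cent.2 hc)
  have e : a * (a * b) = b := by rw [← mul_assoc, ← sq, ha, one_mul]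
  rcases hG.prod b y (Or.inl (four_of_two hb)) (Or.inr hy) with h1 | h1 <;>
  rcases hG.prod (a * b) y (Or.inl (four_of_two hab)) (Or.inr hy) with h2 | h2
  · exfalso
    rcases hp with hp | hp
    · exact hno (mem_cent.1 (tc_C88_8 _ a b y ha hb hy hab hay h1 h2 hp ma mb))
    · exact hno (mem_cent.1 (tc_C88_9 _ a b y ha hb hy hab hay h1 h2 hp ma mb))
  · right
    exact hG.C89 ha ha1 hb hy hab hay h1 h2
  · left
    have := hG.C89 (b := a * b) ha ha1 hab hy (by rw [e]; exact hb) hay h2 (by rw [e]; exact h1)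
    rw [e] at this
    exact this
  · exfalso
    rcases hp with hp | hp
    · exact hno (mem_cent.1 (tc_C99_8 _ a b y ha hb hy hab hay h1 h2 hp ma mb))
    · exact hno (mem_cent.1 (tc_C99_9 _ a b y ha hb hy hab hay h1 h2 hp ma mb))

theorem lemD0 {a p y b : G} (ha : a ^ 2 = 1) (hp : p ^ 2 = 1) (hb : b = (a * p) ^ 2) (hb2 : b ^ 2 = 1)
    (hb1 : b ≠ 1) (hy : y ^ 3 = 1) (hy1 : y ≠ 1) (hby : (b * y) ^ 2 = 1)
    (h1 : (a * y) ^ 3 = 1) (h2 : (b * a * y) ^ 4 = 1) (h3 : (p * y) ^ 3 = 1)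
    (h4 : (b * p * y) ^ 4 = 1) : False := by
  have hno := hG.not_comm hb2 hb1 hy hy1
  have h40 : (a * p) ^ 4 = 1 := by rw [show 4 = 2 * 2 from rfl, pow_mul, ← hb, hb2]
  have eb : b * p = a * p * a := by
    rw [hb, sq, show a * p * (a * p) * p = a * p * a * p ^ 2 by rw [sq]; group, hp, mul_one]
  have hbi : b⁻¹ = (p * a) ^ 2 := by
    rw [hb, ← inv_pow, mul_inv_rev, inv_self ha, inv_self hp]
  have hbi' : b = (p * a) ^ 2 := by rw [← hbi, inv_self hb2]
  have ea : b * a = p * a * p := by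
    rw [hbi', sq, show p * a * (p * a) * a = p * a * p * a ^ 2 by rw [sq]; group, ha, mul_one]
  have ma : a ∈ Subgroup.centralizer {b} := by
    rw [mem_cent]
    show b * a = a * b
    rw [ea, hb, sq, show a * (a * p * (a * p)) = a ^ 2 * p * a * p by rw [sq]; group, ha, one_mul]
  have mp : p ∈ Subgroup.centralizer {b} := by
    rw [mem_cent]
    show b * p = p * b
    rw [eb, hbi', sq, show p * (p * a * (p * a)) = p ^ 2 * a * p * a by rw [sq]; group, hp, one_mul]
  rw [ea] at h2
  rw [eb] at h4
  rcases hG.prod (a * p) y (Or.inl h40) (Or.inr hy) with h | h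
  · exact hno (mem_cent.1 (tc_D8 _ a p y ha hp h40 hy (by rw [← hb]; exact hby) h1 h2 h3 h4 h ma mp))
  · exact hno (mem_cent.1 (tc_D9 _ a p y ha hp h40 hy (by rw [← hb]; exact hby) h1 h2 h3 h4 h ma mp))

theorem lemD {a p : G} (ha : a ^ 2 = 1) (hp : p ^ 2 = 1) (h4 : (a * p) ^ 4 = 1)
    (hb1 : (a * p) ^ 2 ≠ 1) (hJ : InJ ((a * p) ^ 2)) : False := by
  obtain ⟨y, hy, hy1, hby⟩ := hJ
  have hb2 : ((a * p) ^ 2) ^ 2 = 1 := by rw [← pow_mul]; exact h4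
  obtain ⟨b, hb⟩ : ∃ b, b = (a * p) ^ 2 := ⟨_, rfl⟩
  rw [← hb] at hb1 hby hb2
  have hbi' : b = (p * a) ^ 2 := by
    rw [← inv_self hb2, hb, ← inv_pow, mul_inv_rev, inv_self ha, inv_self hp]
  have ma : b * a = a * b := by
    rw [hb]; nth_rewrite 1 [← hb, hbi']
    rw [sq, sq, show p * a * (p * a) * a = p * a * p * a ^ 2 by rw [sq]; group,
      show a * (a * p * (a * p)) = a ^ 2 * p * a * p by rw [sq]; group, ha, mul_one, one_mul]
  have mp : b * p = p * b := by
    have l1 : b * p = a * p * a * p ^ 2 := by rw [hb, sq, sq]; group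
    have l2 : p * b = p ^ 2 * a * p * a := by rw [hbi', sq, sq]; group
    rw [l1, l2, hp, mul_one, one_mul]
  have hba : (b * a) ^ 2 = 1 := by rw [Commute.mul_pow ma, hb2, ha, one_mul]
  have hbp : (b * p) ^ 2 = 1 := by rw [Commute.mul_pow mp, hb2, hp, one_mul]
  have hbb : b * b = 1 := by rw [← sq, hb2]
  have c1 : b * (b * a) = a := by rw [← mul_assoc, hbb, one_mul]
  have c2 : b * (b * p) = p := by rw [← mul_assoc, hbb, one_mul]
  have e1 : b * a * p = b * (a * p) := by group
  have e2 : a * (b * p) = b * (a * p) := by rw [← mul_assoc, ← ma]; group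
  have e3 : b * a * (b * p) = a * p := by
    rw [ma, show a * b * (b * p) = a * (b * b) * p by group, hbb, mul_one]
  have hcb : Commute b (a * p) := by rw [hb]; exact (Commute.refl _).pow_left 2
  have e4 : b = (b * (a * p)) ^ 2 := by rw [hcb.mul_pow, hb2, one_mul, hb]
  rcases hG.lemC hb2 hb1 ha hy hy1 hba hby with ⟨q1, q2⟩ | ⟨q1, q2⟩ <;>
  rcases hG.lemC hb2 hb1 hp hy hy1 hbp hby with ⟨q3, q4⟩ | ⟨q3, q4⟩
  · exact hG.lemD0 ha hp hb hb2 hb1 hy hy1 hby q1 q2 q3 q4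
  · exact hG.lemD0 (p := b * p) ha hbp (by rw [e2]; exact e4) hb2 hb1 hy hy1 hby q1 q2 q3 (by rw [c2]; exact q4)
  · exact hG.lemD0 (a := b * a) hba hp (by rw [e1]; exact e4) hb2 hb1 hy hy1 hby q1 (by rw [c1]; exact q2) q3 q4
  · exact hG.lemD0 (a := b * a) (p := b * p) hba hbp (by rw [e3]; exact hb) hb2 hb1 hy hy1 hby q1
      (by rw [c1]; exact q2) q3 (by rw [c2]; exact q4)

theorem lem2 {a z : G} (ha : a ^ 2 = 1) (ha1 : a ≠ 1) (hz : z ^ 3 = 1) (hz1 : z ≠ 1)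
    (haz : (a * z) ^ 3 = 1) (hJ : InJ a) : False := by
  have hJ0 := hJ
  obtain ⟨y, hy, hy1, hay⟩ := hJ
  have h2 := tc_A4 a z ha hz haz
  have hb : (z⁻¹ * a * z) ^ 2 = 1 := conj_pow_one ha
  rw [show a * z⁻¹ * a * z = a * (z⁻¹ * a * z) by group] at h2
  have key : ∀ e : G, e ^ 2 = 1 → e ≠ 1 → InJ e → Commute a e → (e * y) ^ 3 = 1 → False := by
    intro e he he1 heJ hae hey
    have hs := semi_of_sq ha hay
    have hs' : SemiconjBy a y⁻¹ y := by simpa using hs.inv_right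
    have hc : SemiconjBy a (y⁻¹ * e * y) (y * e * y⁻¹) := (hs'.mul_right hae).mul_right hs
    have e1 : (a * (y⁻¹ * e * y)) ^ 2 = e := by
      rw [sq]; nth_rewrite 1 [hc.eq]
      calc y * e * y⁻¹ * a * (a * (y⁻¹ * e * y)) = y * e * y⁻¹ * a ^ 2 * (y⁻¹ * e * y) := by rw [sq]; group
        _ = y * e * y⁻¹ * y⁻¹ * e * y := by rw [ha]; group
        _ = y * e * (y ^ 3) * y⁻¹ * y⁻¹ * e * y := by rw [hy]; group
        _ = e⁻¹ * (e * y) ^ 3 := by simp only [pow_succ, pow_zero, one_mul]; group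
        _ = e := by rw [hey, mul_one, inv_self he]
    refine hG.lemD ha (conj_pow_one (g := y) he) ?_ (by rw [e1]; exact he1) (by rw [e1]; exact heJ)
    rw [show 4 = 2 * 2 from rfl, pow_mul, e1, he]
  have hcab := comm_of_sq ha hb h2
  rcases hG.lemC ha ha1 hb hy hy1 h2 hay with ⟨q, _⟩ | ⟨q, _⟩
  · exact key _ hb (conj_ne_one ha1) (hJ0.conj z) hcab q
  · have e1 : a * (z⁻¹ * a * z) = z⁻¹⁻¹ * a * z⁻¹ := by
      have : a = z * a * z * a * z := by
        calc a = a⁻¹ := (inv_self ha).symm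
          _ = a⁻¹ * (a * z) ^ 3 := by rw [haz, mul_one]
          _ = _ := by simp only [pow_succ, pow_zero, one_mul]; group
      calc a * (z⁻¹ * a * z) = (z * a * z * a * z) * (z⁻¹ * a * z) := by rw [← this]
        _ = z * a * z * a ^ 2 * z := by rw [sq]; group
        _ = z * a * z⁻¹ * z ^ 3 := by rw [ha, mul_one]; simp [pow_succ, mul_assoc]
        _ = _ := by rw [hz]; group
    refine key _ h2 ?_ ?_ ((Commute.refl a).mul_right hcab) q
    · rw [e1]; exact conj_ne_one ha1
    · rw [e1]; exact hJ0.conj z⁻¹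

theorem notJ {a b : G} (ha : a ^ 2 = 1) (haJ : ¬ InJ a) (hb : b ^ 2 = 1) : (a * b) ^ 8 = 1 := by
  rcases hG.prod a b (Or.inl (four_of_two ha)) (Or.inl (four_of_two hb)) with h | h
  · exact h
  · have hs : SemiconjBy a (a * b) (a * b)⁻¹ := by
      apply semi_of_sq ha
      rw [← mul_assoc, ← sq, ha, one_mul, hb]
    by_cases h1 : a * b = 1
    · rw [h1, one_pow]
    · exfalso
      by_cases h3 : (a * b) ^ 3 = 1
      · exact haJ ⟨_, h3, h1, sq_of_semi ha hs⟩
      · refine haJ ⟨_, by rw [← pow_mul]; exact h, h3, sq_of_semi ha ?_⟩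
        have := hs.pow_right 3
        rwa [inv_pow] at this

theorem E8 {a x : G} (ha : a ^ 2 = 1) (ha1 : a ≠ 1) (haJ : ¬ InJ a) (hx : x ^ 3 = 1)
    (hx1 : x ≠ 1) (h8 : (a * x) ^ 8 = 1) : False := by
  have hno := hG.not_comm ha ha1 hx hx1
  by_cases h4 : (a * x) ^ 4 = 1
  · have h3 := tc_S4a a x ha hx h4
    by_cases h1 : a * x⁻¹ * a * x = 1
    · apply hno
      have h5 := mul_eq_one_iff_eq_inv.1 h1
      have h6 : a * x⁻¹ = x⁻¹ * a := by
        calc a * x⁻¹ = (a * x⁻¹ * a) * a⁻¹ := by group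
          _ = x⁻¹ * a := by rw [h5, inv_self ha]
      have h7 : Commute a x⁻¹ := h6
      simpa using h7.inv_right
    · refine haJ ⟨_, h3, h1, ?_⟩
      rw [show a * (a * x⁻¹ * a * x) = a ^ 2 * (x⁻¹ * a * x) by rw [sq]; group, ha, one_mul]
      exact conj_pow_one ha
  obtain ⟨s, hs⟩ : ∃ s, s = (a * x) ^ 4 := ⟨_, rfl⟩
  rw [← hs] at h4
  have hs2 : s ^ 2 = 1 := by rw [hs, ← pow_mul]; exact h8
  have hnos := hG.not_comm hs2 h4 hx hx1
  have hsc : Commute s (a * x) := by rw [hs]; exact (Commute.refl _).pow_left 4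
  obtain ⟨s1, hs1⟩ : ∃ s1, s1 = x * s * x⁻¹ := ⟨_, rfl⟩
  obtain ⟨s2, hs2'⟩ : ∃ s2, s2 = x * s1 * x⁻¹ := ⟨_, rfl⟩
  have xs : SemiconjBy x s s1 := by rw [hs1, SemiconjBy]; group
  have xs1 : SemiconjBy x s1 s2 := by rw [hs2', SemiconjBy]; group
  have xs2 : SemiconjBy x s2 s := by
    have : s2 = x ^ 3 * x⁻¹ * s * x * (x ^ 3)⁻¹ := by
      rw [hs2', hs1]; simp [pow_succ, mul_assoc]
    rw [this, hx, SemiconjBy]; group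
  have haa : a * a = 1 := by rw [← sq, ha]
  have as : SemiconjBy a s s1 := by
    have : s1 = a * (a * x * s) * x⁻¹ := by
      rw [hs1, ← mul_assoc, ← mul_assoc, haa, one_mul]
    rw [this, ← hsc.eq, SemiconjBy]
    calc a * s = a * s * (a * a) := by rw [haa, mul_one]
      _ = _ := by group
  have as1 : SemiconjBy a s1 s := by
    have := as.inv_symm_left
    rwa [inv_self ha] at this
  have ssm : s * s = 1 := by rw [← sq, hs2]
  have hr8 : (s * a) ^ 8 = 1 := by
    have := hG.notJ ha haJ hs2
    have h := conj_pow_one (g := a) this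
    rwa [show a⁻¹ * (a * s) * a = s * a by group] at h
  have hss1 : s * s1 = (s * a) ^ 2 := by
    have : s1 = a * s * a := by rw [as.eq, mul_assoc, haa, mul_one]
    rw [this, sq]; group
  have q4 : (s * x⁻¹ * s * x) ^ 4 = 1 := by
    have e : s * x⁻¹ * s * x = x⁻¹ * (s * s1)⁻¹ * x := by
      rw [hs1]
      simp only [mul_inv_rev, inv_inv, inv_self hs2]; group
    rw [e]
    apply conj_pow_one
    rw [inv_pow, hss1, ← pow_mul, hr8, inv_one]
  rcases hG.prod s x (Or.inl (four_of_two hs2)) (Or.inr hx) with h | h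
  · have hp := hG.prod s (x * (s * x * s) * x⁻¹) (Or.inl (four_of_two hs2)) (Or.inr ?_)
    · rw [show s * (x * (s * x * s) * x⁻¹) = s * x * s * x * s * x⁻¹ by group] at hp
      have ms := mem_cent.2 (Commute.refl s)
      rcases hp with hp | hp
      · exact hnos (mem_cent.1 (tc_E8_8 _ s x hs2 hx q4 h hp ms))
      · exact hnos (mem_cent.1 (tc_E8_9 _ s x hs2 hx q4 h hp ms))
    · have e : x * (s * x * s) * x⁻¹ = (s * x⁻¹)⁻¹ * x * (s * x⁻¹) := by
        rw [mul_inv_rev, inv_inv, inv_self hs2]; group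
      rw [e]; exact conj_pow_one hx
  · have h1 := mem_cent.1 (tc_E9 _ s x hs2 hx q4 h (mem_cent.2 (Commute.refl x)))
    have h2 : Commute (s * x) ((s * x) ^ 3) := (Commute.refl _).pow_right 3
    have h3 : Commute s ((s * x) ^ 3) := by
      have := h2.mul_left h1.inv_left
      rwa [mul_inv_cancel_right] at this
    have h5 : (s * x) ^ 3 = 1 :=
      hG.three_cent hs2 h4 (by rw [← pow_mul, mul_comm, pow_mul, h, one_pow]) h3
    have h6 : s * s1 * s2 = 1 := by
      calc s * s1 * s2 = (s * x) ^ 3 * (x ^ 3)⁻¹ := by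
            rw [hs2', hs1]; simp [pow_succ, mul_assoc]
        _ = 1 := by rw [h5, hx, inv_one, mul_one]
    have s22 : s2 ^ 2 = 1 := by
      have := conj_pow_one (g := x⁻¹ * x⁻¹) hs2
      rw [hs2', hs1]
      rwa [show (x⁻¹ * x⁻¹)⁻¹ * s * (x⁻¹ * x⁻¹) = x * (x * s * x⁻¹) * x⁻¹ by simp [mul_assoc]] at this
    have s12 : s1 ^ 2 = 1 := by
      have := conj_pow_one (g := x⁻¹) hs2
      rwa [inv_inv, ← hs1] at this
    have e2 : s2 = s * s1 := by
      rw [mul_eq_one_iff_eq_inv, inv_self s22] at h6; exact h6.symm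
    have e2' : s2 = s1 * s := by
      rw [mul_eq_one_iff_eq_inv', mul_inv_rev, inv_self s12, inv_self hs2] at h6; exact h6
    have as2 : SemiconjBy a s2 s2 := by
      have := as.mul_right as1
      rwa [← e2, ← e2'] at this
    have xi : SemiconjBy x⁻¹ s s2 := xs2.inv_symm_left
    have xi1 : SemiconjBy x⁻¹ s1 s := xs.inv_symm_left
    have xi2 : SemiconjBy x⁻¹ s2 s1 := xs1.inv_symm_left
    have c8 : (a * (x⁻¹ * a * x)) ^ 8 = 1 := hG.notJ ha haJ (conj_pow_one ha)
    have cs : SemiconjBy (a * (x⁻¹ * a * x)) s s2 := as2.mul_left ((xi.mul_left as1).mul_left xs)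
    have cs2 : SemiconjBy (a * (x⁻¹ * a * x)) s2 s1 := as.mul_left ((xi1.mul_left as).mul_left xs2)
    have cs1 : SemiconjBy (a * (x⁻¹ * a * x)) s1 s := as1.mul_left ((xi2.mul_left as2).mul_left xs1)
    obtain ⟨c, hc⟩ : ∃ c, c = a * (x⁻¹ * a * x) := ⟨_, rfl⟩
    rw [← hc] at c8 cs cs1 cs2
    have c3 : Commute (c ^ 3) s := by
      have := (cs1.mul_left cs2).mul_left cs
      rwa [show c * c * c = c ^ 3 by rw [pow_succ, sq]] at this
    have c9 := c3.pow_left 3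
    rw [← pow_mul, show 3 * 3 = 8 + 1 from rfl, pow_succ, c8, one_mul] at c9
    have e : s = s2 := mul_right_cancel (c9.eq.symm.trans cs.eq)
    rw [← e] at xs2
    exact hnos (Commute.symm xs2)

theorem claimE {a x : G} (ha : a ^ 2 = 1) (ha1 : a ≠ 1) (haJ : ¬ InJ a) (hx : x ^ 3 = 1)
    (hx1 : x ≠ 1) : (a * x) ^ 3 = 1 := by
  rcases hG.prod a x (Or.inl (four_of_two ha)) (Or.inr hx) with h | h
  · exact (hG.E8 ha ha1 haJ hx hx1 h).elim
  · by_contra hne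
    refine hG.E8 (x := (a * x) ^ 3) ha ha1 haJ (by rw [← pow_mul]; exact h) hne ?_
    have e : a * (a * x) ^ 3 = x * (a * (x⁻¹⁻¹ * a * x⁻¹)) * x⁻¹ := by
      calc a * (a * x) ^ 3 = a ^ 2 * x * a * x * a * x := by simp [pow_succ, mul_assoc]
        _ = x * (a * (x * a * x⁻¹)) * x⁻¹ * x ^ 3 := by rw [ha]; simp [pow_succ, mul_assoc]
        _ = _ := by rw [hx]; simp
    rw [e]
    have := conj_pow_one (g := x⁻¹) (hG.notJ ha haJ (conj_pow_one (g := x⁻¹) ha))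
    rw [inv_inv] at this ⊢
    exact this

theorem exists_good {a b : G} (ha : a ^ 2 = 1) (hb : b ^ 2 = 1) (ha1 : a ≠ 1) (hb1 : b ≠ 1)
    (hab : a ≠ b) (hc : Commute a b) :
    ∃ e : G, e ^ 2 = 1 ∧ e ≠ 1 ∧ ∀ x : G, x ^ 3 = 1 → x ≠ 1 → (e * x) ^ 3 = 1 := by
  have h2 : (a * b) ^ 2 = 1 := by rw [hc.mul_pow, ha, hb, one_mul]
  have hab1 : a * b ≠ 1 := by
    intro h
    rw [mul_eq_one_iff_eq_inv, inv_self hb] at h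
    exact hab h
  have fin : ∀ e : G, e ^ 2 = 1 → e ≠ 1 → ¬ InJ e → ∃ e : G, e ^ 2 = 1 ∧ e ≠ 1 ∧
      ∀ x : G, x ^ 3 = 1 → x ≠ 1 → (e * x) ^ 3 = 1 := by
    intro e he he1 heJ
    exact ⟨e, he, he1, fun x hx hx1 => hG.claimE he he1 heJ hx hx1⟩
  by_cases haJ : InJ a
  · obtain ⟨y, hy, hy1, hay⟩ := haJ
    rcases hG.lemC ha ha1 hb hy hy1 h2 hay with ⟨q, _⟩ | ⟨q, _⟩
    · exact fin b hb hb1 (fun h => hG.lem2 hb hb1 hy hy1 q h)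
    · exact fin (a * b) h2 hab1 (fun h => hG.lem2 h2 hab1 hy hy1 q h)
  · exact fin a ha ha1 haJ

end caseB
end Hyp


/-- A commutator. -/
def br {G : Type*} [Group G] (n m : G) : G := n * m * n⁻¹ * m⁻¹

section
variable {G : Type*} [Group G]

theorem br_conj (g n m : G) : g * br n m * g⁻¹ = br (g * n * g⁻¹) (g * m * g⁻¹) := by
  simp [br, mul_assoc]

theorem br_inv (n m : G) : (br n m)⁻¹ = br m n := by
  simp [br, mul_assoc]

theorem br_inv_inv {p q : G} (h1 : Commute (br p q) p) (h2 : Commute (br p q) q) :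
    br p⁻¹ q⁻¹ = br p q := by
  have e : br p⁻¹ q⁻¹ = (q * p)⁻¹ * br p q * (q * p) := by simp [br, mul_assoc]
  rw [e, mul_assoc, (h2.mul_right h1).eq]
  group

variable {N : Subgroup G} (hNn : ∀ n ∈ N, ∀ g : G, g * n * g⁻¹ ∈ N)
  (hN : ∀ n ∈ N, ∀ x : G, x ^ 3 = 1 → x ≠ 1 → (n * x) ^ 3 = 1 ∧ n * x ≠ 1)
  (h2 : ∀ n ∈ N, ∃ k : ℕ, n ^ 2 ^ k = 1)

theorem inv_eq_sq {x : G} (hx : x ^ 3 = 1) : x⁻¹ = x * x := by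
  rw [← sq]
  exact inv_eq_of_mul_eq_one_left (by rw [← pow_succ, hx])

theorem inv_three {x : G} (hx : x ^ 3 = 1) : x⁻¹ ^ 3 = 1 := by rw [inv_pow, hx, inv_one]

include hN in
theorem NL1 {n x : G} (hn : n ∈ N) (hx : x ^ 3 = 1) (hx1 : x ≠ 1) :
    n * (x * n * x⁻¹) * (x⁻¹ * n * x) = 1 := by
  have h := (hN n hn x hx hx1).1
  calc n * (x * n * x⁻¹) * (x⁻¹ * n * x) = n * x * n * (x⁻¹ * x⁻¹) * n * x := by group
    _ = n * x * n * x * n * x := by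
      have : x⁻¹ * x⁻¹ = x := by
        have := inv_eq_sq (inv_three hx)
        rw [← this, inv_inv]
      rw [this]
    _ = 1 := by rw [← h]; simp [pow_succ, mul_assoc]

include hN in
theorem NL2 {n x : G} (hn : n ∈ N) (hx : x ^ 3 = 1) (hx1 : x ≠ 1) : Commute n (x * n * x⁻¹) := by
  have h1 := NL1 hN hn hx hx1
  have h3 := NL1 hN (inv_mem hn) hx hx1
  have e1 : n * (x * n * x⁻¹) = (x⁻¹ * n * x)⁻¹ := mul_eq_one_iff_eq_inv.1 h1
  have e2 : n⁻¹ * (x * n⁻¹ * x⁻¹) = (x⁻¹ * n⁻¹ * x)⁻¹ := mul_eq_one_iff_eq_inv.1 h3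
  have e3 : (x * n * x⁻¹) * n = (x⁻¹ * n * x)⁻¹ := by
    have := congrArg (·⁻¹) e2
    simp only [mul_inv_rev, inv_inv, mul_assoc] at this ⊢
    rw [this]
  exact e1.trans e3.symm

include hN in
theorem NL3 {n m x : G} (hn : n ∈ N) (hm : m ∈ N) (hx : x ^ 3 = 1) (hx1 : x ≠ 1) :
    Commute n (m * (x * n * x⁻¹) * m⁻¹) := by
  obtain ⟨h1, h3⟩ := hN m hm x hx hx1
  have := NL2 hN hn h1 h3
  rwa [show m * x * n * (m * x)⁻¹ = m * (x * n * x⁻¹) * m⁻¹ by group] at this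

include hN in
theorem NL4 {n m x : G} (hn : n ∈ N) (hm : m ∈ N) (hx : x ^ 3 = 1) (hx1 : x ≠ 1) :
    Commute n (m * (x⁻¹ * n * x) * m⁻¹) := by
  have := NL3 hN hn hm (inv_three hx) (inv_ne_one.2 hx1)
  rwa [inv_inv] at this

include hN in
theorem NL5 {n m x : G} (hn : n ∈ N) (hm : m ∈ N) (hx : x ^ 3 = 1) (hx1 : x ≠ 1) :
    Commute n (m * n * m⁻¹) := by
  have h1 := NL1 hN hn hx hx1
  rw [mul_assoc] at h1
  have e := mul_eq_one_iff_eq_inv.1 h1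
  have e2 : m * n * m⁻¹ = ((m * (x * n * x⁻¹) * m⁻¹) * (m * (x⁻¹ * n * x) * m⁻¹))⁻¹ := by
    nth_rewrite 1 [e]
    group
  rw [e2]
  exact ((NL3 hN hn hm hx hx1).mul_right (NL4 hN hn hm hx hx1)).inv_right

include hN in
theorem NL6 {n m x : G} (hn : n ∈ N) (hm : m ∈ N) (hx : x ^ 3 = 1) (hx1 : x ≠ 1) :
    Commute (br n m) n ∧ Commute (br n m) m := by
  constructor
  · have : br n m = n * (m * n * m⁻¹)⁻¹ := by simp [br, mul_assoc]
    rw [this]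
    exact ((Commute.refl n).mul_right (NL5 hN hn hm hx hx1).inv_right).symm
  · have : br n m = (n * m * n⁻¹) * m⁻¹ := by simp [br, mul_assoc]
    rw [this]
    exact ((NL5 hN hm hn hx hx1).mul_right (Commute.refl m).inv_right).symm

include hN hNn in
theorem NL7 {n m x : G} (hn : n ∈ N) (hm : m ∈ N) (hx : x ^ 3 = 1) (hx1 : x ≠ 1) :
    br n (x * m * x⁻¹) = x⁻¹ * br n m * x := by
  have hn1 := NL1 hN hn hx hx1
  have hm1 := NL1 hN hm hx hx1
  have hmn := NL1 hN (mul_mem hm hn) hx hx1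
  have hm3 := NL3 hN hm hn hx hx1
  have hm2 := NL2 hN hm hx hx1
  have hmem : ∀ z ∈ N, x⁻¹ * z * x ∈ N := by
    intro z hz
    have := hNn z hz x⁻¹
    rwa [inv_inv] at this
  have h6 := NL6 hN (hmem n hn) (hmem m hm) hx hx1
  have e0 : x⁻¹ * br n m * x = br (x⁻¹ * n * x) (x⁻¹ * m * x) := by
    have := br_conj x⁻¹ n m
    rwa [inv_inv] at this
  obtain ⟨n1, en1⟩ : ∃ z, z = x * n * x⁻¹ := ⟨_, rfl⟩
  obtain ⟨m1, em1⟩ : ∃ z, z = x * m * x⁻¹ := ⟨_, rfl⟩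
  obtain ⟨n2, en2⟩ : ∃ z, z = x⁻¹ * n * x := ⟨_, rfl⟩
  obtain ⟨m2, em2⟩ : ∃ z, z = x⁻¹ * m * x := ⟨_, rfl⟩
  rw [show x * (m * n) * x⁻¹ = (x * m * x⁻¹) * (x * n * x⁻¹) by group,
    show x⁻¹ * (m * n) * x = (x⁻¹ * m * x) * (x⁻¹ * n * x) by group] at hmn
  rw [e0, ← br_inv_inv h6.1 h6.2]
  rw [← em1] at hm1 hm2 hm3 hmn ⊢
  rw [← en1] at hn1 hmn
  rw [← em2] at hm1 hmn ⊢
  rw [← en2] at hn1 hmn ⊢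
  have a1 : n2⁻¹ = n * n1 := (mul_eq_one_iff_eq_inv.1 hn1).symm
  have b1 : m2⁻¹ = m * m1 := (mul_eq_one_iff_eq_inv.1 hm1).symm
  have r : n * n1 * (m * m1) = m * n * (m1 * n1) := by
    rw [← a1, ← b1, ← mul_inv_rev]
    exact (mul_eq_one_iff_eq_inv.1 hmn).symm
  have hc : Commute m (br n m1) := by
    have : br n m1 = (n * m1 * n⁻¹) * m1⁻¹ := by simp [br, mul_assoc]
    rw [this]
    exact hm3.mul_right hm2.inv_right
  have e3 : br n2⁻¹ m2⁻¹ = m * br n m1 * m⁻¹ := by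
    rw [a1, b1]
    have : br (n * n1) (m * m1) = (n * n1 * (m * m1)) * (n * n1)⁻¹ * (m * m1)⁻¹ := rfl
    rw [this, r]
    simp [br, mul_assoc]
  rw [e3, hc.eq]; group

include hN hNn in
theorem NL8 {n m k x : G} (hn : n ∈ N) (hm : m ∈ N) (hk : k ∈ N) (hx : x ^ 3 = 1) (hx1 : x ≠ 1) :
    br n (k * m * k⁻¹) = (k * (x * k * x⁻¹)) * br n m * (k * (x * k * x⁻¹))⁻¹ := by
  have hm0 : x⁻¹ * m * x ∈ N := by
    have := hNn m hm x⁻¹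
    rwa [inv_inv] at this
  obtain ⟨h1, h3⟩ := hN k hk x hx hx1
  have e1 := NL7 hNn hN hn hm0 hx hx1
  have e2 := NL7 hNn hN hn hm0 h1 h3
  rw [show x * (x⁻¹ * m * x) * x⁻¹ = m by group] at e1
  rw [show k * x * (x⁻¹ * m * x) * (k * x)⁻¹ = k * m * k⁻¹ by group] at e2
  rw [e2, e1]
  have e3 : (k * x)⁻¹ = k * (x * k * x⁻¹) * x⁻¹ := by
    rw [inv_eq_sq h1]
    calc k * x * (k * x) = k * x * k * x := by group
      _ = k * x * k * (x⁻¹ * x⁻¹) := by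
        have := inv_eq_sq (inv_three hx)
        rw [← this, inv_inv]
      _ = _ := by group
  have e4 : k * x = (k * (x * k * x⁻¹) * x⁻¹)⁻¹ := by rw [← e3, inv_inv]
  calc (k * x)⁻¹ * br n (x⁻¹ * m * x) * (k * x)
      = (k * (x * k * x⁻¹) * x⁻¹) * br n (x⁻¹ * m * x) * (k * (x * k * x⁻¹) * x⁻¹)⁻¹ := by
        rw [← e4, e3]
    _ = _ := by simp only [mul_inv_rev, inv_inv, mul_assoc]

include hN hNn in
theorem NL8' {n m k x : G} (hn : n ∈ N) (hm : m ∈ N) (hk : k ∈ N) (hx : x ^ 3 = 1) (hx1 : x ≠ 1) :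
    br (k * n * k⁻¹) m = br n (k * m * k⁻¹) := by
  rw [NL8 hNn hN hn hm hk hx hx1, ← br_inv, NL8 hNn hN hm hn hk hx hx1, ← br_inv n m]
  simp [mul_assoc]

include hN hNn in
theorem NL9 {n m k x : G} (hn : n ∈ N) (hm : m ∈ N) (hk : k ∈ N) (hx : x ^ 3 = 1) (hx1 : x ≠ 1) :
    Commute (br n m) (k * (x * k * x⁻¹) ^ 2) := by
  have hkm := hNn m hm k
  have e1 : k * br n m * k⁻¹ = br n (k * (k * m * k⁻¹) * k⁻¹) := by
    rw [br_conj, NL8' hNn hN hn hkm hk hx hx1]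
  rw [NL8 hNn hN hn hkm hk hx hx1, NL8 hNn hN hn hm hk hx hx1] at e1
  have hc := NL2 hN hk hx hx1
  obtain ⟨l, hl⟩ : ∃ l, l = x * k * x⁻¹ := ⟨_, rfl⟩
  rw [← hl] at e1 hc ⊢
  obtain ⟨c, hcc⟩ : ∃ c, c = br n m := ⟨_, rfl⟩
  rw [← hcc] at e1 ⊢
  have e2 : k * l ^ 2 = k⁻¹ * (k * l) * (k * l) := by
    calc k * l ^ 2 = l * k * l := by rw [← hc.eq, sq, mul_assoc]
      _ = _ := by group
  show c * (k * l ^ 2) = k * l ^ 2 * c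
  rw [e2]
  calc c * (k⁻¹ * (k * l) * (k * l)) = k⁻¹ * (k * c * k⁻¹) * (k * l) * (k * l) := by group
    _ = _ := by rw [e1]; group

include hN hNn h2 in
theorem NL10 {n m k x : G} (hn : n ∈ N) (hm : m ∈ N) (hk : k ∈ N) (hx : x ^ 3 = 1) (hx1 : x ≠ 1) :
    Commute (br n m) k := by
  have h1 := NL9 hNn hN hn hm hk hx hx1
  have h3 := NL9 hNn hN hn hm (hNn k hk x) hx hx1
  have hc := NL2 hN hk hx hx1
  have hr := NL1 hN hk hx hx1
  have ex : x * (x * k * x⁻¹) * x⁻¹ = x⁻¹ * k * x := by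
    calc x * (x * k * x⁻¹) * x⁻¹ = (x * x) * k * (x⁻¹ * x⁻¹) := by group
      _ = x⁻¹ * k * x := by
        have := inv_eq_sq (inv_three hx)
        rw [← inv_eq_sq hx, ← this, inv_inv]
  rw [ex] at h3
  obtain ⟨l, hl⟩ : ∃ l, l = x * k * x⁻¹ := ⟨_, rfl⟩
  rw [← hl] at h1 h3 hc hr
  have er : x⁻¹ * k * x = (k * l)⁻¹ := mul_eq_one_iff_eq_inv'.1 hr
  rw [er] at h3
  obtain ⟨c, hcc⟩ : ∃ c, c = br n m := ⟨_, rfl⟩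
  rw [← hcc] at h1 h3 ⊢
  have e3 : k ^ 3 = (l * (k * l)⁻¹ ^ 2)⁻¹ * (l * (k * l)⁻¹ ^ 2)⁻¹ * (k * l ^ 2)⁻¹ := by
    have a : (l * (k * l)⁻¹ ^ 2)⁻¹ = k ^ 2 * l := by
      rw [mul_inv_rev, inv_pow, inv_inv, hc.mul_pow, sq l]; group
    rw [a, eq_mul_inv_iff_mul_eq, ← sq, (hc.pow_left 2).mul_pow, ← mul_assoc, ← pow_succ, ← pow_mul]
  have h4 : Commute c (k ^ 3) := by
    rw [e3]
    exact (h3.inv_right.mul_right h3.inv_right).mul_right h1.inv_right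
  obtain ⟨j, hj⟩ := h2 k hk
  have hj4 : k ^ 4 ^ j = 1 := by
    rw [show (4 : ℕ) = 2 * 2 from rfl, mul_pow, pow_mul, hj, one_pow]
  obtain ⟨t, ht⟩ : ∃ t, 4 ^ j = 3 * t + 1 := by
    have : 4 ^ j % 3 = 1 := by simp [Nat.pow_mod]
    exact ⟨4 ^ j / 3, by omega⟩
  rw [ht, pow_add, pow_mul, pow_one] at hj4
  have e5 : k = ((k ^ 3) ^ t)⁻¹ := mul_eq_one_iff_eq_inv'.1 hj4
  rw [e5]
  exact (h4.pow_right t).inv_right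

end


section RingPart
variable {R : Type*} [Ring R]

/-- the trace-like element -/
def TT (X Y : R) : R := X*Y + Y*X + X + Y + 1

theorem ch_self (h2 : (1:R)+1=0) (a : R) : a + a = 0 := by
  have := congrArg (a * ·) h2
  simpa [mul_add] using this

theorem ch_cancel (h2 : (1:R)+1=0) (a b : R) : a + (a + b) = b := by
  rw [← add_assoc, ch_self h2, zero_add]

theorem ch_eq (h2 : (1:R)+1=0) {a b : R} (h : a + b = 0) : a = b := by
  have := ch_cancel h2 b a
  rw [add_comm b a, h, add_zero] at this
  exact this.symm

theorem sq_of_quad (h2 : (1:R)+1=0) {X : R} (h : X*X+X+1=0) : X*X = X+1 := by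
  apply ch_eq h2
  rw [← add_assoc]; exact h

theorem TT_inv (h2 : (1:R)+1=0) (X Y : R) : TT X (Y+1) = TT X Y + 1 := by
  unfold TT
  simp only [mul_add, add_mul, mul_one, one_mul, mul_assoc, add_assoc]
  simp only [add_assoc, add_comm, add_left_comm, ch_self h2, ch_cancel h2, add_zero, zero_add]

theorem TT_eq (h2 : (1:R)+1=0) {X Y : R} :
    TT X Y = X*Y + (Y+1)*(X+1) := by
  unfold TT
  simp only [mul_add, add_mul, mul_one, one_mul, mul_assoc, add_assoc]

theorem PQ (h2 : (1:R)+1=0) {X Y : R} (hX : X*X = X+1) (hY : Y*Y=Y+1) :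
    (X*Y)*((Y+1)*(X+1)) = 1 := by
  have h1 : Y*(Y+1) = 1 := by
    rw [mul_add, hY, mul_one, add_comm Y 1, add_assoc, ch_self h2, add_zero]
  have h3 : X*(X+1) = 1 := by
    rw [mul_add, hX, mul_one, add_comm X 1, add_assoc, ch_self h2, add_zero]
  rw [mul_assoc, ← mul_assoc Y, h1, one_mul, h3]

theorem QP (h2 : (1:R)+1=0) {X Y : R} (hX : X*X = X+1) (hY : Y*Y=Y+1) :
    ((Y+1)*(X+1))*(X*Y) = 1 := by
  have h1 : (Y+1)*Y = 1 := by
    rw [add_mul, hY, one_mul, add_comm Y 1, add_assoc, ch_self h2, add_zero]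
  have h3 : (X+1)*X = 1 := by
    rw [add_mul, hX, one_mul, add_comm X 1, add_assoc, ch_self h2, add_zero]
  rw [mul_assoc, ← mul_assoc _ X, h3, one_mul, h1]

theorem comm_sq (h2 : (1:R)+1=0) {P Q : R} (h : P*Q = Q*P) : (P+Q)^2 = P^2+Q^2 := by
  rw [pow_two, pow_two, pow_two, mul_add, add_mul, add_mul, h, add_assoc, ch_cancel h2]

theorem comm_eight (h2 : (1:R)+1=0) {P Q : R} (h : P*Q = Q*P) : (P+Q)^8 = P^8+Q^8 := by
  have c : Commute P Q := h
  have e1 := comm_sq h2 h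
  have e2 := comm_sq h2 (c.pow_pow 2 2).eq
  have e3 := comm_sq h2 (c.pow_pow 4 4).eq
  simp only [← pow_mul] at e2 e3
  norm_num at e2 e3
  rw [← e3, ← e2, ← e1, ← pow_mul, ← pow_mul]

theorem T_three (h2 : (1:R)+1=0) {P Q : R} (hPQ : P*Q=1) (hQP : Q*P = 1) (h : P*P+P+1=0) :
    P + Q = 1 := by
  have h1 : P*P = P+1 := sq_of_quad h2 h
  have h3 : P = 1 + Q := by
    calc P = P*P*Q := by rw [mul_assoc, hPQ, mul_one]
      _ = 1 + Q := by rw [h1, add_mul, hPQ, one_mul]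
  calc P + Q = 1 + Q + Q := by rw [← h3]
    _ = 1 := by rw [add_assoc, ch_self h2, add_zero]

theorem T_nine (h2 : (1:R)+1=0) {P Q : R} (hPQ : P*Q=1) (hQP : Q*P = 1)
    (h : (P^3)*(P^3)+P^3+1=0) : (P+Q)^3 = (P+Q)+1 := by
  have c : Commute P Q := by rw [Commute, SemiconjBy, hPQ, hQP]
  have h1 : P^3+Q^3=1 := by
    apply T_three h2 _ _ h
    · rw [← c.mul_pow, hPQ, one_pow]
    · rw [← c.symm.mul_pow, hQP, one_pow]
  have : (P+Q)^3 = P^3+Q^3 + (P+Q) := by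
    have e : (P+Q)^3 = (P+Q)*(P+Q)^2 := by rw [pow_succ' _ 2]
    rw [e, comm_sq h2 c.eq, add_mul, mul_add, mul_add, ← pow_succ', ← pow_succ', pow_two, pow_two, ← mul_assoc,
      ← mul_assoc, hPQ, hQP, one_mul, one_mul]
    abel
  rw [this, h1, add_comm]

theorem T_eight (h2 : (1:R)+1=0) {P Q : R} (hPQ : P*Q=1) (hQP : Q*P = 1)
    (h : P^8=1) : (P+Q)^8 = 0 := by
  have c : Commute P Q := by rw [Commute, SemiconjBy, hPQ, hQP]
  have h1 : Q^8 = 1 := by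
    have : P^8*Q^8=1 := by rw [← c.mul_pow, hPQ, one_pow]
    rwa [h, one_mul] at this
  rw [comm_eight h2 c.eq, h, h1, h2]

theorem T_cases (h2 : (1:R)+1=0) (h01 : (1:R) ≠ 0) {T : R}
    (hA : T = 1 ∨ T^3 = T+1 ∨ T^8=0) (hB : T+1 = 1 ∨ (T+1)^3 = (T+1)+1 ∨ (T+1)^8=0) :
    T = 1 ∨ T = 0 := by
  have c1 : (T+1)^8 = T^8+1 := by
    rw [comm_eight h2 (by simp), one_pow]
  have c2 : (T+1)^2 = T^2+1 := by
    rw [comm_sq h2 (by simp), one_pow]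
  have c3 : (T+1)+1 = T := by rw [add_assoc, h2, add_zero]
  have c4 : (T+1)^3 = T^3+T^2+(T+1) := by
    rw [pow_succ, c2, mul_add, add_mul, ← pow_succ]; simp; abel
  have d1 : T^8=0 → (T+1)^3=T → False := by
    intro h h'
    rw [c4] at h'
    have e : T^3+T^2 = 1 := by
      apply ch_eq h2
      have : T^3+T^2+(T+1) - T = 0 := by rw [h', sub_self]
      rw [← this]; abel
    apply h01
    have e1 : T^2*(T+1) = 1 := by rw [mul_add, ← pow_succ, mul_one]; exact e
    have e2 : (T^2*(T+1))^4 = T^8*(T+1)^4 := by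
      have : Commute (T^2) (T+1) := ((Commute.refl T).add_right (Commute.one_right T)).pow_left 2
      rw [this.mul_pow, ← pow_mul]
    rw [e1, h, zero_mul, one_pow] at e2
    exact e2
  rcases hA with h | h | h
  · exact Or.inl h
  · rcases hB with h' | h' | h'
    · right; simpa using h'
    · exfalso
      rw [c3, c4, h] at h'
      have e : T^2 = T := by
        calc T^2 = (T+1) + ((T+1) + T^2) := (ch_cancel h2 _ _).symm
          _ = T + 1 + T^2 + (T+1) := by abel
          _ = T := h'
      have : T^3 = T := by rw [pow_succ, e, ← pow_two, e]
      rw [this] at h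
      apply h01
      simpa using h
    · exfalso
      rw [c1] at h'
      have e : T^8 = 1 := ch_eq h2 h'
      have c : Commute T 1 := Commute.one_right T
      -- T^3 + T = 1
      have e1 : T*(T+1)^2 = 1 := by
        rw [c2, mul_add, ← pow_succ', h, mul_one, add_comm T 1, add_assoc, ch_self h2, add_zero]
      have e2 : (T*(T+1)^2)^4 = T^4*(T+1)^8 := by
        have : Commute T ((T+1)^2) := ((Commute.refl T).add_right (Commute.one_right T)).pow_right 2
        rw [this.mul_pow, ← pow_mul]
      rw [e1, c1, h', mul_zero, one_pow] at e2
      exact h01 e2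
  · rcases hB with h' | h' | h'
    · right; simpa using h'
    · exact (d1 h (by rw [h', c3])).elim
    · exfalso
      rw [c1, h, zero_add] at h'
      exact h01 h'

theorem T_trans (h2 : (1:R)+1=0) (h01 : (1:R) ≠ 0) {X Y Z : R} (hX : X*X = X+1) (hY : Y*Y=Y+1)
    (hxy : TT X Y = 1) (hxz : TT X Z = 1) (hyz : TT Y Z = 0)
    (he : TT (X*Y) Z = 1 ∨ TT (X*Y) Z = 0) : False := by
  have r1 : Y*X = X*Y + (X + Y) := by
    have : Y*X = X*Y + X + Y + 1 + TT X Y := by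
      unfold TT
      simp only [add_assoc, add_comm, add_left_comm, ch_self h2, ch_cancel h2, add_zero, zero_add]
    rw [this, hxy]
    simp only [add_assoc, add_comm, add_left_comm, ch_self h2, ch_cancel h2, add_zero, zero_add]
  have r2 : Z*X = X*Z + (X + Z) := by
    have : Z*X = X*Z + X + Z + 1 + TT X Z := by
      unfold TT
      simp only [add_assoc, add_comm, add_left_comm, ch_self h2, ch_cancel h2, add_zero, zero_add]
    rw [this, hxz]
    simp only [add_assoc, add_comm, add_left_comm, ch_self h2, ch_cancel h2, add_zero, zero_add]
  have r3 : Z*Y = Y*Z + (Y + (Z + 1)) := by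
    have : Z*Y = Y*Z + Y + Z + 1 + TT Y Z := by
      unfold TT
      simp only [add_assoc, add_comm, add_left_comm, ch_self h2, ch_cancel h2, add_zero, zero_add]
    rw [this, hyz]
    simp only [add_assoc, add_comm, add_left_comm, ch_self h2, ch_cancel h2, add_zero, zero_add]
  have e1 : TT (X*Y) Z = (X+Y)*Z + (X*Y+X+Y) := by
    have : Z*(X*Y) = X*(Y*Z + (Y + (Z + 1))) + X*Y + (Y*Z + (Y + (Z + 1))) := by
      rw [← mul_assoc, r2, add_mul, add_mul, mul_assoc, r3, add_assoc]
    unfold TT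
    rw [this]
    simp only [mul_add, add_mul, mul_one, one_mul, mul_assoc, add_assoc]
    simp only [add_assoc, add_comm, add_left_comm, ch_self h2, ch_cancel h2, add_zero, zero_add]
  have s0 : (X+Y)*(X+Y) = 0 := by
    simp only [mul_add, add_mul, hX, hY, r1]
    simp only [add_assoc, add_comm, add_left_comm, ch_self h2, ch_cancel h2, add_zero, zero_add]
  have s1 : (X+Y)*(X*Y) = X*Y+X+1 := by
    have a1 : Y*(X*Y) = X*(Y+1) + (X*Y + (Y+1)) := by
      rw [← mul_assoc, r1, add_mul, add_mul, mul_assoc, hY]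
    rw [add_mul, ← mul_assoc, hX, a1]
    simp only [mul_add, add_mul, mul_one, one_mul, mul_assoc, add_assoc]
    simp only [add_assoc, add_comm, add_left_comm, ch_self h2, ch_cancel h2, add_zero, zero_add]
  have e2 : (X+Y)*TT (X*Y) Z = X*Y+X+1 := by
    rw [e1, mul_add, ← mul_assoc, s0, zero_mul, zero_add, add_assoc, mul_add, s0, add_zero, s1]
  have key : X = Y := by
    have ix : (X+1)*X = 1 := by
      rw [add_mul, hX, one_mul, add_comm X 1, add_assoc, ch_self h2, add_zero]
    have iy : Y*(Y+1) = 1 := by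
      rw [mul_add, hY, mul_one, add_comm Y 1, add_assoc, ch_self h2, add_zero]
    rcases he with h | h
    · rw [h, mul_one] at e2
      have : X*Y = Y*Y := by
        rw [hY]
        calc X*Y = (X*Y + X + 1) + (X + 1) := by
              rw [add_assoc (X*Y), add_assoc, ch_self h2, add_zero]
          _ = X + Y + (X + 1) := by rw [← e2]
          _ = Y + 1 := ?_
        simp only [add_assoc, add_comm, add_left_comm, ch_self h2, ch_cancel h2, add_zero, zero_add]
      calc X = X*Y*(Y+1) := by rw [mul_assoc, iy, mul_one]
        _ = Y := by rw [this, mul_assoc, iy, mul_one]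
    · rw [h, mul_zero] at e2
      have : X*Y = X*X := by
        rw [hX]
        apply ch_eq h2
        rw [← add_assoc, ← e2]
      calc X = (X+1)*(X*X) := by rw [← mul_assoc, ix, one_mul]
        _ = Y := by rw [← this, ← mul_assoc, ix, one_mul]
  rw [key, hyz] at hxz
  exact h01 hxz.symm

end RingPart


/-- elements of order three -/
def O3 {G : Type*} [Group G] (x : G) : Prop := x ^ 3 = 1 ∧ x ≠ 1

section Rel
variable {G : Type*} [Group G] {R : Type*} [Ring R]

theorem O3.inv {x : G} (h : O3 x) : O3 x⁻¹ :=
  ⟨inv_three h.1, inv_ne_one.mpr h.2⟩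

theorem O3.conj {x : G} (h : O3 x) (g : G) : O3 (g * x * g⁻¹) := by
  constructor
  · rw [conj_pow, h.1]; simp
  · intro e
    apply h.2
    have : x = g⁻¹ * (g * x * g⁻¹) * g := by group
    rw [this, e]; group

theorem O3.swap {x y : G} (h : O3 (x * y)) : O3 (y * x) := by
  have := h.conj y
  rwa [show y * (x * y) * y⁻¹ = y * x by group] at this

theorem O3.self {x : G} (h : O3 x) : O3 (x * x) := by
  rw [← inv_eq_sq h.1]; exact h.inv

theorem O3.inv_inv {x y : G} (h : O3 (x * y)) : O3 (x⁻¹ * y⁻¹) := by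
  have := h.swap.inv
  rwa [mul_inv_rev] at this

variable (hG : Hyp G) (h2 : (1:R)+1=0) (h01 : (1:R) ≠ 0) (φ : G →* R)
  (hφ : ∀ x : G, O3 x → φ x * φ x + φ x + 1 = 0)

include h2 hφ in
theorem phi_inv {x : G} (hx : O3 x) : φ x⁻¹ = φ x + 1 := by
  rw [inv_eq_sq hx.1, map_mul]
  exact sq_of_quad h2 (hφ x hx)

include hG h2 hφ in
theorem T_alt {x y : G} (hx : O3 x) (hy : O3 y) :
    O3 (x * y) ∧ TT (φ x) (φ y) = 1 ∨ TT (φ x) (φ y) ^ 3 = TT (φ x) (φ y) + 1 ∨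
      TT (φ x) (φ y) ^ 8 = 0 := by
  have hX := sq_of_quad h2 (hφ x hx)
  have hY := sq_of_quad h2 (hφ y hy)
  have hPQ := PQ h2 hX hY
  have hQP := QP h2 hX hY
  rw [TT_eq h2]
  by_cases h1 : x * y = 1
  · right; right
    apply T_eight h2 hPQ hQP
    rw [← map_mul, h1, map_one, one_pow]
  rcases hG.prod x y (Or.inr hx.1) (Or.inr hy.1) with h | h
  · right; right
    apply T_eight h2 hPQ hQP
    rw [← map_mul, ← map_pow, h, map_one]
  · by_cases h3 : (x * y) ^ 3 = 1
    · left
      refine ⟨⟨h3, h1⟩, ?_⟩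
      apply T_three h2 hPQ hQP
      rw [← map_mul]
      exact hφ _ ⟨h3, h1⟩
    · right; left
      apply T_nine h2 hPQ hQP
      rw [← map_mul, ← map_pow]
      exact hφ _ ⟨by rw [← pow_mul]; exact h, h3⟩

include hG h2 h01 hφ in
theorem T_01 {x y : G} (hx : O3 x) (hy : O3 y) :
    TT (φ x) (φ y) = 1 ∨ TT (φ x) (φ y) = 0 := by
  have hA := T_alt hG h2 φ hφ hx hy
  have hB := T_alt hG h2 φ hφ hx hy.inv
  rw [phi_inv h2 φ hφ hy, TT_inv h2] at hB
  apply T_cases h2 h01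
  · exact hA.imp_left And.right
  · exact hB.imp_left And.right

include hG h2 h01 hφ in
theorem T_iff {x y : G} (hx : O3 x) (hy : O3 y) :
    O3 (x * y) ↔ TT (φ x) (φ y) = 1 := by
  constructor
  · intro h
    have hX := sq_of_quad h2 (hφ x hx)
    have hY := sq_of_quad h2 (hφ y hy)
    rw [TT_eq h2]
    apply T_three h2 (PQ h2 hX hY) (QP h2 hX hY)
    rw [← map_mul]
    exact hφ _ h
  · intro h
    rcases T_alt hG h2 φ hφ hx hy with h' | h' | h'
    · exact h'.1
    · rw [h, one_pow] at h'
      exact (h01 (by simpa using h')).elim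
    · rw [h, one_pow] at h'
      exact (h01 h').elim

include hG h2 h01 hφ in
theorem sim_or {x y : G} (hx : O3 x) (hy : O3 y) : O3 (x * y) ∨ O3 (x * y⁻¹) := by
  rcases T_01 hG h2 h01 φ hφ hx hy with h | h
  · left; exact (T_iff hG h2 h01 φ hφ hx hy).2 h
  · right
    apply (T_iff hG h2 h01 φ hφ hx hy.inv).2
    rw [phi_inv h2 φ hφ hy, TT_inv h2, h, zero_add]

include hG h2 h01 hφ in
theorem sim_trans {x y z : G} (hx : O3 x) (hy : O3 y) (hz : O3 z) (hxy : O3 (x * y))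
    (hxz : O3 (x * z)) : O3 (y * z) := by
  rcases T_01 hG h2 h01 φ hφ hy hz with h | h
  · exact (T_iff hG h2 h01 φ hφ hy hz).2 h
  · exfalso
    have he := T_01 hG h2 h01 φ hφ hxy hz
    rw [map_mul] at he
    exact T_trans h2 h01 (sq_of_quad h2 (hφ x hx)) (sq_of_quad h2 (hφ y hy))
      ((T_iff hG h2 h01 φ hφ hx hy).1 hxy) ((T_iff hG h2 h01 φ hφ hx hz).1 hxz) h he

include hG h2 h01 hφ in
theorem sim_N1 {x y z : G} (hx : O3 x) (hy : O3 y) (hz : O3 z) (hxy : O3 (x * y))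
    (hxz : O3 (x * z)) : O3 (x * y⁻¹ * z) := by
  have hyz := sim_trans hG h2 h01 φ hφ hx hy hz hxy hxz
  -- (xy)⁻¹ ~ y
  have a1 : O3 (y * (x * y)⁻¹) := by
    have : y * (x * y)⁻¹ = x⁻¹ := by group
    rw [this]; exact hx.inv
  have a2 : O3 (y * (y * z)⁻¹) := by
    have : y * (y * z)⁻¹ = y * z⁻¹ * y⁻¹ := by group
    rw [this]; exact hz.inv.conj y
  have a3 := sim_trans hG h2 h01 φ hφ hy hxy.inv hyz.inv a1 a2
  have a4 := a3.inv_inv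
  rw [_root_.inv_inv, _root_.inv_inv] at a4
  have : x * y⁻¹ * z = x * y * (y * z) := by
    rw [inv_eq_sq hy.1]; group
  rw [this]; exact a4

include hG h2 h01 hφ in
theorem sim_N {x y z : G} (hx : O3 x) (hy : O3 y) (hz : O3 z) (hxy : O3 (x * y)) :
    O3 (x * y⁻¹ * z) := by
  rcases sim_or hG h2 h01 φ hφ hx hz with h | h
  · exact sim_N1 hG h2 h01 φ hφ hx hy hz hxy h
  · have h' := sim_trans hG h2 h01 φ hφ hx hy hz.inv hxy h
    have := sim_N1 hG h2 h01 φ hφ hy hx hz.inv hxy.swap h'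
    have := this.inv
    have e : (y * x⁻¹ * z⁻¹)⁻¹ = z * (x * y⁻¹) := by group
    rw [e] at this
    exact this.swap
end Rel

section Fin
variable {Q : Type*} [Group Q]

theorem cube_mul {h k z : Q} (hz : h * k = z * (k * h)) (zh : Commute z h) (zk : Commute z k)
    (z3 : z ^ 3 = 1) : (h * k) ^ 3 = h ^ 3 * k ^ 3 := by
  have zh' : ∀ w, h * (z * w) = z * (h * w) := fun w => by rw [← mul_assoc, ← zh.eq, mul_assoc]
  have zk' : ∀ w, k * (z * w) = z * (k * w) := fun w => by rw [← mul_assoc, ← zk.eq, mul_assoc]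
  have e1 : h ^ 3 * k ^ 3 = h * h * (h * k) * k * k := by
    simp only [pow_succ, pow_zero, one_mul, mul_assoc]
  have hz' : ∀ w, h * (k * w) = z * (k * (h * w)) := fun w => by
    rw [← mul_assoc, hz, mul_assoc, mul_assoc]
  have z3' : ∀ w, z * (z * (z * w)) = w := fun w => by
    rw [← mul_assoc, ← mul_assoc, ← pow_two, ← pow_succ, z3, one_mul]
  have hz0 : h * k = z * (k * h) := hz
  simp only [pow_succ, pow_zero, one_mul, mul_assoc]
  simp only [hz', hz0, zh', zk', z3', zh.eq.symm, zk.eq.symm]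
end Fin


section Fin
variable {Q : Type*} [Group Q] {u : Q} (hu : u ^ 3 = 1) (hu1 : u ≠ 1)
  (tor : ∀ q : Q, (∃ k : ℕ, q ^ 2 ^ k = 1) ∨ q ^ 9 = 1)
  (h3 : ∀ q : Q, q ^ 3 = 1 → q = 1 ∨ q = u ∨ q = u⁻¹)

include h3 in
theorem Q_mem {q : Q} (h : q ^ 3 = 1) : q ∈ Subgroup.zpowers u := by
  rcases h3 q h with h | h | h
  · rw [h]; exact one_mem _
  · rw [h]; exact Subgroup.mem_zpowers u
  · rw [h]; exact inv_mem (Subgroup.mem_zpowers u)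

include hu in
theorem Q_three {z : Q} (h : z ∈ Subgroup.zpowers u) : z ^ 3 = 1 := by
  obtain ⟨n, rfl⟩ := Subgroup.mem_zpowers_iff.1 h
  have : (u ^ n) ^ 3 = (u ^ 3) ^ n := by
    rw [← zpow_natCast, ← zpow_natCast, ← zpow_mul, ← zpow_mul, mul_comm]
  rw [this, hu, one_zpow]

theorem Q_comm {z q : Q} (h : z ∈ Subgroup.zpowers u) (hq : Commute q u) : Commute z q := by
  obtain ⟨n, rfl⟩ := Subgroup.mem_zpowers_iff.1 h
  exact (hq.zpow_right n).symm

include hu hu1 tor in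
theorem Q_nine {q : Q} (hq : Commute q u) : q ^ 9 = 1 := by
  rcases tor q with ⟨k, hk⟩ | h
  · rcases tor (q * u) with ⟨m, hm⟩ | h
    · exfalso
      have e : u ^ 2 ^ (k + m) = 1 := by
        have h1 : (q * u) ^ 2 ^ (k + m) = 1 := by
          rw [add_comm, pow_add, pow_mul, hm, one_pow]
        rw [hq.mul_pow, pow_add, pow_mul, hk, one_pow, one_mul, ← pow_add] at h1
        exact h1
      apply hu1
      have hc : Nat.Coprime (2 ^ (k + m)) 3 := by
        apply Nat.Coprime.pow_left; norm_num
      have d : orderOf u ∣ Nat.gcd (2 ^ (k + m)) 3 :=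
        Nat.dvd_gcd (orderOf_dvd_of_pow_eq_one e) (orderOf_dvd_of_pow_eq_one hu)
      rw [hc] at d
      exact orderOf_eq_one_iff.1 (Nat.dvd_one.1 d)
    · rw [hq.mul_pow, show u ^ 9 = (u ^ 3) ^ 3 by rw [← pow_mul], hu, one_pow, mul_one] at h
      exact h
  · exact h

include hu hu1 tor h3 in
theorem Q_cube {q : Q} (hq : Commute q u) : q ^ 3 ∈ Subgroup.zpowers u := by
  apply Q_mem h3
  rw [← pow_mul]
  exact Q_nine hu hu1 tor hq

include hu hu1 tor h3 in
theorem Q_trip {h k : Q} (hh : Commute h u) (hk : Commute k u) :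
    h * (k * h * k⁻¹) * (k * (k * h * k⁻¹) * k⁻¹) ∈ Subgroup.zpowers u := by
  have e : h * (k * h * k⁻¹) * (k * (k * h * k⁻¹) * k⁻¹) = (h * k) ^ 3 * (k ^ 3)⁻¹ := by
    simp [pow_succ, mul_assoc]
  rw [e]
  exact mul_mem (Q_cube hu hu1 tor h3 (hh.mul_left hk)) (inv_mem (Q_cube hu hu1 tor h3 hk))

include hu hu1 tor h3 in
theorem Q_c1 {h k : Q} (hh : Commute h u) (hk : Commute k u) :
    ∃ z ∈ Subgroup.zpowers u, h * (k * h * k⁻¹) = z * ((k * h * k⁻¹) * h) := by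
  have t1 := Q_trip hu hu1 tor h3 hh hk
  have t2 := inv_mem (Q_trip hu hu1 tor h3 hh.inv_left hk)
  have hh' : Commute (k * h * k⁻¹) u := (hk.mul_left hh).mul_left hk.inv_left
  have e2 : (h⁻¹ * (k * h⁻¹ * k⁻¹) * (k * (k * h⁻¹ * k⁻¹) * k⁻¹))⁻¹
      = (k * (k * h * k⁻¹) * k⁻¹) * ((k * h * k⁻¹) * h) := by simp [mul_assoc]
  rw [e2] at t2
  generalize k * (k * h * k⁻¹) * k⁻¹ = c at *
  generalize k * h * k⁻¹ = b at *
  refine ⟨h * b * c * (c * (b * h))⁻¹, mul_mem t1 (inv_mem t2), ?_⟩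
  have cc := Q_comm t2 (hh.mul_left hh')
  have : h * b * c * (c * (b * h))⁻¹ * (b * h) = h * b := by
    have hc1 := Q_comm (mul_mem t1 (inv_mem t2)) (hh'.mul_left hh)
    have hc2 := Q_comm (inv_mem t2) (hh'.mul_left hh)
    calc h * b * c * (c * (b * h))⁻¹ * (b * h) = h * b * c * ((c * (b * h))⁻¹ * (b * h)) := by group
      _ = h * b * c * ((b * h) * (c * (b * h))⁻¹) := by rw [hc2.eq]
      _ = h * b := by group
  exact this.symm

include hu hu1 tor h3 in
theorem Q_c2 {h k : Q} (hh : Commute h u) (hk : Commute k u) :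
    ∃ z ∈ Subgroup.zpowers u, h * k = z * (k * h) := by
  obtain ⟨z, hz, e⟩ := Q_c1 hu hu1 tor h3 hh hk
  have hh' : Commute (k * h * k⁻¹) u := (hk.mul_left hh).mul_left hk.inv_left
  have h3c : (k * h * k⁻¹) ^ 3 = h ^ 3 := by
    rw [conj_pow, ← (Q_comm (Q_cube hu hu1 tor h3 hh) hk).eq]; group
  refine ⟨h * (k * h * k⁻¹)⁻¹, ?_, by group⟩
  apply Q_mem h3
  generalize k * h * k⁻¹ = b at *
  have zh := Q_comm hz hh
  have zb := Q_comm hz hh'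
  have e' : h * b⁻¹ = z⁻¹ * (b⁻¹ * h) := by
    have : b * h = z⁻¹ * (h * b) := by rw [e]; group
    have h1 : b⁻¹ * (b * h) * b⁻¹ = b⁻¹ * (z⁻¹ * (h * b)) * b⁻¹ := by rw [this]
    have h2 : b⁻¹ * (b * h) * b⁻¹ = h * b⁻¹ := by group
    rw [h2] at h1
    rw [h1, ← mul_assoc b⁻¹, ← zb.inv_inv.eq]
    group
  rw [cube_mul e' zh.inv_left zb.inv_inv (Q_three hu (inv_mem hz)), inv_pow, h3c, mul_inv_cancel]

include hu hu1 tor h3 in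
theorem Q_fib {h k : Q} (hh : Commute h u) (hk : Commute k u) (e : h ^ 3 = k ^ 3) :
    h * k⁻¹ ∈ Subgroup.zpowers u := by
  obtain ⟨z, hz, e'⟩ := Q_c2 hu hu1 tor h3 hh hk.inv_left
  apply Q_mem h3
  rw [cube_mul e' (Q_comm hz hh) (Q_comm hz hk.inv_left) (Q_three hu hz), inv_pow, e, mul_inv_cancel]

include hu hu1 tor h3 in
theorem Q_finite : Finite Q := by
  have hZ : (Subgroup.zpowers u : Set Q).Finite := by
    have : (Subgroup.zpowers u : Set Q) ⊆ {1, u, u⁻¹} := by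
      intro z hz
      simpa using h3 z (Q_three hu hz)
    exact Set.Finite.subset (by simp) this
  have hC : {q : Q | Commute q u}.Finite := by
    have h1 : ∀ b : Q, {q : Q | Commute q u ∧ q ^ 3 = b}.Finite := by
      intro b
      by_cases hne : ∃ k : Q, Commute k u ∧ k ^ 3 = b
      · obtain ⟨k, hk, hkb⟩ := hne
        apply (hZ.image (· * k)).subset
        rintro q ⟨hq, hqb⟩
        exact ⟨q * k⁻¹, Q_fib hu hu1 tor h3 hq hk (hqb.trans hkb.symm), by simp⟩
      · convert Set.finite_empty
        ext q
        simp only [Set.mem_setOf_eq, Set.mem_empty_iff_false, iff_false]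
        exact fun h => hne ⟨q, h⟩
    apply (hZ.biUnion (fun b _ => h1 b)).subset
    intro q hq
    simp only [Set.mem_iUnion]
    exact ⟨q ^ 3, Q_cube hu hu1 tor h3 hq, hq, rfl⟩
  have hD : {q : Q | q * u * q⁻¹ = u⁻¹}.Finite := by
    by_cases hne : ∃ k : Q, k * u * k⁻¹ = u⁻¹
    · obtain ⟨k, hk⟩ := hne
      apply (hC.image (k * ·)).subset
      intro q hq
      refine ⟨k⁻¹ * q, ?_, by simp⟩
      have hq : q * u * q⁻¹ = u⁻¹ := hq
      show k⁻¹ * q * u = u * (k⁻¹ * q)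
      calc k⁻¹ * q * u = k⁻¹ * (q * u * q⁻¹) * q := by group
        _ = k⁻¹ * (k * u * k⁻¹) * q := by rw [hq, hk]
        _ = _ := by group
    · convert Set.finite_empty
      ext q
      simp only [Set.mem_setOf_eq, Set.mem_empty_iff_false, iff_false]
      exact fun h => hne ⟨q, h⟩
  rw [← Set.finite_univ_iff]
  apply (hC.union hD).subset
  intro q _
  rcases h3 (q * u * q⁻¹) (by rw [conj_pow, hu]; simp) with h | h | h
  · exfalso
    apply hu1
    calc u = q⁻¹ * (q * u * q⁻¹) * q := by group
      _ = 1 := by rw [h]; group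
  · left
    exact mul_inv_eq_iff_eq_mul.1 h
  · right; exact h

end Fin


section NN
variable {G : Type*} [Group G] (hG : Hyp G)

include hG in
theorem Hyp.fin (g : G) : IsOfFinOrder g := by
  rw [isOfFinOrder_iff_pow_eq_one]
  rcases hG.tor g with ⟨k, h⟩ | h
  · exact ⟨_, by positivity, h⟩
  · exact ⟨9, by norm_num, h⟩

/-- the normal subgroup N -/
def NS (hG : Hyp G) : Subgroup G where
  carrier := {n | ∀ x : G, O3 x → O3 (n * x)}
  one_mem' := by intro x hx; simpa using hx
  mul_mem' := by
    intro a b ha hb x hx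
    rw [mul_assoc]
    exact ha _ (hb _ hx)
  inv_mem' := by
    intro a ha x hx
    have hp : ∀ m : ℕ, O3 (a ^ m * x) := by
      intro m
      induction m with
      | zero => simpa using hx
      | succ m ih => rw [pow_succ', mul_assoc]; exact ha _ ih
    obtain ⟨m, hm⟩ : ∃ m : ℕ, a⁻¹ = a ^ m := by
      have := (hG.fin a).mem_powers_iff_mem_zpowers.2 (inv_mem (Subgroup.mem_zpowers a))
      obtain ⟨m, hm⟩ := this
      exact ⟨m, hm.symm⟩
    rw [hm]; exact hp m

theorem NS_mem {n : G} : n ∈ NS hG ↔ ∀ x : G, O3 x → O3 (n * x) := Iff.rfl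

instance NS_normal : (NS hG).Normal := by
  constructor
  intro n hn g
  rw [NS_mem] at *
  intro x hx
  have h1 := hn (g⁻¹ * x * g) (by simpa using hx.conj g⁻¹)
  have h2 := h1.conj g
  rwa [show g * (n * (g⁻¹ * x * g)) * g⁻¹ = g * n * g⁻¹ * x by group] at h2

theorem NS_three {n : G} (hn : n ∈ NS hG) (h : n ^ 3 = 1) : n = 1 := by
  by_contra h1
  have := (hn n⁻¹ (O3.inv ⟨h, h1⟩)).2
  simp at this

theorem NS_nine {n : G} (hn : n ∈ NS hG) (h : n ^ 9 = 1) : n = 1 := by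
  apply NS_three hG hn
  apply NS_three hG (pow_mem hn 3)
  rw [← pow_mul]; exact h

theorem NS_two {n : G} (hn : n ∈ NS hG) : ∃ k : ℕ, n ^ 2 ^ k = 1 := by
  rcases hG.tor n with h | h
  · exact h
  · exact ⟨0, by rw [NS_nine hG hn h, one_pow]⟩

theorem NS_br {n m k x : G} (hx : O3 x) (hn : n ∈ NS hG) (hm : m ∈ NS hG) (hk : k ∈ NS hG) :
    Commute (br n m) k :=
  NL10 (N := NS hG) (fun n hn g => (NS_normal hG).conj_mem n hn g)
    (fun n hn x hx hx1 => hn x ⟨hx, hx1⟩) (fun n hn => NS_two hG hn) hn hm hk hx.1 hx.2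

theorem NS_LF {x : G} (hx : O3 x) : LF (NS hG) := by
  apply LF.ext (Subgroup.center (NS hG))
  · apply LF.of_comm
    · rintro ⟨a, ha⟩ ⟨b, hb⟩
      apply Subtype.ext
      exact (Subgroup.mem_center_iff.1 ha b).symm
    · intro a
      have := hG.fin ((a : NS hG) : G)
      exact (Submonoid.isOfFinOrder_coe (H := (Subgroup.center (NS hG)).toSubmonoid)).1 ((Submonoid.isOfFinOrder_coe (H := (NS hG).toSubmonoid)).1 this)
  · apply LF.of_comm
    · intro a b
      induction a using QuotientGroup.induction_on with | H a => ?_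
      induction b using QuotientGroup.induction_on with | H b => ?_
      rw [← QuotientGroup.mk_mul, ← QuotientGroup.mk_mul, QuotientGroup.eq, Subgroup.mem_center_iff]
      intro c
      have := NS_br hG hx (inv_mem b.2) (inv_mem a.2) c.2
      apply Subtype.ext
      have e : (((a * b)⁻¹ * (b * a) : NS hG) : G) = br (b:G)⁻¹ (a:G)⁻¹ := by
        simp [br, mul_assoc]
      show (c : G) * (((a * b)⁻¹ * (b * a) : NS hG) : G) = (((a * b)⁻¹ * (b * a) : NS hG) : G) * c
      rw [e]
      exact this.eq.symm
    · intro a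
      induction a using QuotientGroup.induction_on with | H a => ?_
      have h1 : IsOfFinOrder a := by
        exact (Submonoid.isOfFinOrder_coe (H := (NS hG).toSubmonoid)).1 (hG.fin (a : G))
      exact MonoidHom.isOfFinOrder (QuotientGroup.mk' _) h1

/-- central elements of N of exponent two -/
def WS (hG : Hyp G) : Subgroup G where
  carrier := {w | w ∈ NS hG ∧ w ^ 2 = 1 ∧ ∀ n ∈ NS hG, Commute w n}
  one_mem' := ⟨one_mem _, one_pow _, fun n _ => Commute.one_left n⟩
  mul_mem' := by
    rintro a b ⟨ha, ha2, hac⟩ ⟨hb, hb2, hbc⟩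
    exact ⟨mul_mem ha hb, by rw [(hac b hb).mul_pow, ha2, hb2, one_mul],
      fun n hn => (hac n hn).mul_left (hbc n hn)⟩
  inv_mem' := by
    rintro a ⟨ha, ha2, hac⟩
    exact ⟨inv_mem ha, by rw [inv_pow, ha2, inv_one], fun n hn => (hac n hn).inv_left⟩

theorem WS_mem {w : G} : w ∈ WS hG ↔ w ∈ NS hG ∧ w ^ 2 = 1 ∧ ∀ n ∈ NS hG, Commute w n := Iff.rfl

instance WS_normal : (WS hG).Normal := by
  constructor
  rintro w ⟨h1, h2, h3⟩ g
  refine ⟨(NS_normal hG).conj_mem _ h1 g, by rw [conj_pow, h2]; simp, ?_⟩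
  intro n hn
  have := h3 _ ((NS_normal hG).conj_mem n hn g⁻¹)
  have h4 : Commute (g * w * g⁻¹) (g * (g⁻¹ * n * g⁻¹⁻¹) * g⁻¹) := by
    have := this.eq
    show g * w * g⁻¹ * (g * (g⁻¹ * n * g⁻¹⁻¹) * g⁻¹) = g * (g⁻¹ * n * g⁻¹⁻¹) * g⁻¹ * (g * w * g⁻¹)
    calc _ = g * (w * (g⁻¹ * n * g⁻¹⁻¹)) * g⁻¹ := by group
      _ = _ := by rw [this]; group
  rwa [show g * (g⁻¹ * n * g⁻¹⁻¹) * g⁻¹ = n by group] at h4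

theorem WS_nontriv {e x : G} (hx : O3 x) (he : e ∈ NS hG) (he2 : e ^ 2 = 1) (he1 : e ≠ 1) :
    ∃ w ∈ WS hG, w ≠ 1 := by
  by_cases hab : ∀ n ∈ NS hG, Commute e n
  · exact ⟨e, ⟨he, he2, hab⟩, he1⟩
  · push Not at hab
    obtain ⟨n, hn, hc⟩ := hab
    have hbn : br e n ∈ NS hG := by
      unfold br
      exact mul_mem (mul_mem (mul_mem he hn) (inv_mem he)) (inv_mem hn)
    have hb1 : br e n ≠ 1 := by
      intro h
      apply hc
      unfold br at h
      have : e * n * (n * e)⁻¹ = 1 := by rw [mul_inv_rev, ← mul_assoc]; exact h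
      exact mul_inv_eq_one.1 this
    obtain ⟨k, hk⟩ := NS_two hG hbn
    obtain ⟨m, hm1, hm2⟩ := Hyp.exists_inv_pow hk hb1
    exact ⟨br e n ^ m, ⟨pow_mem hbn m, hm2, fun l hl => (NS_br hG hx he hn hl).pow_left m⟩, hm1⟩

instance WS_comm : CommGroup (WS hG) :=
  { (inferInstance : Group (WS hG)) with
    mul_comm := by
      rintro ⟨a, ha⟩ ⟨b, hb⟩
      apply Subtype.ext
      exact ((WS_mem hG).1 ha).2.2 b hb.1 }

/-- conjugation action on W -/
def WSphi : G →* AddMonoid.End (Additive (WS hG)) where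
  toFun g := (MulAut.conjNormal (H := WS hG) g : WS hG →* WS hG).toAdditive
  map_one' := by
    ext w
    simp
    rfl
  map_mul' g h := by
    ext w
    simp
    rfl
end NN


section NN
variable {G : Type*} [Group G] (hG : Hyp G)

theorem WSphi_apply (g : G) (w : WS hG) :
    ((Additive.toMul (WSphi hG g (Additive.ofMul w)) : WS hG) : G) = g * w * g⁻¹ := rfl

theorem WSphi_quad {x : G} (hx : O3 x) :
    WSphi hG x * WSphi hG x + WSphi hG x + 1 = 0 := by
  refine AddMonoidHom.ext fun w => ?_
  have hw := (Additive.toMul w : WS hG).2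
  apply Additive.toMul.injective
  apply Subtype.ext
  show (x * (x * (Additive.toMul w : WS hG) * x⁻¹) * x⁻¹) * (x * (Additive.toMul w : WS hG) * x⁻¹)
    * (Additive.toMul w : WS hG) = 1
  generalize ((Additive.toMul w : WS hG) : G) = n at *
  have := NL1 (N := NS hG) (fun n hn x hx hx1 => hn x ⟨hx, hx1⟩) hw.1 hx.1 hx.2
  have c1 := hw.2.2 _ ((NS_normal hG).conj_mem n hw.1 x)
  have e : x⁻¹ * n * x = x * (x * n * x⁻¹) * x⁻¹ := by
    have h1 : x⁻¹ = x * x := inv_eq_sq hx.1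
    have h2 : x = x⁻¹ * x⁻¹ := by
      have := inv_eq_sq hx.inv.1
      rwa [inv_inv] at this
    calc x⁻¹ * n * x = (x * x) * n * (x⁻¹ * x⁻¹) := by rw [← h1, ← h2]
      _ = _ := by group
  rw [e] at this
  rw [c1.eq] at this
  generalize x * (x * n * x⁻¹) * x⁻¹ = c at *
  have h3 := eq_inv_of_mul_eq_one_right this
  rw [h3]; group

theorem WSphi_two : (1 : AddMonoid.End (Additive (WS hG))) + 1 = 0 := by
  refine AddMonoidHom.ext fun w => ?_
  apply Additive.toMul.injective
  apply Subtype.ext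
  show ((Additive.toMul w : WS hG) : G) * (Additive.toMul w : WS hG) = 1
  rw [← pow_two]
  exact (Additive.toMul w : WS hG).2.2.1

theorem WSphi_one {w : G} (hw : w ∈ WS hG) (hw1 : w ≠ 1) :
    (1 : AddMonoid.End (Additive (WS hG))) ≠ 0 := by
  intro h
  apply hw1
  have h1 := DFunLike.congr_fun h (Additive.ofMul (⟨w, hw⟩ : WS hG))
  have h2 := congrArg (fun v => ((Additive.toMul v : WS hG) : G)) h1
  exact h2

include hG in
theorem Hyp.caseB_LF {e x : G} (hx : O3 x) (he2 : e ^ 2 = 1) (he1 : e ≠ 1)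
    (he : ∀ x : G, x ^ 3 = 1 → x ≠ 1 → (e * x) ^ 3 = 1) : LF G := by
  have heN : e ∈ NS hG := by
    intro y hy
    refine ⟨he y hy.1 hy.2, ?_⟩
    intro h
    have : e = y⁻¹ := eq_inv_of_mul_eq_one_left h
    apply he1
    have e3 : e ^ 3 = 1 := by rw [this]; exact hy.inv.1
    rw [pow_succ, he2, one_mul] at e3
    exact e3
  obtain ⟨w, hw, hw1⟩ := WS_nontriv hG hx heN he2 he1
  have h01 := WSphi_one hG hw hw1
  have h2 := WSphi_two hG
  have hφ : ∀ x : G, O3 x → WSphi hG x * WSphi hG x + WSphi hG x + 1 = 0 :=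
    fun x hx => WSphi_quad hG hx
  apply LF.ext (NS hG) (NS_LF hG hx)
  have : Finite (G ⧸ NS hG) := by
    apply Q_finite (u := (QuotientGroup.mk x : G ⧸ NS hG))
    · rw [← QuotientGroup.mk_pow, hx.1, QuotientGroup.mk_one]
    · intro h
      rw [QuotientGroup.eq_one_iff] at h
      exact hx.2 (NS_three hG h hx.1)
    · intro q
      induction q using QuotientGroup.induction_on with | H g => ?_
      rcases hG.tor g with ⟨k, h⟩ | h
      · left; exact ⟨k, by rw [← QuotientGroup.mk_pow, h, QuotientGroup.mk_one]⟩
      · right; rw [← QuotientGroup.mk_pow, h, QuotientGroup.mk_one]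
    · intro q hq
      induction q using QuotientGroup.induction_on with | H g => ?_
      rw [← QuotientGroup.mk_pow, QuotientGroup.eq_one_iff] at hq
      rcases hG.tor g with ⟨k, h⟩ | h
      · left
        have h1 : (QuotientGroup.mk g : G ⧸ NS hG) ^ 2 ^ k = 1 := by
          rw [← QuotientGroup.mk_pow, h, QuotientGroup.mk_one]
        have h3 : (QuotientGroup.mk g : G ⧸ NS hG) ^ 3 = 1 := by
          rw [← QuotientGroup.mk_pow, QuotientGroup.eq_one_iff]; exact hq
        have hc : Nat.Coprime (2 ^ k) 3 := by
          apply Nat.Coprime.pow_left; norm_num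
        have d := Nat.dvd_gcd (orderOf_dvd_of_pow_eq_one h1) (orderOf_dvd_of_pow_eq_one h3)
        rw [hc] at d
        exact orderOf_eq_one_iff.1 (Nat.dvd_one.1 d)
      · have g3 : g ^ 3 = 1 := NS_three hG hq (by rw [← pow_mul]; exact h)
        by_cases g1 : g = 1
        · left; rw [g1, QuotientGroup.mk_one]
        · right
          have hg : O3 g := ⟨g3, g1⟩
          rcases sim_or hG h2 h01 (WSphi hG) hφ hg hx with h' | h'
          · left
            have : (g * x⁻¹) ∈ NS hG := fun z hz => sim_N hG h2 h01 (WSphi hG) hφ hg hx hz h'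
            have h4 := (QuotientGroup.eq_one_iff _).2 this
            rw [QuotientGroup.mk_mul, QuotientGroup.mk_inv] at h4
            exact mul_inv_eq_one.1 h4
          · right
            have : (g * x⁻¹⁻¹) ∈ NS hG :=
              fun z hz => sim_N hG h2 h01 (WSphi hG) hφ hg hx.inv hz h'
            have h4 := (QuotientGroup.eq_one_iff _).2 this
            rw [QuotientGroup.mk_mul, QuotientGroup.mk_inv, QuotientGroup.mk_inv] at h4
            exact mul_inv_eq_one.1 h4
  exact LF.of_finite _

include hG in
theorem Hyp.LF_main {a x : G} (ha : a ^ 2 = 1) (ha1 : a ≠ 1) (hx : x ^ 3 = 1) (hx1 : x ≠ 1) :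
    LF G := by
  by_cases hA : ∀ a b : G, a ^ 2 = 1 → b ^ 2 = 1 → a ≠ 1 → b ≠ 1 → Commute a b → a = b
  · exact hG.caseA_LF hA ha ha1
  · push Not at hA
    obtain ⟨b, c, hb, hc, hb1, hc1, hbc, hne⟩ := hA
    obtain ⟨e, he2, he1, he⟩ := hG.exists_good hb hc hb1 hc1 hne hbc
    exact Hyp.caseB_LF hG ⟨hx, hx1⟩ he2 he1 he
end NN

theorem HypH.order {G : Type*} [Group G] (hG : HypH G)
    (h6 : ∀ g : G, orderOf g ≠ 6) (h27 : ∀ g : G, orderOf g ≠ 27) (g : G) :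
    (∃ k : ℕ, orderOf g = 2 ^ k) ∨ orderOf g ∣ 9 := by
  have h0 : orderOf g ≠ 0 := (hG.1 g).orderOf_pos.ne'
  have hp : ∀ p : ℕ, p.Prime → p ∣ orderOf g → p = 2 ∨ p = 3 :=
    fun p hp hd => (hG.2.1 p hp).1 ⟨g, hd⟩
  have hsix : ¬ (2 ∣ orderOf g ∧ 3 ∣ orderOf g) := by
    rintro ⟨a, b⟩
    have : 6 ∣ orderOf g := by omega
    exact h6 _ (orderOf_pow_orderOf_div h0 this)
  by_cases h3 : 3 ∣ orderOf g
  · right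
    have h := Nat.eq_prime_pow_of_unique_prime_dvd (p := 3) h0 (by
      intro d hd hdd
      rcases hp d hd hdd with h | h
      · subst h; exact (hsix ⟨hdd, h3⟩).elim
      · exact h)
    generalize (orderOf g).primeFactorsList.length = k at h
    by_cases hk : 3 ≤ k
    · exfalso
      have : 27 ∣ orderOf g := by
        rw [h]; exact pow_dvd_pow 3 hk
      exact h27 _ (orderOf_pow_orderOf_div h0 this)
    · rw [h, show 9 = 3 ^ 2 by norm_num]
      exact pow_dvd_pow 3 (by omega)
  · left
    have h := Nat.eq_prime_pow_of_unique_prime_dvd (p := 2) h0 (by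
      intro d hd hdd
      rcases hp d hd hdd with h | h
      · exact h
      · subst h; exact (h3 hdd).elim)
    exact ⟨_, h⟩

theorem HypH.toHyp {G : Type*} [Group G] (hG : HypH G)
    (h6 : ∀ g : G, orderOf g ≠ 6) (h27 : ∀ g : G, orderOf g ≠ 27) : Hyp G where
  tor g := by
    rcases hG.order h6 h27 g with ⟨k, h⟩ | h
    · left; exact ⟨k, by rw [← h, pow_orderOf_eq_one]⟩
    · right; exact orderOf_dvd_iff_pow_eq_one.1 h
  prod x y hx hy := by
    have small : ∀ x : G, x ^ 4 = 1 ∨ x ^ 3 = 1 → orderOf x ≤ 4 := by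
      rintro x (h | h)
      · exact orderOf_le_of_pow_eq_one (by norm_num) h
      · exact (orderOf_le_of_pow_eq_one (by norm_num) h).trans (by norm_num)
    have h9 := hG.2.2 x y (small x hx) (small y hy)
    rcases hG.order h6 h27 (x * y) with ⟨k, h⟩ | h
    · left
      rw [← orderOf_dvd_iff_pow_eq_one, h, show 8 = 2 ^ 3 by norm_num]
      apply pow_dvd_pow
      by_contra hk
      have : 2 ^ 4 ≤ 2 ^ k := Nat.pow_le_pow_right (by norm_num) (by omega)
      omega
    · right; exact orderOf_dvd_iff_pow_eq_one.1 h
  six a x ha hx hc := by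
    by_contra hcon
    push Not at hcon
    have o2 : orderOf a = 2 := orderOf_eq_prime ha hcon.1
    have o3 : orderOf x = 3 := orderOf_eq_prime hx hcon.2
    apply h6 (a * x)
    rw [hc.orderOf_mul_eq_mul_orderOf_of_coprime (by rw [o2, o3]; norm_num), o2, o3]

/-- Corollary 2: a group satisfying (H) with no element of order 6 and no element of
order 27 is locally finite. -/
theorem statement_4 (G : Type*) [Group G] (hG : HypH G)
    (h6 : ∀ g : G, orderOf g ≠ 6) (h27 : ∀ g : G, orderOf g ≠ 27) :
    ∀ S : Subgroup G, S.FG → Finite S := by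
  have exi : ∀ p : ℕ, p.Prime → p = 2 ∨ p = 3 → ∃ a : G, a ^ p = 1 ∧ a ≠ 1 := by
    intro p hp h
    obtain ⟨g, hg⟩ := (hG.2.1 p hp).2 h
    have := orderOf_pow_orderOf_div (hG.1 g).orderOf_pos.ne' hg
    refine ⟨g ^ (orderOf g / p), orderOf_dvd_iff_pow_eq_one.1 this.dvd, ?_⟩
    intro h1
    rw [h1, orderOf_one] at this
    exact hp.one_lt.ne this
  obtain ⟨a, ha, ha1⟩ := exi 2 Nat.prime_two (Or.inl rfl)
  obtain ⟨x, hx, hx1⟩ := exi 3 Nat.prime_three (Or.inr rfl)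
  exact Hyp.LF_main (hG.toHyp h6 h27) ha ha1 hx hx1
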